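/- (Generalized Viro patchworking.) Let P_t = Σ A_{i,j}(t) x^i y^j ∈ ℝ[t,x,y], and suppose there is t₁ > 0 such that for all t ∈ (0,t₁) the Newton polygon of P_t (as a polynomial in x,y) is a fixed two-dimensional lattice polygon Θ. Let Θ̂ ⊂ ℝ³ be the Newton polytope of P_t in the variables (t,x,y), let Θ̂_c be the union of the compact faces of Θ̂ + (ℝ_{≥0}×{(0,0)}), and let Θ' be the convex polyhedral subdivision of Θ obtained by projecting the faces of Θ̂_c via (k,i,j) ↦ (i,j). Assume that for every face Λ̂ of Θ̂ contained in Θ̂_c, with projection Λ, the polynomial P^Λ̂_1 is real nondegenerate with respect to Λ. Then there exists t₀ > 0 such that for every t ∈ (0,t₀) there is a homeomorphism h of Θ̃ onto itself which maps ρ(Φ) onto ρ(Φ) for every face Φ of Θ and every ρ ∈ S, and which maps Ch_Θ(P_t) onto the union ⋃_Λ Ch_Λ(P^Λ̂_1), the union taken over the two-dimensional cells Λ of Θ'. -/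

import Mathlib

noncomputable section

/-- Embedding of an integral point into the real plane. -/
def latticeEmb (p : ℤ × ℤ) : ℝ × ℝ := ((p.1 : ℝ), (p.2 : ℝ))

/-- The real torus (ℝ*)². -/
def realTorus : Set (ℝ × ℝ) := {q : ℝ × ℝ | q.1 ≠ 0 ∧ q.2 ≠ 0}

/-- The orthogonal reflection ρ_{i,j} with respect to the coordinate axes. -/
def quadRefl (s : Bool × Bool) (q : ℝ × ℝ) : ℝ × ℝ :=
  ((if s.1 then -q.1 else q.1), (if s.2 then -q.2 else q.2))

/-- Ã : the union of the four reflected copies of A. -/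
def tildeSet (A : Set (ℝ × ℝ)) : Set (ℝ × ℝ) := ⋃ s : Bool × Bool, quadRefl s '' A

/-- The moment map associated to a (bounded) region `Λ`. -/
def momentMap (Λ : Set (ℝ × ℝ)) (q : ℝ × ℝ) : ℝ × ℝ :=
  (∑ᶠ (p : ℤ × ℤ) (_ : latticeEmb p ∈ Λ), q.1 ^ p.1 * q.2 ^ p.2)⁻¹ •
    ∑ᶠ (p : ℤ × ℤ) (_ : latticeEmb p ∈ Λ), (q.1 ^ p.1 * q.2 ^ p.2) • latticeEmb p

/-- The symmetric extension φ̃_Λ of the moment map to (ℝ*)². -/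
def tildeMomentMap (Λ : Set (ℝ × ℝ)) (q : ℝ × ℝ) : ℝ × ℝ :=
  (Real.sign q.1 * (momentMap Λ (|q.1|, |q.2|)).1,
   Real.sign q.2 * (momentMap Λ (|q.1|, |q.2|)).2)

/-- Evaluation of a real polynomial in two variables at a point of the plane. -/
def evalQ (q : ℝ × ℝ) (Q : MvPolynomial (Fin 2) ℝ) : ℝ :=
  MvPolynomial.eval ![q.1, q.2] Q

/-- The symbolic restriction (truncation) of `Q` to the monomials with exponents in `Φ`. -/
def trunc (Q : MvPolynomial (Fin 2) ℝ) (Φ : Set (ℝ × ℝ)) : MvPolynomial (Fin 2) ℝ :=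
  ∑ᶠ (d : Fin 2 →₀ ℕ) (_ : ((d 0 : ℝ), (d 1 : ℝ)) ∈ Φ),
    MvPolynomial.monomial d (MvPolynomial.coeff d Q)

/-- The Newton polygon of a polynomial: the convex hull of its support. -/
def newtonPolygon (Q : MvPolynomial (Fin 2) ℝ) : Set (ℝ × ℝ) :=
  convexHull ℝ ((fun d : Fin 2 →₀ ℕ => ((d 0 : ℝ), (d 1 : ℝ))) '' (Q.support : Set (Fin 2 →₀ ℕ)))

/-- `Q` is real nondegenerate with respect to the polygon `Θ`. -/
def RealNonDeg (Q : MvPolynomial (Fin 2) ℝ) (Θ : Set (ℝ × ℝ)) : Prop :=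
  ∀ Φ : Set (ℝ × ℝ), Φ.Nonempty → IsExposed ℝ Θ Φ → ∀ q ∈ realTorus,
    evalQ q (trunc Q Φ) = 0 →
      evalQ q (MvPolynomial.pderiv 0 (trunc Q Φ)) ≠ 0 ∨
      evalQ q (MvPolynomial.pderiv 1 (trunc Q Φ)) ≠ 0

/-- The Λ-chart of the real curve defined by `Q`. -/
def chart (Λ : Set (ℝ × ℝ)) (Q : MvPolynomial (Fin 2) ℝ) : Set (ℝ × ℝ) :=
  closure (tildeMomentMap Λ '' {q ∈ realTorus | evalQ q Q = 0})

/-- Embedding of the exponent of a monomial in the variables (t,x,y) into ℝ³. -/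
def expEmb3 (d : Fin 3 →₀ ℕ) : ℝ × ℝ × ℝ := ((d 0 : ℝ), (d 1 : ℝ), (d 2 : ℝ))

/-- The projection (k,i,j) ↦ (i,j). -/
def proj23 (p : ℝ × ℝ × ℝ) : ℝ × ℝ := (p.2.1, p.2.2)

/-- The Newton polytope Θ̂ ⊂ ℝ³ of `P` viewed as a polynomial in (t,x,y). -/
def newtonPolytope3 (P : MvPolynomial (Fin 3) ℝ) : Set (ℝ × ℝ × ℝ) :=
  convexHull ℝ (expEmb3 '' (P.support : Set (Fin 3 →₀ ℕ)))

/-- The Minkowski sum Θ̂ + (ℝ_{≥0} × {(0,0)}). -/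
def raisedPolytope (P : MvPolynomial (Fin 3) ℝ) : Set (ℝ × ℝ × ℝ) :=
  {p : ℝ × ℝ × ℝ | ∃ a ∈ newtonPolytope3 P, ∃ s : ℝ, 0 ≤ s ∧ p = a + ((s, 0, 0) : ℝ × ℝ × ℝ)}

/-- The lower part Θ̂_c of Θ̂: the union of the compact faces of Θ̂ + (ℝ_{≥0} × {(0,0)}). -/
def lowerPart (P : MvPolynomial (Fin 3) ℝ) : Set (ℝ × ℝ × ℝ) :=
  ⋃₀ {F : Set (ℝ × ℝ × ℝ) | IsExposed ℝ (raisedPolytope P) F ∧ IsCompact F}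

/-- The polynomial `P_t ∈ ℝ[x,y]` obtained by substituting the real value `t` for the first
variable of `P ∈ ℝ[t,x,y]`. -/
def substT (P : MvPolynomial (Fin 3) ℝ) (t : ℝ) : MvPolynomial (Fin 2) ℝ :=
  ∑ᶠ d : Fin 3 →₀ ℕ,
    MvPolynomial.monomial (Finsupp.single 0 (d 1) + Finsupp.single 1 (d 2))
      (MvPolynomial.coeff d P * t ^ (d 0))

/-- The polynomial `P^Λ̂_1 ∈ ℝ[x,y]`: the restriction of `P` to the monomials `t^k x^i y^j`
with `(k,i,j) ∈ F`, followed by the substitution `t = 1`. -/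
def truncAtOne (P : MvPolynomial (Fin 3) ℝ) (F : Set (ℝ × ℝ × ℝ)) : MvPolynomial (Fin 2) ℝ :=
  ∑ᶠ (d : Fin 3 →₀ ℕ) (_ : expEmb3 d ∈ F),
    MvPolynomial.monomial (Finsupp.single 0 (d 1) + Finsupp.single 1 (d 2))
      (MvPolynomial.coeff d P)

namespace Viro

open Set Filter Topology

section Graph

variable {X Z : Type*} [TopologicalSpace X] [TopologicalSpace Z]

/-- A function with values in a compact set and determined by a closed relation is continuous. -/
theorem continuousOn_of_closed_relation {K : Set X} {D : Set Z} {R : Set (X × Z)} {y : X → Z}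
    (hD : IsCompact D) (hR : IsClosed R) (hy : ∀ x ∈ K, y x ∈ D ∧ (x, y x) ∈ R)
    (huniq : ∀ x ∈ K, ∀ z ∈ D, (x, z) ∈ R → z = y x) : ContinuousOn y K := by
  intro x hx
  refine hD.tendsto_nhds_of_unique_mapClusterPt (l := 𝓝[K] x) ?_ ?_
  · filter_upwards [self_mem_nhdsWithin] with a ha using (hy a ha).1
  · intro z hz hcl
    obtain ⟨U, hU, hUz⟩ := mapClusterPt_iff_ultrafilter.1 hcl
    refine huniq x hx z hz ?_
    have h1 : Tendsto (fun a => (a, y a)) (U : Filter X) (𝓝 (x, z)) :=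
      (tendsto_id'.2 (hU.trans nhdsWithin_le_nhds)).prodMk_nhds hUz
    refine hR.mem_of_tendsto h1 ?_
    filter_upwards [hU self_mem_nhdsWithin] with a ha using (hy a ha).2

end Graph

section Toric

variable {ι : Type*} [Fintype ι]

/-- The barycentre of the points `v i` with weights `z i`. -/
def mom (v : ι → ℝ × ℝ) (z : ι → ℝ) : ℝ × ℝ := ∑ i, z i • v i

/-- The nonnegative part of the toric variety of the configuration `v`, deformed by the
heights `ν` at the time `t`. -/
def toricSlice (v : ι → ℝ × ℝ) (ν : ι → ℝ) (t : ℝ) : Set (ι → ℝ) :=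
  {z | z ∈ stdSimplex ℝ ι ∧ ∀ a b : ι → ℝ, (∀ i, 0 ≤ a i) → (∀ i, 0 ≤ b i) →
    ∑ i, a i = ∑ i, b i → mom v a = mom v b → ∑ i, ν i * b i ≤ ∑ i, ν i * a i →
    ∏ i, z i ^ a i = t ^ (∑ i, ν i * a i - ∑ i, ν i * b i) * ∏ i, z i ^ b i}

variable {v : ι → ℝ × ℝ} {ν : ι → ℝ}

theorem mom_fst (z : ι → ℝ) : (mom v z).1 = ∑ i, z i * (v i).1 := by
  simp [mom, Prod.fst_sum]

theorem mom_snd (z : ι → ℝ) : (mom v z).2 = ∑ i, z i * (v i).2 := by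
  simp [mom, Prod.snd_sum]

theorem map_mom (l : ℝ × ℝ →L[ℝ] ℝ) (z : ι → ℝ) : l (mom v z) = ∑ i, z i * l (v i) := by
  simp [mom]

theorem continuous_mom : Continuous (mom v) := by
  unfold mom; fun_prop

theorem mom_mem_convexHull {z : ι → ℝ} (hz : z ∈ stdSimplex ℝ ι) :
    mom v z ∈ convexHull ℝ (range v) := by
  refine (convex_convexHull ℝ (range v)).sum_mem (fun i _ => hz.1 i) hz.2 fun i _ =>
    subset_convexHull ℝ _ (mem_range_self i)

theorem isClosed_toricSlice :
    IsClosed {p : ℝ × (ι → ℝ) | p.2 ∈ toricSlice v ν p.1} := by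
  have : {p : ℝ × (ι → ℝ) | p.2 ∈ toricSlice v ν p.1} =
      {p : ℝ × (ι → ℝ) | p.2 ∈ stdSimplex ℝ ι} ∩ ⋂ (a : ι → ℝ) (b : ι → ℝ)
        (_ : ∀ i, 0 ≤ a i) (_ : ∀ i, 0 ≤ b i) (_ : ∑ i, a i = ∑ i, b i)
        (_ : mom v a = mom v b) (_ : ∑ i, ν i * b i ≤ ∑ i, ν i * a i),
        {p : ℝ × (ι → ℝ) | ∏ i, p.2 i ^ a i =
          p.1 ^ (∑ i, ν i * a i - ∑ i, ν i * b i) * ∏ i, p.2 i ^ b i} := by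
    ext p; simp [toricSlice]
  rw [this]
  refine ((isClosed_stdSimplex ℝ ι).preimage continuous_snd).inter ?_
  refine isClosed_iInter fun a => isClosed_iInter fun b => isClosed_iInter fun ha =>
    isClosed_iInter fun hb => isClosed_iInter fun _ => isClosed_iInter fun _ =>
    isClosed_iInter fun hν => isClosed_eq ?_ ?_
  · refine continuous_finsetProd _ fun i _ => ?_
    exact ((continuous_apply i).comp continuous_snd).rpow_const fun _ => Or.inr (ha i)
  · refine (continuous_fst.rpow_const fun _ => Or.inr (by linarith)).mul ?_
    refine continuous_finsetProd _ fun i _ => ?_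
    exact ((continuous_apply i).comp continuous_snd).rpow_const fun _ => Or.inr (hb i)

/-- Raising to the powers `(z - z')⁺` strictly separates `z` from `z'`. -/
theorem prod_rpow_lt {z z' : ι → ℝ} (hz' : ∀ i, 0 ≤ z' i)
    (hne : ∃ i, z' i < z i) :
    ∏ i, z' i ^ max (z i - z' i) 0 < ∏ i, z i ^ max (z i - z' i) 0 := by
  have hpos : ∀ i, 0 < z i ^ max (z i - z' i) 0 := by
    intro i
    rcases le_or_gt (z i) (z' i) with h | h
    · rw [max_eq_right (by linarith)]; simp
    · exact Real.rpow_pos_of_pos ((hz' i).trans_lt h) _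
  have hle : ∀ i, z' i ^ max (z i - z' i) 0 ≤ z i ^ max (z i - z' i) 0 := by
    intro i
    rcases le_or_gt (z i) (z' i) with h | h
    · rw [max_eq_right (by linarith)]; simp
    · exact Real.rpow_le_rpow (hz' i) h.le (le_max_right _ _)
  by_cases h0 : ∃ i, z' i ^ max (z i - z' i) 0 = 0
  · obtain ⟨i, hi⟩ := h0
    rw [Finset.prod_eq_zero (Finset.mem_univ i) hi]
    exact Finset.prod_pos fun i _ => hpos i
  · push Not at h0
    obtain ⟨i, hi⟩ := hne
    refine Finset.prod_lt_prod (fun i _ => ?_) (fun i _ => hle i) ⟨i, Finset.mem_univ i, ?_⟩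
    · exact (Real.rpow_nonneg (hz' i) _).lt_of_ne (h0 i).symm
    · exact Real.rpow_lt_rpow (hz' i) hi (by rw [lt_max_iff]; left; linarith)

theorem prod_rpow_le {z z' : ι → ℝ} (hz : ∀ i, 0 ≤ z i) :
    ∏ i, z i ^ max (z' i - z i) 0 ≤ ∏ i, z' i ^ max (z' i - z i) 0 := by
  refine Finset.prod_le_prod (fun i _ => Real.rpow_nonneg (hz i) _) fun i _ => ?_
  rcases le_or_gt (z' i) (z i) with h | h
  · rw [max_eq_right (by linarith)]; simp
  · exact Real.rpow_le_rpow (hz i) h.le (le_max_right _ _)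

theorem toricSlice_injOn {t : ℝ} (ht : 0 ≤ t) : InjOn (mom v) (toricSlice v ν t) := by
  have key : ∀ z ∈ toricSlice v ν t, ∀ z' ∈ toricSlice v ν t, mom v z = mom v z' →
      ∑ i, ν i * z' i ≤ ∑ i, ν i * z i → z = z' := by
    intro z hz z' hz' hm hν
    by_contra hne
    have hex : ∃ i, z' i < z i := by
      by_contra! hle
      refine hne (funext fun i => ?_)
      have := (Finset.sum_eq_sum_iff_of_le (fun i _ => hle i)).1 (hz.1.2.trans hz'.1.2.symm)
      exact this i (Finset.mem_univ i)
    have hdiff : ∀ i, max (z i - z' i) 0 = max (z' i - z i) 0 + (z i - z' i) := by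
      intro i
      rcases le_total (z i) (z' i) with h | h
      · rw [max_eq_right (by linarith), max_eq_left (by linarith)]; ring
      · rw [max_eq_left (by linarith), max_eq_right (by linarith)]; ring
    have hsum : ∑ i, max (z i - z' i) 0 = ∑ i, max (z' i - z i) 0 := by
      simp_rw [hdiff]
      rw [Finset.sum_add_distrib, Finset.sum_sub_distrib, hz.1.2, hz'.1.2]; ring
    have hmom : mom v (fun i => max (z i - z' i) 0) = mom v (fun i => max (z' i - z i) 0) := by
      simp_rw [hdiff]
      have : mom v (fun i => max (z' i - z i) 0 + (z i - z' i)) =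
          mom v (fun i => max (z' i - z i) 0) + (mom v z - mom v z') := by
        simp [mom, add_smul, sub_smul, Finset.sum_add_distrib]
      rw [this, hm]; simp
    have hheight : ∑ i, ν i * max (z' i - z i) 0 ≤ ∑ i, ν i * max (z i - z' i) 0 := by
      simp_rw [hdiff, mul_add, mul_sub]
      rw [Finset.sum_add_distrib, Finset.sum_sub_distrib]; linarith
    have e1 := hz.2 _ _ (fun i => le_max_right (z i - z' i) 0)
      (fun i => le_max_right (z' i - z i) 0) hsum hmom hheight
    have e2 := hz'.2 _ _ (fun i => le_max_right (z i - z' i) 0)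
      (fun i => le_max_right (z' i - z i) 0) hsum hmom hheight
    have h1 := prod_rpow_lt hz'.1.1 hex
    have h2 := prod_rpow_le (z' := z') hz.1.1
    have h3 := mul_le_mul_of_nonneg_left h2
      (Real.rpow_nonneg ht (∑ i, ν i * max (z i - z' i) 0 - ∑ i, ν i * max (z' i - z i) 0))
    rw [← e1, ← e2] at h3
    linarith
  intro z hz z' hz' hm
  rcases le_total (∑ i, ν i * z' i) (∑ i, ν i * z i) with h | h
  · exact key z hz z' hz' hm h
  · exact (key z' hz' z hz hm.symm h).symm

/-- The point of the simplex with homogeneous coordinates `w i * exp ⟨θ, v i⟩`. -/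
def gibbs (v : ι → ℝ × ℝ) (w : ι → ℝ) (θ : ℝ × ℝ) (i : ι) : ℝ :=
  w i * Real.exp (θ.1 * (v i).1 + θ.2 * (v i).2) /
    ∑ j, w j * Real.exp (θ.1 * (v j).1 + θ.2 * (v j).2)

theorem prod_normalized_rpow {x : ι → ℝ} (hx : ∀ i, 0 ≤ x i) {N : ℝ} (hN : 0 < N) (a : ι → ℝ) :
    ∏ i, (x i / N) ^ a i = (∏ i, x i ^ a i) * N ^ (-∑ i, a i) := by
  rw [← Finset.sum_neg_distrib, Real.rpow_sum_of_pos hN, ← Finset.prod_mul_distrib]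
  refine Finset.prod_congr rfl fun i _ => ?_
  rw [Real.div_rpow (hx i) hN.le, Real.rpow_neg hN.le, div_eq_mul_inv]

theorem sum_pos_of_pos [Nonempty ι] {x : ι → ℝ} (hx : ∀ i, 0 < x i) : 0 < ∑ i, x i :=
  Finset.sum_pos (fun i _ => hx i) Finset.univ_nonempty

theorem normalized_mem_stdSimplex {x : ι → ℝ} (hx : ∀ i, 0 ≤ x i) (hN : 0 < ∑ i, x i) :
    (fun i => x i / ∑ j, x j) ∈ stdSimplex ℝ ι :=
  ⟨fun i => div_nonneg (hx i) hN.le, by rw [← Finset.sum_div, div_self hN.ne']⟩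

theorem sum_affine_eq {a b : ι → ℝ} (hsum : ∑ i, a i = ∑ i, b i) (hmom : mom v a = mom v b)
    (θ : ℝ × ℝ) (k : ℝ) :
    ∑ i, (θ.1 * (v i).1 + θ.2 * (v i).2 + k) * a i =
      ∑ i, (θ.1 * (v i).1 + θ.2 * (v i).2 + k) * b i := by
  have e : ∀ c : ι → ℝ, ∑ i, (θ.1 * (v i).1 + θ.2 * (v i).2 + k) * c i =
      θ.1 * (mom v c).1 + θ.2 * (mom v c).2 + k * ∑ i, c i := by
    intro c
    rw [mom_fst, mom_snd, Finset.mul_sum, Finset.mul_sum, Finset.mul_sum,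
      ← Finset.sum_add_distrib, ← Finset.sum_add_distrib]
    exact Finset.sum_congr rfl fun i _ => by ring
  rw [e, e, hsum, hmom]

theorem prod_exp_rpow (f a : ι → ℝ) :
    ∏ i, Real.exp (f i) ^ a i = Real.exp (∑ i, f i * a i) := by
  rw [Real.exp_sum]
  exact Finset.prod_congr rfl fun i _ => (Real.exp_mul _ _).symm

theorem gibbs_mem_toricSlice [Nonempty ι] {t : ℝ} (ht : 0 < t) (θ : ℝ × ℝ) :
    gibbs v (fun i => t ^ ν i) θ ∈ toricSlice v ν t := by
  have hpos : ∀ i, 0 < t ^ ν i * Real.exp (θ.1 * (v i).1 + θ.2 * (v i).2) := fun i =>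
    mul_pos (Real.rpow_pos_of_pos ht _) (Real.exp_pos _)
  refine ⟨normalized_mem_stdSimplex (fun i => (hpos i).le) (sum_pos_of_pos hpos), ?_⟩
  intro a b ha hb hsum hmom _
  have hN := sum_pos_of_pos hpos
  have e : ∀ i, t ^ ν i * Real.exp (θ.1 * (v i).1 + θ.2 * (v i).2) =
      Real.exp (Real.log t * ν i + (θ.1 * (v i).1 + θ.2 * (v i).2 + 0)) := by
    intro i; rw [Real.rpow_def_of_pos ht, ← Real.exp_add, add_zero]
  unfold gibbs
  rw [prod_normalized_rpow (fun i => (hpos i).le) hN, prod_normalized_rpow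
    (fun i => (hpos i).le) hN, hsum, ← mul_assoc]
  congr 1
  simp_rw [e]
  rw [prod_exp_rpow, prod_exp_rpow, Real.rpow_def_of_pos ht, ← Real.exp_add]
  congr 1
  simp_rw [add_mul (_ * ν _), mul_assoc (Real.log t)]
  rw [Finset.sum_add_distrib, Finset.sum_add_distrib, sum_affine_eq hsum hmom θ 0,
    ← Finset.mul_sum, ← Finset.mul_sum]
  ring

/-- A linear functional does not exceed its maximum over the vertices. -/
theorem exists_le_of_mem_convexHull {q : ℝ × ℝ} (hq : q ∈ convexHull ℝ (range v))
    (l : ℝ × ℝ →L[ℝ] ℝ) : ∃ i, l q ≤ l (v i) := by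
  by_contra! h
  have : convexHull ℝ (range v) ⊆ {x | l x < l q} :=
    convexHull_min (by rintro _ ⟨i, rfl⟩; exact h i)
      (convex_halfSpace_lt l.toLinearMap.isLinear _)
  exact (lt_irrefl (l q)) (this hq)

/-- The functional `⟨θ, ·⟩`. -/
def pairing (θ : ℝ × ℝ) : ℝ × ℝ →L[ℝ] ℝ :=
  θ.1 • ContinuousLinearMap.fst ℝ ℝ ℝ + θ.2 • ContinuousLinearMap.snd ℝ ℝ ℝ

@[simp] theorem pairing_apply (θ x : ℝ × ℝ) : pairing θ x = θ.1 * x.1 + θ.2 * x.2 := by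
  simp [pairing]

theorem exists_gibbs [Nonempty ι] {q : ℝ × ℝ} (hq : q ∈ interior (convexHull ℝ (range v)))
    {w : ι → ℝ} (hw : ∀ i, 0 < w i) : ∃ θ, mom v (gibbs v w θ) = q := by
  let f : ℝ × ℝ → ℝ := fun θ =>
    ∑ i, w i * Real.exp (θ.1 * ((v i).1 - q.1) + θ.2 * ((v i).2 - q.2))
  have hf : Continuous f := by fun_prop
  obtain ⟨ρ, hρ, hball⟩ := Metric.isOpen_iff.1 isOpen_interior q hq
  obtain ⟨i₀, hi₀⟩ := Finite.exists_min w
  have hlow : ∀ θ : ℝ × ℝ, w i₀ * (ρ / 2) * ‖θ‖ ≤ f θ := by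
    intro θ
    let x : ℝ × ℝ := (q.1 + ρ / 2 * SignType.sign θ.1, q.2 + ρ / 2 * SignType.sign θ.2)
    have hs : ∀ a : ℝ, |ρ / 2 * ((SignType.sign a : SignType) : ℝ)| < ρ := by
      intro a
      rcases lt_trichotomy a 0 with h | h | h
      · rw [sign_neg h]; simp [abs_div, abs_of_pos hρ, hρ]
      · simp [h, hρ]
      · rw [sign_pos h]; simp [abs_div, abs_of_pos hρ, hρ]
    have hx : x ∈ convexHull ℝ (range v) := by
      refine interior_subset (hball ?_)
      rw [Metric.mem_ball, Prod.dist_eq, max_lt_iff, Real.dist_eq, Real.dist_eq]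
      exact ⟨by simpa [x] using hs θ.1, by simpa [x] using hs θ.2⟩
    obtain ⟨i, hi⟩ := exists_le_of_mem_convexHull hx (pairing θ)
    have h1 : ρ / 2 * ‖θ‖ ≤ θ.1 * ((v i).1 - q.1) + θ.2 * ((v i).2 - q.2) := by
      simp only [pairing_apply, x] at hi
      have h2 : θ.1 * (SignType.sign θ.1 : ℝ) = |θ.1| := self_mul_sign θ.1
      have h3 : θ.2 * (SignType.sign θ.2 : ℝ) = |θ.2| := self_mul_sign θ.2
      have h4 : ‖θ‖ ≤ |θ.1| + |θ.2| := by
        rw [Prod.norm_def, max_le_iff]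
        exact ⟨by simp, by simp⟩
      have h5 : ρ / 2 * ‖θ‖ ≤ ρ / 2 * (|θ.1| + |θ.2|) :=
        mul_le_mul_of_nonneg_left h4 (by linarith)
      rw [← h2, ← h3] at h5
      linarith
    have h6 := Real.add_one_le_exp (θ.1 * ((v i).1 - q.1) + θ.2 * ((v i).2 - q.2))
    calc w i₀ * (ρ / 2) * ‖θ‖ = w i₀ * (ρ / 2 * ‖θ‖) := by ring
      _ ≤ w i₀ * Real.exp (θ.1 * ((v i).1 - q.1) + θ.2 * ((v i).2 - q.2)) :=
          mul_le_mul_of_nonneg_left (by linarith) (hw i₀).le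
      _ ≤ w i * Real.exp (θ.1 * ((v i).1 - q.1) + θ.2 * ((v i).2 - q.2)) :=
          mul_le_mul_of_nonneg_right (hi₀ i) (Real.exp_pos _).le
      _ ≤ f θ := Finset.single_le_sum (f := fun i =>
          w i * Real.exp (θ.1 * ((v i).1 - q.1) + θ.2 * ((v i).2 - q.2)))
          (fun j _ => mul_nonneg (hw j).le (Real.exp_pos _).le) (Finset.mem_univ i)
  have hlim : Tendsto f (cocompact (ℝ × ℝ)) atTop := by
    refine tendsto_atTop_mono hlow ?_
    exact (tendsto_norm_cocompact_atTop (E := ℝ × ℝ)).const_mul_atTop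
      (mul_pos (hw i₀) (by linarith))
  obtain ⟨θ, hθ⟩ := hf.exists_forall_le hlim
  have hcrit : ∀ e : ℝ × ℝ, ∑ i, w i * (Real.exp (θ.1 * ((v i).1 - q.1) +
      θ.2 * ((v i).2 - q.2)) * (e.1 * ((v i).1 - q.1) + e.2 * ((v i).2 - q.2))) = 0 := by
    intro e
    have hd : HasDerivAt (fun s : ℝ => f (θ + s • e)) (∑ i, w i * (Real.exp
        ((θ + (0:ℝ) • e).1 * ((v i).1 - q.1) + (θ + (0:ℝ) • e).2 * ((v i).2 - q.2)) *
        (e.1 * ((v i).1 - q.1) + e.2 * ((v i).2 - q.2)))) 0 := by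
      refine HasDerivAt.fun_sum fun i _ => ?_
      refine HasDerivAt.const_mul _ (HasDerivAt.exp ?_)
      have h1 : HasDerivAt (fun s : ℝ => (θ + s • e).1) e.1 0 := by
        simpa using ((hasDerivAt_id (0:ℝ)).mul_const e.1).const_add θ.1
      have h2 : HasDerivAt (fun s : ℝ => (θ + s • e).2) e.2 0 := by
        simpa using ((hasDerivAt_id (0:ℝ)).mul_const e.2).const_add θ.2
      exact (h1.mul_const _).add (h2.mul_const _)
    have hmin : IsLocalMin (fun s : ℝ => f (θ + s • e)) 0 := by
      refine Eventually.of_forall fun s => ?_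
      simpa using hθ (θ + s • e)
    have := hmin.hasDerivAt_eq_zero hd
    simpa using this
  refine ⟨θ, ?_⟩
  have hpos : ∀ i, 0 < w i * Real.exp (θ.1 * (v i).1 + θ.2 * (v i).2) := fun i =>
    mul_pos (hw i) (Real.exp_pos _)
  have hN := sum_pos_of_pos hpos
  have hcrit' : ∀ e : ℝ × ℝ, ∑ i, w i * Real.exp (θ.1 * (v i).1 + θ.2 * (v i).2) *
      (e.1 * ((v i).1 - q.1) + e.2 * ((v i).2 - q.2)) = 0 := by
    intro e
    have h := hcrit e
    have h2 : ∀ i, Real.exp (θ.1 * ((v i).1 - q.1) + θ.2 * ((v i).2 - q.2)) =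
      Real.exp (-(θ.1 * q.1 + θ.2 * q.2)) * Real.exp (θ.1 * (v i).1 + θ.2 * (v i).2) := by
      intro i; rw [← Real.exp_add]; congr 1; ring
    simp_rw [h2] at h
    have h3 : ∑ i, w i * Real.exp (θ.1 * (v i).1 + θ.2 * (v i).2) *
        (e.1 * ((v i).1 - q.1) + e.2 * ((v i).2 - q.2)) * Real.exp (-(θ.1 * q.1 + θ.2 * q.2))
        = 0 := by
      rw [← h]; exact Finset.sum_congr rfl fun i _ => by ring
    rw [← Finset.sum_mul] at h3
    exact (mul_eq_zero.1 h3).resolve_right (Real.exp_pos _).ne'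
  ext
  · rw [mom_fst]
    have h := hcrit' (1, 0)
    simp only [one_mul, zero_mul, add_zero] at h
    simp only [mul_sub, Finset.sum_sub_distrib] at h
    rw [← Finset.sum_mul] at h
    simp_rw [gibbs, div_mul_eq_mul_div]
    rw [← Finset.sum_div, div_eq_iff hN.ne']
    linarith
  · rw [mom_snd]
    have h := hcrit' (0, 1)
    simp only [one_mul, zero_mul, zero_add] at h
    simp only [mul_sub, Finset.sum_sub_distrib] at h
    rw [← Finset.sum_mul] at h
    simp_rw [gibbs, div_mul_eq_mul_div]
    rw [← Finset.sum_div, div_eq_iff hN.ne']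
    linarith

omit [Fintype ι] in
theorem nonempty_index (h : (interior (convexHull ℝ (range v))).Nonempty) : Nonempty ι := by
  by_contra hne
  rw [not_nonempty_iff] at hne
  simp [range_eq_empty] at h

theorem exists_mem_toricSlice (hint : (interior (convexHull ℝ (range v))).Nonempty)
    {t : ℝ} (ht : t ∈ Icc (0:ℝ) 1) {q : ℝ × ℝ} (hq : q ∈ convexHull ℝ (range v)) :
    ∃ z ∈ toricSlice v ν t, mom v z = q := by
  have := nonempty_index hint
  let Y : Set (ℝ × (ι → ℝ)) := {p | p.1 ∈ Icc (0:ℝ) 1 ∧ p.2 ∈ toricSlice v ν p.1}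
  have hY : IsCompact Y := by
    refine ((isCompact_Icc (a := (0:ℝ)) (b := 1)).prod
      (isCompact_stdSimplex ℝ ι)).of_isClosed_subset
      ((isClosed_Icc.preimage continuous_fst).inter isClosed_toricSlice) ?_
    rintro ⟨s, z⟩ ⟨hs, hz⟩
    exact ⟨hs, hz.1⟩
  let m : ℝ × (ι → ℝ) → ℝ × (ℝ × ℝ) := fun p => (p.1, mom v p.2)
  have hm : Continuous m := continuous_fst.prodMk (continuous_mom.comp continuous_snd)
  have hcl : IsClosed (m '' Y) := (hY.image hm).isClosed
  have hsub : Ioc (0:ℝ) 1 ×ˢ interior (convexHull ℝ (range v)) ⊆ m '' Y := by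
    rintro ⟨s, x⟩ ⟨hs, hx⟩
    obtain ⟨θ, hθ⟩ := exists_gibbs hx (w := fun i => s ^ ν i)
      fun i => Real.rpow_pos_of_pos hs.1 _
    exact ⟨(s, gibbs v (fun i => s ^ ν i) θ), ⟨⟨hs.1.le, hs.2⟩, gibbs_mem_toricSlice hs.1 θ⟩,
      by simp [m, hθ]⟩
  have hmem : (t, q) ∈ m '' Y := by
    refine hcl.closure_subset_iff.2 hsub ?_
    rw [closure_prod_eq, closure_Ioc (by norm_num),
      (convex_convexHull ℝ _).closure_interior_eq_closure_of_nonempty_interior hint]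
    exact ⟨ht, subset_closure hq⟩
  obtain ⟨⟨s, z⟩, ⟨_, hz⟩, h⟩ := hmem
  obtain ⟨rfl, rfl⟩ := Prod.mk.inj h
  exact ⟨z, hz, rfl⟩

open Classical in
/-- The inverse of the moment map on the slice at the time `t`. -/
def lift (v : ι → ℝ × ℝ) (ν : ι → ℝ) (t : ℝ) (q : ℝ × ℝ) : ι → ℝ :=
  if h : ∃ z ∈ toricSlice v ν t, mom v z = q then h.choose else 0

theorem lift_spec (hint : (interior (convexHull ℝ (range v))).Nonempty)
    {t : ℝ} (ht : t ∈ Icc (0:ℝ) 1) {q : ℝ × ℝ} (hq : q ∈ convexHull ℝ (range v)) :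
    lift v ν t q ∈ toricSlice v ν t ∧ mom v (lift v ν t q) = q := by
  have h := exists_mem_toricSlice (ν := ν) hint ht hq
  rw [lift, dif_pos h]
  exact h.choose_spec

theorem lift_mom {t : ℝ} (ht : 0 ≤ t) {z : ι → ℝ} (hz : z ∈ toricSlice v ν t) :
    lift v ν t (mom v z) = z := by
  have h : ∃ z' ∈ toricSlice v ν t, mom v z' = mom v z := ⟨z, hz, rfl⟩
  rw [lift, dif_pos h]
  exact toricSlice_injOn ht h.choose_spec.1 hz h.choose_spec.2

theorem continuousOn_lift (hint : (interior (convexHull ℝ (range v))).Nonempty) :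
    ContinuousOn (fun p : ℝ × (ℝ × ℝ) => lift v ν p.1 p.2)
      (Icc (0:ℝ) 1 ×ˢ convexHull ℝ (range v)) := by
  refine continuousOn_of_closed_relation (D := stdSimplex ℝ ι)
    (R := {p | p.2 ∈ toricSlice v ν p.1.1 ∧ mom v p.2 = p.1.2})
    (isCompact_stdSimplex ℝ ι) ?_ ?_ ?_
  · refine IsClosed.inter ?_ (isClosed_eq (continuous_mom.comp continuous_snd)
      (continuous_snd.comp continuous_fst))
    exact isClosed_toricSlice.preimage
      ((continuous_fst.comp continuous_fst).prodMk continuous_snd)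
  · rintro ⟨t, q⟩ ⟨ht, hq⟩
    have := lift_spec (ν := ν) hint ht hq
    exact ⟨this.1.1, this⟩
  · rintro ⟨t, q⟩ ⟨ht, hq⟩ z _ ⟨hz, hm⟩
    simp only at hz hm ⊢
    rw [← hm, lift_mom ht.1 hz]

end Toric

section Monotone

variable {ι : Type*} [Fintype ι] {v : ι → ℝ × ℝ} {ν : ι → ℝ}

/-- If `e = ∑ z₀ c₀ v` does not vanish, then every displacement of the barycentre by `τ e` obtained
from an affine change of logarithms increases the value of `c` by at least `δ τ`, as soon as the
weights are positive and close to `z₀`. -/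
theorem eventually_increment_ge {z₀ c₀ : ι → ℝ} (hz₀ : ∀ i, 0 ≤ z₀ i)
    (h0 : ∑ i, z₀ i * c₀ i = 0) (he : mom v (fun i => z₀ i * c₀ i) ≠ 0) :
    ∃ δ > 0, ∀ᶠ p : (ι → ℝ) × (ι → ℝ) in 𝓝 (z₀, c₀), ∀ (θ : ℝ × ℝ) (k τ : ℝ),
      (∀ i, 0 < p.1 i) → 0 ≤ τ →
      ∑ i, p.1 i * (θ.1 * (v i).1 + θ.2 * (v i).2 + k) = 0 →
      mom v (fun i => p.1 i * (θ.1 * (v i).1 + θ.2 * (v i).2 + k)) =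
        τ • mom v (fun i => z₀ i * c₀ i) →
      δ * τ ≤ ∑ i, p.1 i * p.2 i * (θ.1 * (v i).1 + θ.2 * (v i).2 + k) := by
  set e := mom v (fun i => z₀ i * c₀ i) with he_def
  have hn : 0 < e.1 ^ 2 + e.2 ^ 2 := by
    by_contra! hle
    refine he (Prod.ext ?_ ?_)
    · simpa using pow_eq_zero_iff two_ne_zero |>.1
        (le_antisymm (by nlinarith [sq_nonneg e.1, sq_nonneg e.2]) (sq_nonneg e.1))
    · simpa using pow_eq_zero_iff two_ne_zero |>.1
        (le_antisymm (by nlinarith [sq_nonneg e.1, sq_nonneg e.2]) (sq_nonneg e.2))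
  set n := e.1 ^ 2 + e.2 ^ 2 with hn_def
  let Vf : (ι → ℝ) → ℝ := fun w => ∑ i, w i * (e.1 * (v i).1 + e.2 * (v i).2) ^ 2
  set V := Vf z₀ + 1 with hV
  have hVpos : 0 < V := by
    have : 0 ≤ Vf z₀ := Finset.sum_nonneg fun i _ => mul_nonneg (hz₀ i) (sq_nonneg _)
    linarith
  let R : (ι → ℝ) × (ι → ℝ) → ℝ := fun p => ∑ i,
    if z₀ i = 0 then p.1 i * p.2 i ^ 2 else (p.1 i * p.2 i - z₀ i * c₀ i) ^ 2 / p.1 i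
  have hRcont : ContinuousAt R (z₀, c₀) := by
    refine tendsto_finsetSum _ fun i _ => ?_
    by_cases hi : z₀ i = 0
    · simp only [hi, if_true]
      have : Continuous fun p : (ι → ℝ) × (ι → ℝ) => p.1 i * p.2 i ^ 2 := by fun_prop
      simpa [hi] using this.tendsto (z₀, c₀)
    · simp only [hi, if_false]
      have h1 : Continuous fun p : (ι → ℝ) × (ι → ℝ) => (p.1 i * p.2 i - z₀ i * c₀ i) ^ 2 := by
        fun_prop
      have h2 : Continuous fun p : (ι → ℝ) × (ι → ℝ) => p.1 i := by fun_prop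
      exact (h1.tendsto (z₀, c₀)).div (h2.tendsto (z₀, c₀)) hi
  have hR0 : R (z₀, c₀) = 0 := by
    refine Finset.sum_eq_zero fun i _ => ?_
    by_cases hi : z₀ i = 0 <;> simp [hi]
  have hc1 : 0 < n ^ 2 / V := by positivity
  set c₁ := n ^ 2 / V with hc₁
  refine ⟨c₁ / 2, by positivity, ?_⟩
  have evR : ∀ᶠ p : (ι → ℝ) × (ι → ℝ) in 𝓝 (z₀, c₀), R p < c₁ / 4 :=
    hRcont.eventually (gt_mem_nhds (by rw [hR0]; positivity))
  have evV : ∀ᶠ p : (ι → ℝ) × (ι → ℝ) in 𝓝 (z₀, c₀), Vf p.1 < V := by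
    have : Continuous fun p : (ι → ℝ) × (ι → ℝ) => Vf p.1 := by fun_prop
    exact (this.tendsto (z₀, c₀)).eventually (gt_mem_nhds (by simp [hV]))
  filter_upwards [evR, evV] with p hpR hpV θ k τ hw hτ hsum hmom
  obtain ⟨w, c⟩ := p
  simp only at hw hsum hmom hpV ⊢
  set lam : ι → ℝ := fun i => θ.1 * (v i).1 + θ.2 * (v i).2 + k with hlam
  change ∑ i, w i * lam i = 0 at hsum
  change mom v (fun i => w i * lam i) = τ • e at hmom
  change c₁ / 2 * τ ≤ ∑ i, w i * c i * lam i
  have hm1 : ∑ i, w i * lam i * (v i).1 = τ * e.1 := by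
    rw [← mom_fst (v := v) (fun i => w i * lam i), hmom]; simp
  have hm2 : ∑ i, w i * lam i * (v i).2 = τ * e.2 := by
    rw [← mom_snd (v := v) (fun i => w i * lam i), hmom]; simp
  have he1 : ∑ i, z₀ i * c₀ i * (v i).1 = e.1 := by rw [he_def, mom_fst]
  have he2 : ∑ i, z₀ i * c₀ i * (v i).2 = e.2 := by rw [he_def, mom_snd]
  set D := θ.1 * e.1 + θ.2 * e.2 with hD
  have hDsum : ∑ i, z₀ i * c₀ i * lam i = D := by
    have : ∀ i, z₀ i * c₀ i * lam i = θ.1 * (z₀ i * c₀ i * (v i).1) +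
        θ.2 * (z₀ i * c₀ i * (v i).2) + k * (z₀ i * c₀ i) := fun i => by simp only [hlam]; ring
    simp_rw [this, Finset.sum_add_distrib, ← Finset.mul_sum, he1, he2, h0]
    ring
  have hQ : ∑ i, w i * lam i ^ 2 = τ * D := by
    have : ∀ i, w i * lam i ^ 2 = θ.1 * (w i * lam i * (v i).1) +
        θ.2 * (w i * lam i * (v i).2) + k * (w i * lam i) := fun i => by simp only [hlam]; ring
    simp_rw [this, Finset.sum_add_distrib, ← Finset.mul_sum, hm1, hm2, hsum]
    ring
  rcases hτ.eq_or_lt with rfl | hτ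
  · have hz : ∀ i, lam i = 0 := by
      rw [zero_mul, Finset.sum_eq_zero_iff_of_nonneg
        (fun i _ => mul_nonneg (hw i).le (sq_nonneg _))] at hQ
      intro i
      have := hQ i (Finset.mem_univ i)
      simpa [(hw i).ne'] using this
    simp [hz]
  have hCS1 : (τ * n) ^ 2 ≤ (τ * D) * V := by
    have h1 : ∑ i, w i * lam i * (e.1 * (v i).1 + e.2 * (v i).2) = τ * n := by
      have : ∀ i, w i * lam i * (e.1 * (v i).1 + e.2 * (v i).2) =
        e.1 * (w i * lam i * (v i).1) + e.2 * (w i * lam i * (v i).2) := fun i => by ring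
      simp_rw [this, Finset.sum_add_distrib, ← Finset.mul_sum, hm1, hm2, hn_def]
      ring
    have h2 := Finset.sum_sq_le_sum_mul_sum_of_sq_le_mul Finset.univ
      (r := fun i => w i * lam i * (e.1 * (v i).1 + e.2 * (v i).2))
      (f := fun i => w i * lam i ^ 2) (g := fun i => w i * (e.1 * (v i).1 + e.2 * (v i).2) ^ 2)
      (fun i _ => mul_nonneg (hw i).le (sq_nonneg _))
      (fun i _ => mul_nonneg (hw i).le (sq_nonneg _)) (fun i _ => le_of_eq (by ring))
    rw [h1, hQ] at h2
    have h3 : 0 ≤ τ * D := by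
      rw [← hQ]; exact Finset.sum_nonneg fun i _ => mul_nonneg (hw i).le (sq_nonneg _)
    exact h2.trans (mul_le_mul_of_nonneg_left hpV.le h3)
  have hDge : c₁ * τ ≤ D := by
    have h1 : τ * (τ * n ^ 2) ≤ τ * (D * V) := by nlinarith [hCS1]
    have h2 := le_of_mul_le_mul_left h1 hτ
    rw [hc₁, div_mul_eq_mul_div, div_le_iff₀ hVpos]
    linarith
  have hDpos : 0 < D := lt_of_lt_of_le (by positivity) hDge
  have hCS2 : (∑ i, (w i * c i - z₀ i * c₀ i) * lam i) ^ 2 ≤ (D / 2) ^ 2 := by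
    have h2 := Finset.sum_sq_le_sum_mul_sum_of_sq_le_mul Finset.univ
      (r := fun i => (w i * c i - z₀ i * c₀ i) * lam i)
      (f := fun i => if z₀ i = 0 then w i * c i ^ 2 else (w i * c i - z₀ i * c₀ i) ^ 2 / w i)
      (g := fun i => w i * lam i ^ 2)
      (fun i _ => by
        have := hw i
        split_ifs <;> positivity)
      (fun i _ => mul_nonneg (hw i).le (sq_nonneg _)) (fun i _ => by
        have := (hw i).ne'
        refine le_of_eq ?_
        split_ifs with hi
        · rw [hi]; ring
        · field_simp)
    rw [hQ] at h2
    have h3 : R (w, c) * (τ * D) ≤ c₁ / 4 * (τ * D) :=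
      mul_le_mul_of_nonneg_right hpR.le (by positivity)
    have h4 : c₁ * τ * D ≤ D * D := mul_le_mul_of_nonneg_right hDge hDpos.le
    refine h2.trans (h3.trans ?_)
    nlinarith
  have hlow := (abs_le_of_sq_le_sq' hCS2 (by positivity)).1
  have hsplit : ∑ i, (w i * c i - z₀ i * c₀ i) * lam i = ∑ i, w i * c i * lam i - D := by
    simp_rw [sub_mul]; rw [Finset.sum_sub_distrib, hDsum]
  rw [hsplit] at hlow
  linarith

theorem exists_log_mean {a b : ℝ} (ha : 0 < a) (hb : 0 < b) :
    ∃ m, 0 < m ∧ m ∈ uIcc a b ∧ b - a = m * (Real.log b - Real.log a) := by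
  wlog hab : a ≤ b generalizing a b
  · obtain ⟨m, h1, h2, h3⟩ := this hb ha (le_of_not_ge hab)
    exact ⟨m, h1, by rwa [uIcc_comm], by linarith⟩
  rcases hab.eq_or_lt with rfl | hlt
  · exact ⟨a, ha, by simp, by simp⟩
  obtain ⟨m, hm, hs⟩ := exists_hasDerivAt_eq_slope Real.log (fun x => x⁻¹) hlt
    (Real.continuousOn_log.mono fun x hx => (ha.trans_le hx.1).ne')
    (fun x hx => Real.hasDerivAt_log (ha.trans hx.1).ne')
  have hmpos := ha.trans hm.1
  refine ⟨m, hmpos, by rw [uIcc_of_le hab]; exact ⟨hm.1.le, hm.2.le⟩, ?_⟩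
  have hba : 0 < b - a := by linarith
  rw [eq_div_iff hba.ne'] at hs
  rw [← hs, ← mul_assoc, mul_inv_cancel₀ hmpos.ne', one_mul]

theorem gibbs_pos [Nonempty ι] {w : ι → ℝ} (hw : ∀ i, 0 < w i) (θ : ℝ × ℝ) (i : ι) :
    0 < gibbs v w θ i :=
  div_pos (mul_pos (hw i) (Real.exp_pos _))
    (sum_pos_of_pos fun i => mul_pos (hw i) (Real.exp_pos _))

theorem log_gibbs [Nonempty ι] {w : ι → ℝ} (hw : ∀ i, 0 < w i) (θ : ℝ × ℝ) (i : ι) :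
    Real.log (gibbs v w θ i) = Real.log (w i) + (θ.1 * (v i).1 + θ.2 * (v i).2) -
      Real.log (∑ j, w j * Real.exp (θ.1 * (v j).1 + θ.2 * (v j).2)) := by
  rw [gibbs, Real.log_div (mul_pos (hw i) (Real.exp_pos _)).ne'
    (sum_pos_of_pos fun i => mul_pos (hw i) (Real.exp_pos _)).ne',
    Real.log_mul (hw i).ne' (Real.exp_pos _).ne', Real.log_exp]

theorem lift_eq_gibbs (hint : (interior (convexHull ℝ (range v))).Nonempty)
    {t : ℝ} (ht : 0 < t) {q : ℝ × ℝ} (hq : q ∈ interior (convexHull ℝ (range v))) :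
    ∃ θ, lift v ν t q = gibbs v (fun i => t ^ ν i) θ := by
  have := nonempty_index hint
  obtain ⟨θ, hθ⟩ := exists_gibbs hq (w := fun i => t ^ ν i) fun i => Real.rpow_pos_of_pos ht _
  refine ⟨θ, ?_⟩
  rw [← hθ, lift_mom ht.le (gibbs_mem_toricSlice ht θ)]

/-- The value at `q` of the function with coefficients `c`, transported to the polygon. -/
def height (v : ι → ℝ × ℝ) (ν : ι → ℝ) (c : ℝ → ι → ℝ) (t : ℝ) (q : ℝ × ℝ) : ℝ :=
  ∑ i, lift v ν t q i * c t i

theorem continuousOn_height (hint : (interior (convexHull ℝ (range v))).Nonempty)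
    {c : ℝ → ι → ℝ} (hc : ContinuousOn c (Icc 0 1)) :
    ContinuousOn (fun p : ℝ × (ℝ × ℝ) => height v ν c p.1 p.2)
      (Icc (0:ℝ) 1 ×ˢ convexHull ℝ (range v)) := by
  refine continuousOn_finsetSum _ fun i _ => ?_
  refine ((continuous_apply i).comp_continuousOn (continuousOn_lift hint)).mul ?_
  exact (continuous_apply i).comp_continuousOn
    (hc.comp continuousOn_fst fun p hp => hp.1)

theorem lift_mem_ball {z₀ z z' w : ι → ℝ} {ρ : ℝ} (hz : dist z z₀ < ρ) (hz' : dist z' z₀ < ρ)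
    (hw : ∀ i, w i ∈ uIcc (z i) (z' i)) : dist w z₀ < ρ := by
  have hρ : 0 < ρ := dist_nonneg.trans_lt hz
  rw [dist_pi_lt_iff hρ] at *
  intro i
  have h1 := abs_lt.1 (hz i)
  have h2 := abs_lt.1 (hz' i)
  rw [Real.dist_eq, abs_lt]
  rcases mem_uIcc.1 (hw i) with h | h <;> constructor <;> linarith [h.1, h.2]

/-- Near a nondegenerate zero at the time `0`, the functions `height` at all small times increase
uniformly in the direction `e`. -/
theorem exists_uniform_increase (hint : (interior (convexHull ℝ (range v))).Nonempty)
    {c : ℝ → ι → ℝ} (hc : ContinuousOn c (Icc 0 1)) {q₀ : ℝ × ℝ}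
    (hq₀ : q₀ ∈ convexHull ℝ (range v)) (h0 : height v ν c 0 q₀ = 0)
    (he : mom v (fun i => lift v ν 0 q₀ i * c 0 i) ≠ 0) :
    ∃ δ > 0, ∃ r > 0, ∀ t ∈ Ico 0 r, ∀ q ∈ convexHull ℝ (range v), ∀ τ : ℝ, 0 ≤ τ →
      q + τ • mom v (fun i => lift v ν 0 q₀ i * c 0 i) ∈ convexHull ℝ (range v) →
      q ∈ Metric.ball q₀ r →
      q + τ • mom v (fun i => lift v ν 0 q₀ i * c 0 i) ∈ Metric.ball q₀ r →
      δ * τ ≤ height v ν c t (q + τ • mom v (fun i => lift v ν 0 q₀ i * c 0 i)) -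
        height v ν c t q := by
  have hne := nonempty_index hint
  set Θ := convexHull ℝ (range v) with hΘ
  set z₀ := lift v ν 0 q₀ with hz₀
  set e := mom v (fun i => z₀ i * c 0 i) with he_def
  have h01 : (0:ℝ) ∈ Icc (0:ℝ) 1 := by simp
  obtain ⟨δ, hδ, hev⟩ := eventually_increment_ge (v := v) (z₀ := z₀) (c₀ := c 0)
    (lift_spec hint h01 hq₀).1.1.1 h0 he
  obtain ⟨ρ, hρ, hball⟩ := Metric.eventually_nhds_iff.1 hev
  have hcl := continuousOn_lift (ν := ν) hint (0, q₀) ⟨h01, hq₀⟩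
  have hcc : ContinuousWithinAt (fun p : ℝ × (ℝ × ℝ) => c p.1) (Icc (0:ℝ) 1 ×ˢ Θ) (0, q₀) :=
    (hc.comp continuousOn_fst fun p hp => hp.1) (0, q₀) ⟨h01, hq₀⟩
  obtain ⟨r₁, hr₁, H₁⟩ := Metric.continuousWithinAt_iff.1 hcl ρ hρ
  obtain ⟨r₂, hr₂, H₂⟩ := Metric.continuousWithinAt_iff.1 hcc ρ hρ
  set r := min (min r₁ r₂) 1 with hr
  have hrpos : 0 < r := by positivity
  have hcl' : ∀ t ∈ Ico 0 r, ∀ q ∈ Θ, q ∈ Metric.ball q₀ r →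
      dist (lift v ν t q) z₀ < ρ ∧ dist (c t) (c 0) < ρ := by
    intro t ht q hq hqb
    have htI : t ∈ Icc (0:ℝ) 1 := ⟨ht.1, ht.2.le.trans (min_le_right _ _)⟩
    have hd : dist (t, q) ((0:ℝ), q₀) < min r₁ r₂ := by
      refine lt_of_lt_of_le ?_ (min_le_left _ 1)
      rw [Prod.dist_eq, max_lt_iff]
      exact ⟨by rw [Real.dist_eq, sub_zero, abs_of_nonneg ht.1]; exact ht.2, hqb⟩
    exact ⟨H₁ (x := (t, q)) ⟨htI, hq⟩ (hd.trans_le (min_le_left _ _)),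
      H₂ (x := (t, q)) ⟨htI, hq⟩ (hd.trans_le (min_le_right _ _))⟩
  have hinterior : ∀ t ∈ Ioo 0 r, ∀ q ∈ interior Θ, ∀ τ : ℝ, 0 ≤ τ → q + τ • e ∈ interior Θ →
      q ∈ Metric.ball q₀ r → q + τ • e ∈ Metric.ball q₀ r →
      δ * τ ≤ height v ν c t (q + τ • e) - height v ν c t q := by
    intro t ht q hq τ hτ hq' hqb hqb'
    have hw : ∀ i, 0 < t ^ ν i := fun i => Real.rpow_pos_of_pos ht.1 _
    have htI : t ∈ Icc (0:ℝ) 1 := ⟨ht.1.le, ht.2.le.trans (min_le_right _ _)⟩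
    obtain ⟨θ, hθ⟩ := lift_eq_gibbs (ν := ν) hint ht.1 hq
    obtain ⟨θ', hθ'⟩ := lift_eq_gibbs (ν := ν) hint ht.1 hq'
    have hs := lift_spec (ν := ν) hint htI (interior_subset hq)
    have hs' := lift_spec (ν := ν) hint htI (interior_subset hq')
    have hd := hcl' t ⟨ht.1.le, ht.2⟩ q (interior_subset hq) hqb
    have hd' := hcl' t ⟨ht.1.le, ht.2⟩ _ (interior_subset hq') hqb'
    set z := lift v ν t q with hz
    set z' := lift v ν t (q + τ • e) with hz'
    have hzpos : ∀ i, 0 < z i := fun i => by rw [hθ]; exact gibbs_pos hw θ i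
    have hzpos' : ∀ i, 0 < z' i := fun i => by rw [hθ']; exact gibbs_pos hw θ' i
    choose w hwpos hwmem hweq using fun i => exists_log_mean (hzpos i) (hzpos' i)
    set N := fun θ : ℝ × ℝ =>
      Real.log (∑ j, t ^ ν j * Real.exp (θ.1 * (v j).1 + θ.2 * (v j).2))
    have hdiff : ∀ i, w i * ((θ' - θ).1 * (v i).1 + (θ' - θ).2 * (v i).2 + (N θ - N θ')) =
        z' i - z i := by
      intro i
      rw [hweq i, hθ, hθ', log_gibbs hw, log_gibbs hw, Prod.fst_sub, Prod.snd_sub]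
      simp only [N]
      ring
    have hwd : dist (w, c t) (z₀, c 0) < ρ := by
      rw [Prod.dist_eq, max_lt_iff]
      exact ⟨lift_mem_ball hd.1 hd'.1 hwmem, hd.2⟩
    have key := hball hwd (θ' - θ) (N θ - N θ') τ hwpos hτ
    simp only [hdiff] at key
    have k1 := key (by rw [Finset.sum_sub_distrib, hs.1.1.2, hs'.1.1.2, sub_self])
      (by
        have : mom v (fun i => z' i - z i) = mom v z' - mom v z := by
          simp [mom, sub_smul]
        rw [this, hs.2, hs'.2, add_sub_cancel_left])
    refine k1.trans_eq ?_
    unfold height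
    rw [← Finset.sum_sub_distrib]
    refine Finset.sum_congr rfl fun i _ => ?_
    rw [← hz, ← hz', mul_right_comm, hdiff i]; ring
  refine ⟨δ, hδ, r, hrpos, ?_⟩
  intro t ht q hq τ hτ hq' hqb hqb'
  obtain ⟨p, hp⟩ := hint
  have hconv : Convex ℝ Θ := convex_convexHull ℝ _
  let T : ℝ → ℝ := fun η => t + η * ((r - t) / 2)
  let Q : ℝ × ℝ → ℝ → ℝ × ℝ := fun x η => x + η • (p - x)
  have hQcont : ∀ x, Continuous (Q x) := fun x => by fun_prop
  have hQ0 : ∀ x, Q x 0 = x := fun x => by simp [Q]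
  have hT0 : T 0 = t := by simp [T]
  have hrt : 0 < r - t := by linarith [ht.2]
  have hTmem : ∀ η ∈ Icc (0:ℝ) 1, T η ∈ Icc (0:ℝ) 1 := by
    intro η hη
    have h1 : η * ((r - t) / 2) ≤ 1 * ((r - t) / 2) :=
      mul_le_mul_of_nonneg_right hη.2 (by linarith)
    have h2 : 0 ≤ η * ((r - t) / 2) := mul_nonneg hη.1 (by linarith)
    have h3 : r ≤ 1 := min_le_right _ _
    exact ⟨by simp only [T]; linarith [ht.1], by simp only [T]; linarith⟩
  have hlim : ∀ x ∈ Θ, Tendsto (fun η => height v ν c (T η) (Q x η)) (𝓝[>] 0)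
      (𝓝 (height v ν c t x)) := by
    intro x hx
    have hcont : ContinuousWithinAt (fun p : ℝ × (ℝ × ℝ) => height v ν c p.1 p.2)
        (Icc (0:ℝ) 1 ×ˢ Θ) (T 0, Q x 0) := by
      rw [hT0, hQ0]
      exact continuousOn_height ⟨p, hp⟩ hc _ ⟨hT0 ▸ hTmem 0 (by simp), hx⟩
    have htend : Tendsto (fun η => (T η, Q x η)) (𝓝[>] 0)
        (𝓝[Icc (0:ℝ) 1 ×ˢ Θ] (T 0, Q x 0)) := by
      refine tendsto_nhdsWithin_iff.2 ⟨?_, ?_⟩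
      · have hTc : Continuous fun η => (T η, Q x η) := by
          refine Continuous.prodMk ?_ (hQcont x)
          fun_prop
        exact (hTc.tendsto 0).mono_left nhdsWithin_le_nhds
      · filter_upwards [Ioc_mem_nhdsGT (zero_lt_one (α := ℝ))] with η hη
        exact ⟨hTmem η ⟨hη.1.le, hη.2⟩,
          interior_subset (hconv.add_smul_sub_mem_interior hx hp hη)⟩
    have := hcont.tendsto.comp htend
    simpa [hT0, hQ0, Function.comp_def] using this
  have hfin : Tendsto (fun η : ℝ => δ * ((1 - η) * τ)) (𝓝[>] 0) (𝓝 (δ * τ)) := by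
    have : Continuous fun η : ℝ => δ * ((1 - η) * τ) := by fun_prop
    simpa using (this.tendsto 0).mono_left nhdsWithin_le_nhds
  refine le_of_tendsto_of_tendsto hfin ((hlim _ hq').sub (hlim q hq)) ?_
  have hnear : ∀ x, x ∈ Metric.ball q₀ r → ∀ᶠ η in 𝓝[>] (0:ℝ), Q x η ∈ Metric.ball q₀ r := by
    intro x hx
    exact ((hQcont x).tendsto 0).mono_left nhdsWithin_le_nhds |>.eventually
      (by rw [hQ0]; exact Metric.isOpen_ball.mem_nhds hx)
  filter_upwards [Ioc_mem_nhdsGT (zero_lt_one (α := ℝ)), hnear q hqb, hnear _ hqb'] with η hη h1 h2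
  have heq : Q (q + τ • e) η = Q q η + ((1 - η) * τ) • e := by
    simp only [Q]; module
  have i1 : Q q η ∈ interior Θ := hconv.add_smul_sub_mem_interior hq hp hη
  have i2 : Q (q + τ • e) η ∈ interior Θ := hconv.add_smul_sub_mem_interior hq' hp hη
  have hTη : T η ∈ Ioo 0 r := by
    have h1 : η * ((r - t) / 2) ≤ 1 * ((r - t) / 2) :=
      mul_le_mul_of_nonneg_right hη.2 (by linarith)
    have h2 : 0 < η * ((r - t) / 2) := mul_pos hη.1 (by linarith)
    exact ⟨by simp only [T]; linarith [ht.1], by simp only [T]; linarith⟩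
  rw [heq] at i2 h2 ⊢
  exact hinterior _ hTη _ i1 _ (mul_nonneg (by linarith [hη.2]) hτ) i2 h1 h2

/-- Near a zero at the time `0`, the polygon and its faces are invariant under small translations
in the direction `e`. -/
theorem exists_translation_invariant (hint : (interior (convexHull ℝ (range v))).Nonempty)
    {c : ι → ℝ} {q₀ : ℝ × ℝ} (hq₀ : q₀ ∈ convexHull ℝ (range v))
    (h0 : ∑ i, lift v ν 0 q₀ i * c i = 0)
    (he : mom v (fun i => lift v ν 0 q₀ i * c i) ≠ 0) :
    ∃ r > 0, ∀ q ∈ convexHull ℝ (range v), q ∈ Metric.ball q₀ r →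
      (∀ τ : ℝ, q + τ • mom v (fun i => lift v ν 0 q₀ i * c i) ∈ Metric.ball q₀ r →
        q + τ • mom v (fun i => lift v ν 0 q₀ i * c i) ∈ convexHull ℝ (range v)) ∧
      ∀ l : ℝ × ℝ →L[ℝ] ℝ, (∀ y ∈ convexHull ℝ (range v), l y ≤ l q) →
        l (mom v (fun i => lift v ν 0 q₀ i * c i)) = 0 := by
  have h01 : (0:ℝ) ∈ Icc (0:ℝ) 1 := by simp
  set Θ := convexHull ℝ (range v) with hΘ
  set z₀ := lift v ν 0 q₀ with hz₀
  set e := mom v (fun i => z₀ i * c i) with he_def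
  have hz₀nn : ∀ i, 0 ≤ z₀ i := (lift_spec hint h01 hq₀).1.1.1
  have hcont : ContinuousWithinAt (fun q => lift v ν 0 q) Θ q₀ :=
    (continuousOn_lift (ν := ν) hint).comp (f := fun q : ℝ × ℝ => ((0:ℝ), q)) (s := Θ)
      (by fun_prop) (fun q hq => ⟨h01, hq⟩) q₀ hq₀
  have hev : ∀ᶠ q in 𝓝[Θ] q₀, ∀ i, 0 < z₀ i → z₀ i / 2 < lift v ν 0 q i := by
    refine eventually_all.2 fun i => ?_
    by_cases hi : 0 < z₀ i
    · have h1 : Tendsto (fun q => lift v ν 0 q i) (𝓝[Θ] q₀) (𝓝 (z₀ i)) :=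
        ((continuous_apply i).tendsto _).comp hcont.tendsto
      filter_upwards [h1.eventually (lt_mem_nhds (half_lt_self hi))] with q hq _ using hq
    · exact Eventually.of_forall fun q h => absurd h hi
  obtain ⟨r₁, hr₁, H⟩ := Metric.mem_nhdsWithin_iff.1 hev
  have hepos : 0 < ‖e‖ := norm_pos_iff.2 he
  set M := 1 + ∑ i, |c i| with hM
  have hMpos : 0 < M := by
    have : 0 ≤ ∑ i, |c i| := Finset.sum_nonneg fun i _ => abs_nonneg _
    linarith
  have hcM : ∀ i, |c i| ≤ M := fun i => by
    have := Finset.single_le_sum (f := fun i => |c i|) (fun i _ => abs_nonneg _)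
      (Finset.mem_univ i)
    linarith
  refine ⟨min r₁ (‖e‖ / (4 * M)), by positivity, ?_⟩
  intro q hq hqb
  have hqz : ∀ i, 0 < z₀ i → z₀ i / 2 < lift v ν 0 q i :=
    H ⟨Metric.ball_subset_ball (min_le_left _ _) hqb, hq⟩
  have hs := lift_spec (ν := ν) hint h01 hq
  set z := lift v ν 0 q with hz
  refine ⟨?_, ?_⟩
  · intro τ hτ
    have hτ' : |τ| * M ≤ 1 / 2 := by
      have h1 : dist (q + τ • e) q < ‖e‖ / (4 * M) + ‖e‖ / (4 * M) :=
        (dist_triangle_right _ _ q₀).trans_lt (add_lt_add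
          (lt_of_lt_of_le hτ (min_le_right _ _)) (lt_of_lt_of_le hqb (min_le_right _ _)))
      rw [dist_eq_norm, add_sub_cancel_left, norm_smul, Real.norm_eq_abs] at h1
      have h2 : ‖e‖ / (4 * M) + ‖e‖ / (4 * M) = ‖e‖ * (1 / (2 * M)) := by field_simp; ring
      rw [h2, mul_comm] at h1
      have h3 := lt_of_mul_lt_mul_left h1 hepos.le
      rw [lt_div_iff₀ (by positivity)] at h3
      linarith
    have hmom : q + τ • e = mom v (fun i => z i + τ * (z₀ i * c i)) := by
      have : mom v (fun i => z i + τ * (z₀ i * c i)) = mom v z + τ • e := by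
        simp [he_def, mom, add_smul, mul_smul, Finset.sum_add_distrib, Finset.smul_sum]
      rw [this, hs.2]
    rw [hmom]
    refine mom_mem_convexHull ⟨fun i => ?_, ?_⟩
    · change 0 ≤ z i + τ * (z₀ i * c i)
      rcases (hz₀nn i).eq_or_lt with h | h
      · rw [← h]; simpa using hs.1.1.1 i
      · have h1 := hqz i h
        have h2 : |τ * (z₀ i * c i)| ≤ 1 / 2 * z₀ i := by
          rw [abs_mul, abs_mul, abs_of_pos h]
          calc |τ| * (z₀ i * |c i|) = (|τ| * |c i|) * z₀ i := by ring
            _ ≤ (|τ| * M) * z₀ i := by gcongr; exact hcM i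
            _ ≤ 1 / 2 * z₀ i := by gcongr
        have := (abs_le.1 h2).1
        linarith
    · rw [Finset.sum_add_distrib, hs.1.1.2, ← Finset.mul_sum, h0]; simp
  · intro l hl
    have hmax : ∀ i, 0 < z i → l (v i) = l q := by
      intro i hi
      have hle : ∀ j, l (v j) ≤ l q := fun j => hl _ (subset_convexHull ℝ _ (mem_range_self j))
      refine le_antisymm (hle i) ?_
      by_contra! hlt
      have h1 : ∑ j, z j * l (v j) < ∑ j, z j * l q :=
        Finset.sum_lt_sum (fun j _ => mul_le_mul_of_nonneg_left (hle j) (hs.1.1.1 j))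
          ⟨i, Finset.mem_univ i, mul_lt_mul_of_pos_left hlt hi⟩
      rw [← map_mom, hs.2, ← Finset.sum_mul, hs.1.1.2, one_mul] at h1
      exact lt_irrefl _ h1
    rw [he_def, map_mom]
    have : ∀ i, z₀ i * c i * l (v i) = z₀ i * c i * l q := by
      intro i
      rcases (hz₀nn i).eq_or_lt with h | h
      · simp [← h]
      · rw [hmax i ((half_pos h).trans (hqz i h))]
    simp_rw [this]
    rw [← Finset.sum_mul, h0, zero_mul]

end Monotone

section AutPair

variable {E : Type*} [TopologicalSpace E]

/-- `h` and `h'` are mutually inverse self-homeomorphisms of `K` preserving the members of `𝓐`. -/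
structure AutPair (K : Set E) (𝓐 : Set (Set E)) (h h' : E → E) : Prop where
  cont : ContinuousOn h K
  cont' : ContinuousOn h' K
  left_inv : ∀ x ∈ K, h' (h x) = x
  right_inv : ∀ x ∈ K, h (h' x) = x
  maps : ∀ A ∈ 𝓐, MapsTo h A A
  maps' : ∀ A ∈ 𝓐, MapsTo h' A A

theorem AutPair.refl (K : Set E) (𝓐 : Set (Set E)) : AutPair K 𝓐 id id :=
  ⟨continuousOn_id, continuousOn_id, fun _ _ => rfl, fun _ _ => rfl,
    fun A _ => mapsTo_id A, fun A _ => mapsTo_id A⟩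

theorem AutPair.symm {K : Set E} {𝓐 : Set (Set E)} {h h' : E → E} (H : AutPair K 𝓐 h h') :
    AutPair K 𝓐 h' h :=
  ⟨H.cont', H.cont, H.right_inv, H.left_inv, H.maps', H.maps⟩

theorem AutPair.comp {K : Set E} {𝓐 : Set (Set E)} (hK : K ∈ 𝓐) {h h' k k' : E → E}
    (H : AutPair K 𝓐 h h') (H₁ : AutPair K 𝓐 k k') : AutPair K 𝓐 (k ∘ h) (h' ∘ k') where
  cont := H₁.cont.comp H.cont (H.maps K hK)
  cont' := H.cont'.comp H₁.cont' (H₁.maps' K hK)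
  left_inv x hx := by
    simp only [Function.comp_apply]
    rw [H₁.left_inv _ (H.maps K hK hx), H.left_inv x hx]
  right_inv x hx := by
    simp only [Function.comp_apply]
    rw [H.right_inv _ (H₁.maps' K hK hx), H₁.right_inv x hx]
  maps A hA := (H₁.maps A hA).comp (H.maps A hA)
  maps' A hA := (H.maps' A hA).comp (H₁.maps' A hA)

theorem AutPair.image_eq {K : Set E} {𝓐 : Set (Set E)} {h h' : E → E} (H : AutPair K 𝓐 h h')
    {A : Set E} (hA : A ∈ 𝓐) (hAK : A ⊆ K) : h '' A = A := by
  refine (H.maps A hA).image_subset.antisymm fun x hx => ?_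
  exact ⟨h' x, H.maps' A hA hx, H.right_inv x (hAK hx)⟩

end AutPair

section Cutoff

variable {E : Type*} [PseudoMetricSpace E] {x₀ : E} {r : ℝ}

/-- A cutoff function, equal to `1` in the ball of radius `r / 2` and to `0` outside the ball of
radius `r`. -/
def cutoff (x₀ : E) (r : ℝ) (x : E) : ℝ := min 1 (max 0 (2 - 2 * dist x x₀ / r))

theorem cutoff_mem (x₀ : E) (r : ℝ) (x : E) : cutoff x₀ r x ∈ Icc (0:ℝ) 1 :=
  ⟨le_min zero_le_one (le_max_left _ _), min_le_left _ _⟩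

theorem cutoff_eq_one {x : E} (hr : 0 < r) (hx : dist x x₀ ≤ r / 2) : cutoff x₀ r x = 1 := by
  refine min_eq_left (le_max_of_le_right ?_)
  have : 2 * dist x x₀ / r ≤ 1 := by rw [div_le_one hr]; linarith
  linarith

theorem cutoff_eq_zero {x : E} (hr : 0 < r) (hx : x ∉ Metric.ball x₀ r) : cutoff x₀ r x = 0 := by
  rw [Metric.mem_ball, not_lt] at hx
  have : 2 ≤ 2 * dist x x₀ / r := by rw [le_div_iff₀ hr]; linarith
  rw [cutoff, max_eq_left (by linarith)]; simp

theorem continuous_cutoff : Continuous (cutoff x₀ r) := by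
  unfold cutoff; fun_prop

theorem abs_cutoff_sub_le (hr : 0 < r) (x y : E) :
    |cutoff x₀ r x - cutoff x₀ r y| ≤ 2 / r * dist x y := by
  unfold cutoff
  refine (abs_min_sub_min_le_max _ _ _ _).trans (max_le (by simp; positivity) ?_)
  refine (abs_max_sub_max_le_max _ _ _ _).trans (max_le (by simp; positivity) ?_)
  have : 2 - 2 * dist x x₀ / r - (2 - 2 * dist y x₀ / r) =
      2 / r * (dist y x₀ - dist x x₀) := by ring
  rw [this, abs_mul, abs_of_pos (by positivity)]
  refine mul_le_mul_of_nonneg_left ?_ (by positivity)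
  rw [dist_comm x y]
  exact abs_dist_sub_le y x x₀

theorem abs_prod_sub_prod_le {α : Type*} (I : Finset α) {a b : α → ℝ}
    (ha : ∀ i, a i ∈ Icc (0:ℝ) 1) (hb : ∀ i, b i ∈ Icc (0:ℝ) 1) :
    |∏ i ∈ I, a i - ∏ i ∈ I, b i| ≤ ∑ i ∈ I, |a i - b i| := by
  classical
  induction I using Finset.induction_on with
  | empty => simp
  | insert j I hj ih =>
    rw [Finset.prod_insert hj, Finset.prod_insert hj, Finset.sum_insert hj]
    have h1 : |∏ i ∈ I, a i| ≤ 1 := by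
      rw [abs_of_nonneg (Finset.prod_nonneg fun i _ => (ha i).1)]
      exact Finset.prod_le_one (fun i _ => (ha i).1) fun i _ => (ha i).2
    have h2 : |b j| ≤ 1 := by rw [abs_of_nonneg (hb j).1]; exact (hb j).2
    have e1 : a j * ∏ i ∈ I, a i - b j * ∏ i ∈ I, b i =
      (a j - b j) * ∏ i ∈ I, a i + b j * (∏ i ∈ I, a i - ∏ i ∈ I, b i) := by ring
    rw [e1]
    refine (abs_add_le _ _).trans ?_
    rw [abs_mul, abs_mul]
    have h3 := mul_le_mul_of_nonneg_left h1 (abs_nonneg (a j - b j))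
    have h4 := mul_le_mul_of_nonneg_right h2 (abs_nonneg (∏ i ∈ I, a i - ∏ i ∈ I, b i))
    linarith

/-- The union of cutoff functions. -/
def multiCutoff {α : Type*} (I : Finset α) (x : α → E) (r : α → ℝ) (y : E) : ℝ :=
  1 - ∏ i ∈ I, (1 - cutoff (x i) (r i) y)

theorem one_sub_cutoff_mem (x₀ : E) (r : ℝ) (x : E) : 1 - cutoff x₀ r x ∈ Icc (0:ℝ) 1 := by
  have := cutoff_mem x₀ r x
  exact ⟨by linarith [this.2], by linarith [this.1]⟩

theorem multiCutoff_mem {α : Type*} (I : Finset α) (x : α → E) (r : α → ℝ) (y : E) :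
    multiCutoff I x r y ∈ Icc (0:ℝ) 1 := by
  have h1 := Finset.prod_nonneg (s := I) fun i _ => (one_sub_cutoff_mem (x i) (r i) y).1
  have h2 := Finset.prod_le_one (s := I) (fun i _ => (one_sub_cutoff_mem (x i) (r i) y).1)
    fun i _ => (one_sub_cutoff_mem (x i) (r i) y).2
  exact ⟨by unfold multiCutoff; linarith, by unfold multiCutoff; linarith⟩

theorem continuous_multiCutoff {α : Type*} (I : Finset α) (x : α → E) (r : α → ℝ) :
    Continuous (multiCutoff I x r) :=
  continuous_const.sub (continuous_finsetProd _ fun _ _ => continuous_const.sub continuous_cutoff)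

theorem abs_multiCutoff_sub_le {α : Type*} {I J : Finset α} (hIJ : I ⊆ J) {x : α → E} {r : α → ℝ}
    (hr : ∀ i, 0 < r i) (y z : E) :
    |multiCutoff I x r y - multiCutoff I x r z| ≤ (∑ i ∈ J, 2 / r i) * dist y z := by
  have e1 : multiCutoff I x r y - multiCutoff I x r z =
    -(∏ i ∈ I, (1 - cutoff (x i) (r i) y) - ∏ i ∈ I, (1 - cutoff (x i) (r i) z)) := by
    unfold multiCutoff; ring
  rw [e1, abs_neg]
  refine (abs_prod_sub_prod_le I (fun i => one_sub_cutoff_mem _ _ _)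
    (fun i => one_sub_cutoff_mem _ _ _)).trans ?_
  rw [Finset.sum_mul]
  refine (Finset.sum_le_sum (g := fun i => 2 / r i * dist y z) fun i _ => ?_).trans
    (Finset.sum_le_sum_of_subset_of_nonneg hIJ fun i _ _ => by have := hr i; positivity)
  rw [sub_sub_sub_cancel_left, abs_sub_comm]
  exact abs_cutoff_sub_le (hr i) y z

end Cutoff

section Slide

variable {E : Type*} [NormedAddCommGroup E] [NormedSpace ℝ E]

theorem exists_mem_sphere_of_line {x x₀ e : E} {r : ℝ} (he : e ≠ 0)
    (hx : x ∈ Metric.ball x₀ r) : ∃ τ : ℝ, 0 ≤ τ ∧ x + τ • e ∈ Metric.sphere x₀ r := by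
  let f : ℝ → ℝ := fun τ => dist (x + τ • e) x₀
  have hf : Continuous f := by fun_prop
  have hpos : 0 < ‖e‖ := norm_pos_iff.2 he
  set T := (2 * r) / ‖e‖
  have hr : 0 < r := Metric.pos_of_mem_ball hx
  have hT : 0 ≤ T := by positivity
  have hfT : r ≤ f T := by
    have h1 : dist (x + T • e) x = 2 * r := by
      rw [dist_eq_norm, add_sub_cancel_left, norm_smul, Real.norm_eq_abs, abs_of_nonneg hT,
        div_mul_cancel₀ _ hpos.ne']
    have h2 := dist_triangle_right (x + T • e) x x₀
    have h3 := Metric.mem_ball.1 hx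
    simp only [f]; linarith
  obtain ⟨τ, hτ, h⟩ := intermediate_value_Icc hT hf.continuousOn
    (show r ∈ Icc (f 0) (f T) from ⟨by simpa [f] using (Metric.mem_ball.1 hx).le, hfT⟩)
  exact ⟨τ, hτ.1, h⟩

/-- `y` lies on the line through `x` in the direction `e` inside the ball, at the level
prescribed by `f x = g y`; outside the ball nothing moves. -/
def SlideRel (x₀ e : E) (r : ℝ) (f g : E → ℝ) (x y : E) : Prop :=
  (y = x ∧ x ∉ Metric.ball x₀ r) ∨
    (x ∈ Metric.closedBall x₀ r ∧ y ∈ Metric.closedBall x₀ r ∧ y - x ∈ Submodule.span ℝ {e} ∧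
      g y = f x)

/-- `f` is strictly increasing along `e` in a closed ball. -/
def IncrAlong (K : Set E) (x₀ e : E) (r : ℝ) (f : E → ℝ) : Prop :=
  ∀ x ∈ K, x ∈ Metric.closedBall x₀ r → ∀ τ : ℝ, 0 < τ → x + τ • e ∈ K →
    x + τ • e ∈ Metric.closedBall x₀ r → f x < f (x + τ • e)

/-- Translations along `e` inside a closed ball do not leave `A`. -/
def TransInv (A : Set E) (x₀ e : E) (r : ℝ) : Prop :=
  ∀ x ∈ A, x ∈ Metric.closedBall x₀ r → ∀ τ : ℝ, x + τ • e ∈ Metric.closedBall x₀ r →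
    x + τ • e ∈ A

variable {K : Set E} {x₀ e : E} {r : ℝ} {f g : E → ℝ}

theorem IncrAlong.injective (hg : IncrAlong K x₀ e r g) {y z : E} (hy : y ∈ K) (hz : z ∈ K)
    (hyb : y ∈ Metric.closedBall x₀ r) (hzb : z ∈ Metric.closedBall x₀ r)
    (hyz : y - z ∈ Submodule.span ℝ {e}) (h : g y = g z) : y = z := by
  obtain ⟨τ, hτ⟩ := Submodule.mem_span_singleton.1 hyz
  rcases lt_trichotomy τ 0 with h0 | h0 | h0
  · have e1 : z = y + (-τ) • e := by rw [neg_smul, hτ]; abel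
    have := hg y hy hyb (-τ) (by linarith) (e1 ▸ hz) (e1 ▸ hzb)
    rw [← e1] at this; linarith
  · rw [h0, zero_smul] at hτ; exact (sub_eq_zero.1 hτ.symm)
  · have e1 : y = z + τ • e := by rw [hτ]; abel
    have := hg z hz hzb τ h0 (e1 ▸ hy) (e1 ▸ hyb)
    rw [← e1] at this; linarith

theorem slideRel_unique (hg : IncrAlong K x₀ e r g)
    (hfg : ∀ x ∈ K, x ∉ Metric.ball x₀ r → f x = g x) {x y z : E} (hx : x ∈ K) (hy : y ∈ K)
    (hz : z ∈ K) (hxy : SlideRel x₀ e r f g x y) (hxz : SlideRel x₀ e r f g x z) : y = z := by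
  have key : ∀ y ∈ K, SlideRel x₀ e r f g x y → x ∉ Metric.ball x₀ r → y = x := by
    rintro y hy (⟨h, -⟩ | ⟨h1, h2, h3, h4⟩) hn
    · exact h
    · exact hg.injective hy hx h2 h1 h3 (h4.trans (hfg x hx hn))
  by_cases hn : x ∈ Metric.ball x₀ r
  · rcases hxy with ⟨-, h⟩ | ⟨-, h2, h3, h4⟩
    · exact absurd hn h
    rcases hxz with ⟨-, h⟩ | ⟨-, k2, k3, k4⟩
    · exact absurd hn h
    refine hg.injective hy hz h2 k2 ?_ (h4.trans k4.symm)
    have := Submodule.sub_mem _ h3 k3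
    rwa [sub_sub_sub_cancel_right] at this
  · rw [key y hy hxy hn, key z hz hxz hn]

theorem exists_slideRel (he : e ≠ 0) (hinv : TransInv K x₀ e r) (hgc : ContinuousOn g K)
    (hf : IncrAlong K x₀ e r f) (hfg : ∀ x ∈ K, x ∉ Metric.ball x₀ r → f x = g x)
    {x : E} (hx : x ∈ K) : ∃ y ∈ K, SlideRel x₀ e r f g x y := by
  by_cases hn : x ∈ Metric.ball x₀ r
  swap
  · exact ⟨x, hx, Or.inl ⟨rfl, hn⟩⟩
  obtain ⟨τ₂, h2, hs2⟩ := exists_mem_sphere_of_line he hn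
  obtain ⟨τ₁, h1, hs1⟩ := exists_mem_sphere_of_line (neg_ne_zero.2 he) hn
  rw [smul_neg, ← neg_smul] at hs1
  have hxb := Metric.ball_subset_closedBall hn
  have hseg : ∀ τ ∈ Icc (-τ₁) τ₂, x + τ • e ∈ Metric.closedBall x₀ r := by
    intro τ hτ
    have hc : Convex ℝ {τ : ℝ | x + τ • e ∈ Metric.closedBall x₀ r} := by
      intro a ha b hb s t hs ht hst
      have e1 : x + (s • a + t • b) • e = s • (x + a • e) + t • (x + b • e) := by
        calc x + (s • a + t • b) • e = (s + t) • x + (s • a + t • b) • e := by rw [hst, one_smul]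
          _ = _ := by simp only [smul_eq_mul]; module
      change x + (s • a + t • b) • e ∈ Metric.closedBall x₀ r
      rw [e1]
      exact convex_closedBall x₀ r ha hb hs ht hst
    exact hc.ordConnected.out (x := -τ₁) (Metric.sphere_subset_closedBall hs1)
      (Metric.sphere_subset_closedBall hs2) hτ
  have hK : ∀ τ ∈ Icc (-τ₁) τ₂, x + τ • e ∈ K := fun τ hτ => hinv x hx hxb τ (hseg τ hτ)
  have hle : -τ₁ ≤ τ₂ := by linarith
  have hcont : ContinuousOn (fun τ : ℝ => g (x + τ • e)) (Icc (-τ₁) τ₂) :=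
    hgc.comp (by fun_prop) hK
  have hup : f x ≤ g (x + τ₂ • e) := by
    rw [← hfg _ (hK τ₂ ⟨hle, le_rfl⟩) (fun h => (Metric.mem_ball.1 h).ne hs2)]
    rcases h2.eq_or_lt with h | h
    · simp [← h]
    · exact (hf x hx hxb τ₂ h (hK _ ⟨hle, le_rfl⟩) (hseg _ ⟨hle, le_rfl⟩)).le
  have hlo : g (x + (-τ₁) • e) ≤ f x := by
    rw [← hfg _ (hK (-τ₁) ⟨le_rfl, hle⟩) (fun h => (Metric.mem_ball.1 h).ne hs1)]
    rcases h1.eq_or_lt with h | h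
    · simp [← h]
    · have e1 : x + (-τ₁) • e + τ₁ • e = x := by module
      have := hf _ (hK (-τ₁) ⟨le_rfl, hle⟩) (hseg _ ⟨le_rfl, hle⟩) τ₁ h (e1.symm ▸ hx)
        (e1.symm ▸ hxb)
      rw [e1] at this
      exact this.le
  obtain ⟨τ, hτ, h⟩ := intermediate_value_Icc hle hcont ⟨hlo, hup⟩
  refine ⟨x + τ • e, hK τ hτ, Or.inr ⟨hxb, hseg τ hτ, ?_, h⟩⟩
  rw [add_sub_cancel_left]
  exact Submodule.smul_mem _ _ (Submodule.mem_span_singleton_self e)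

theorem slideRel_symm {x y : E}
    (h : SlideRel x₀ e r f g x y) : SlideRel x₀ e r g f y x := by
  rcases h with ⟨rfl, h⟩ | ⟨h1, h2, h3, h4⟩
  · exact Or.inl ⟨rfl, h⟩
  · refine Or.inr ⟨h2, h1, ?_, h4.symm⟩
    rw [← neg_sub]; exact Submodule.neg_mem _ h3

theorem exists_slide_map (hKc : IsCompact K) (he : e ≠ 0) (hinv : TransInv K x₀ e r)
    (hfc : ContinuousOn f K) (hgc : ContinuousOn g K)
    (hf : IncrAlong K x₀ e r f) (hg : IncrAlong K x₀ e r g)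
    (hfg : ∀ x ∈ K, x ∉ Metric.ball x₀ r → f x = g x) :
    ∃ h : E → E, ContinuousOn h K ∧ ∀ x ∈ K, h x ∈ K ∧ SlideRel x₀ e r f g x (h x) := by
  choose! h hh using fun x (hx : x ∈ K) => exists_slideRel he hinv hgc hf hfg hx
  refine ⟨h, ?_, hh⟩
  refine continuousOn_of_closed_relation (D := K)
    (R := {p | p.1 ∈ K ∧ p.2 ∈ K ∧ SlideRel x₀ e r f g p.1 p.2}) hKc ?_
    (fun x hx => ⟨(hh x hx).1, hx, hh x hx⟩) ?_
  · have hKK : IsClosed (K ×ˢ K) := hKc.isClosed.prod hKc.isClosed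
    have h1 : IsClosed ((K ×ˢ K) ∩ {p : E × E | p.2 = p.1 ∧ p.1 ∉ Metric.ball x₀ r}) :=
      hKK.inter ((isClosed_eq continuous_snd continuous_fst).inter
        (Metric.isOpen_ball.isClosed_compl.preimage continuous_fst))
    have h2 : IsClosed ((K ×ˢ K) ∩ (fun p : E × E => g p.2 - f p.1) ⁻¹' {0}) :=
      ContinuousOn.preimage_isClosed_of_isClosed
        ((hgc.comp continuousOn_snd fun p hp => hp.2).sub
          (hfc.comp continuousOn_fst fun p hp => hp.1)) hKK isClosed_singleton
    have h3 : IsClosed {p : E × E | p.1 ∈ Metric.closedBall x₀ r ∧ p.2 ∈ Metric.closedBall x₀ r ∧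
        p.2 - p.1 ∈ Submodule.span ℝ {e}} :=
      (Metric.isClosed_closedBall.preimage continuous_fst).inter
        ((Metric.isClosed_closedBall.preimage continuous_snd).inter
          ((Submodule.closed_of_finiteDimensional _).preimage (continuous_snd.sub continuous_fst)))
    convert h1.union (h2.inter h3) using 1
    ext p
    simp only [SlideRel, mem_ofPred_eq, mem_union, mem_inter_iff, mem_prod, mem_preimage,
      mem_singleton_iff, sub_eq_zero]
    tauto
  · rintro x hx z hz ⟨-, -, hr⟩
    exact slideRel_unique hg hfg hx hz (hh x hx).1 hr (hh x hx).2

/-- Two functions strictly increasing along `e` in a ball, and equal outside it, differ by a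
homeomorphism. -/
theorem exists_slide (hKc : IsCompact K) {𝓐 : Set (Set E)} (h𝓐 : ∀ A ∈ 𝓐, A ⊆ K) (he : e ≠ 0)
    (hKA : K ∈ 𝓐) (hinv : ∀ A ∈ 𝓐, TransInv A x₀ e r)
    (hfc : ContinuousOn f K) (hgc : ContinuousOn g K)
    (hf : IncrAlong K x₀ e r f) (hg : IncrAlong K x₀ e r g)
    (hfg : ∀ x ∈ K, x ∉ Metric.ball x₀ r → f x = g x) :
    ∃ h h' : E → E, AutPair K 𝓐 h h' ∧ ∀ x ∈ K, g (h x) = f x := by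
  have hgf : ∀ x ∈ K, x ∉ Metric.ball x₀ r → g x = f x := fun x hx hn => (hfg x hx hn).symm
  obtain ⟨h, hc, hh⟩ := exists_slide_map hKc he (hinv K hKA) hfc hgc hf hg hfg
  obtain ⟨h', hc', hh'⟩ := exists_slide_map hKc he (hinv K hKA) hgc hfc hg hf hgf
  have hmaps : ∀ (f g : E → ℝ) (k : E → E), (∀ x ∈ K, SlideRel x₀ e r f g x (k x)) →
      ∀ A ∈ 𝓐, MapsTo k A A := by
    intro f g k hk A hA x hx
    rcases hk x (h𝓐 A hA hx) with ⟨h1, -⟩ | ⟨h1, h2, h3, -⟩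
    · rwa [h1]
    · obtain ⟨τ, hτ⟩ := Submodule.mem_span_singleton.1 h3
      have e1 : k x = x + τ • e := by rw [hτ]; abel
      rw [e1] at h2 ⊢
      exact hinv A hA x hx h1 τ h2
  refine ⟨h, h', ⟨hc, hc', fun x hx => ?_, fun x hx => ?_, hmaps f g h fun x hx => (hh x hx).2,
    hmaps g f h' fun x hx => (hh' x hx).2⟩, fun x hx => ?_⟩
  · exact slideRel_unique hf hgf (hh x hx).1 (hh' _ (hh x hx).1).1 hx (hh' _ (hh x hx).1).2
      (slideRel_symm (hh x hx).2)
  · exact slideRel_unique hg hfg (hh' x hx).1 (hh _ (hh' x hx).1).1 hx (hh _ (hh' x hx).1).2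
      (slideRel_symm (hh' x hx).2)
  · rcases (hh x hx).2 with ⟨h1, h2⟩ | ⟨-, -, -, h4⟩
    · rw [h1, hfg x hx h2]
    · exact h4

/-- Every increment along `e` in the closed ball is at least `δ` times the displacement. -/
def IncrAtLeast (K : Set E) (x₀ e : E) (r δ : ℝ) (f : E → ℝ) : Prop :=
  ∀ x ∈ K, x ∈ Metric.closedBall x₀ r → ∀ τ : ℝ, 0 ≤ τ → x + τ • e ∈ K →
    x + τ • e ∈ Metric.closedBall x₀ r → δ * τ ≤ f (x + τ • e) - f x

theorem exists_patch (hKc : IsCompact K) {𝓐 : Set (Set E)} (h𝓐 : ∀ A ∈ 𝓐, A ⊆ K)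
    (hKA : K ∈ 𝓐) {α : Type*} (J : Finset α) {x e : α → E} {r : α → ℝ} {δ κ : ℝ}
    (hr : ∀ i, 0 < r i) (he : ∀ i, e i ≠ 0)
    (hinv : ∀ i, ∀ A ∈ 𝓐, TransInv A (x i) (e i) (r i)) {F₀ F₁ : E → ℝ}
    (hF₀ : ContinuousOn F₀ K) (hF₁ : ContinuousOn F₁ K)
    (h₀ : ∀ i ∈ J, IncrAtLeast K (x i) (e i) (r i) δ F₀)
    (h₁ : ∀ i ∈ J, IncrAtLeast K (x i) (e i) (r i) δ F₁)
    (hκ : ∀ y ∈ K, |F₁ y - F₀ y| ≤ κ) (hsmall : ∀ i ∈ J, (∑ j ∈ J, 2 / r j) * ‖e i‖ * κ < δ)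
    {I : Finset α} (hIJ : I ⊆ J) :
    ∃ h h' : E → E, AutPair K 𝓐 h h' ∧ ∀ y ∈ K,
      (fun y => F₀ y + multiCutoff I x r y * (F₁ y - F₀ y)) (h y) = F₀ y := by
  classical
  have hcont : ∀ I : Finset α,
      ContinuousOn (fun y => F₀ y + multiCutoff I x r y * (F₁ y - F₀ y)) K := fun I =>
    hF₀.add ((continuous_multiCutoff I x r).continuousOn.mul (hF₁.sub hF₀))
  have hincr : ∀ I ⊆ J, ∀ j ∈ J, IncrAlong K (x j) (e j) (r j)
      (fun y => F₀ y + multiCutoff I x r y * (F₁ y - F₀ y)) := by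
    intro I hI j hj y hy hyb τ hτ hy' hyb'
    set y' := y + τ • e j with hy'_def
    have hd : dist y' y = τ * ‖e j‖ := by
      rw [dist_eq_norm, hy'_def, add_sub_cancel_left, norm_smul, Real.norm_eq_abs, abs_of_pos hτ]
    have h1 := abs_multiCutoff_sub_le hI (x := x) hr y' y
    rw [hd] at h1
    have a0 := h₀ j hj y hy hyb τ hτ.le hy' hyb'
    have a1 := h₁ j hj y hy hyb τ hτ.le hy' hyb'
    rw [← hy'_def] at a0 a1
    have hl := multiCutoff_mem I x r y'
    have hk := hκ y hy
    have hsm : (∑ j ∈ J, 2 / r j) * (τ * ‖e j‖) * κ < δ * τ := by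
      have := mul_lt_mul_of_pos_right (hsmall j hj) hτ
      calc _ = (∑ j ∈ J, 2 / r j) * ‖e j‖ * κ * τ := by ring
        _ < _ := this
    have hprod : |(multiCutoff I x r y' - multiCutoff I x r y) * (F₁ y - F₀ y)| ≤
        (∑ j ∈ J, 2 / r j) * (τ * ‖e j‖) * κ := by
      rw [abs_mul]
      exact mul_le_mul h1 hk (abs_nonneg _) ((abs_nonneg _).trans h1)
    have hneg := (abs_le.1 hprod).1
    have b0 := mul_le_mul_of_nonneg_left a0 (sub_nonneg.2 hl.2)
    have b1 := mul_le_mul_of_nonneg_left a1 hl.1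
    simp only
    nlinarith
  induction I using Finset.induction_on with
  | empty => exact ⟨id, id, AutPair.refl K 𝓐, fun y _ => by simp [multiCutoff]⟩
  | insert j I hj ih =>
    obtain ⟨h, h', H, hH⟩ := ih ((Finset.subset_insert j I).trans hIJ)
    have hjJ : j ∈ J := hIJ (Finset.mem_insert_self j I)
    obtain ⟨k, k', H', hH'⟩ := exists_slide hKc h𝓐 (he j) hKA (hinv j) (hcont I)
      (hcont (insert j I)) (hincr I ((Finset.subset_insert j I).trans hIJ) j hjJ)
      (hincr (insert j I) hIJ j hjJ) (fun y _ hn => by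
        simp only [multiCutoff, Finset.prod_insert hj, cutoff_eq_zero (hr j) hn]
        ring)
    refine ⟨k ∘ h, h' ∘ k', H.comp hKA H', fun y hy => ?_⟩
    exact (hH' _ (H.maps K hKA hy)).trans (hH y hy)

/-- If every zero of `G 0` has a direction along which all the functions `G t` increase uniformly,
then the zero sets of `G t`, for small `t`, are equivalent to the zero set of `G 0`. -/
theorem exists_autPair_zeros (hKc : IsCompact K) {𝓐 : Set (Set E)} (h𝓐 : ∀ A ∈ 𝓐, A ⊆ K)
    (hKA : K ∈ 𝓐) {G : ℝ → E → ℝ}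
    (hG : ContinuousOn (fun p : ℝ × E => G p.1 p.2) (Icc (0:ℝ) 1 ×ˢ K))
    (hloc : ∀ x ∈ K, G 0 x = 0 → ∃ e : E, e ≠ 0 ∧ ∃ δ > 0, ∃ r > 0,
      (∀ t ∈ Ico 0 r, ∀ y ∈ K, y ∈ Metric.ball x r → ∀ τ : ℝ, 0 ≤ τ → y + τ • e ∈ K →
        y + τ • e ∈ Metric.ball x r → δ * τ ≤ G t (y + τ • e) - G t y) ∧
      ∀ A ∈ 𝓐, ∀ y ∈ A, y ∈ Metric.ball x r → ∀ τ : ℝ, y + τ • e ∈ Metric.ball x r →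
        y + τ • e ∈ A) :
    ∃ t₀ > 0, ∀ t ∈ Ioo 0 t₀, (∃ h h' : E → E, AutPair K 𝓐 h h' ∧
      ∀ x ∈ K, (G t (h x) = 0 ↔ G 0 x = 0)) ∧
      ∀ y ∈ K, G t y = 0 → ∃ e : E, ∃ ρ > (0:ℝ), ∀ τ ∈ Ioo 0 ρ,
        G t (y - τ • e) < 0 ∧ 0 < G t (y + τ • e) ∧
        ∀ A ∈ 𝓐, y ∈ A → y - τ • e ∈ A ∧ y + τ • e ∈ A := by
  classical
  have h01 : (0:ℝ) ∈ Icc (0:ℝ) 1 := by simp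
  have hGt : ∀ t ∈ Icc (0:ℝ) 1, ContinuousOn (G t) K := fun t ht =>
    hG.comp (f := fun x => (t, x)) (by fun_prop) fun x hx => ⟨ht, hx⟩
  set Z : Set E := K ∩ (G 0) ⁻¹' {0} with hZ
  have hZc : IsCompact Z := hKc.of_isClosed_subset
    ((hGt 0 h01).preimage_isClosed_of_isClosed hKc.isClosed isClosed_singleton) inter_subset_left
  choose e he δ hδ r hr hinc hinv using fun z : Z => hloc z.1 z.2.1 z.2.2
  obtain ⟨J, hJ⟩ := hZc.elim_finite_subcover (fun z : Z => Metric.ball z.1 (r z / 4))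
    (fun z => Metric.isOpen_ball) fun z hz => mem_iUnion.2
      ⟨⟨z, hz⟩, Metric.mem_ball_self (by have := hr ⟨z, hz⟩; positivity)⟩
  set U : Set E := ⋃ z ∈ J, Metric.ball (z : E) (r z / 4) with hU
  have hUo : IsOpen U := isOpen_biUnion fun z _ => Metric.isOpen_ball
  have hη : ∃ η > 0, ∀ y ∈ K, y ∉ U → η ≤ |G 0 y| := by
    rcases (K \ U).eq_empty_or_nonempty with hem | hne
    · exact ⟨1, one_pos, fun y hy hyU => absurd (show y ∈ K \ U from ⟨hy, hyU⟩) (by simp [hem])⟩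
    · obtain ⟨y, hy, hmin⟩ := (hKc.diff hUo).exists_isMinOn hne
        (((hGt 0 h01).mono sdiff_subset).abs)
      refine ⟨|G 0 y|, abs_pos.2 fun h0 => hy.2 (hJ ⟨hy.1, h0⟩), fun z hz hzU =>
        isMinOn_iff.1 hmin z ⟨hz, hzU⟩⟩
  obtain ⟨η, hη, hηmin⟩ := hη
  have hδ' : ∃ d > 0, ∀ z ∈ J, d ≤ δ z := by
    rcases J.eq_empty_or_nonempty with rfl | hne
    · exact ⟨1, one_pos, by simp⟩
    · obtain ⟨z, hz, hmin⟩ := J.exists_min_image δ hne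
      exact ⟨δ z, hδ z, hmin⟩
  obtain ⟨d, hd, hdmin⟩ := hδ'
  have hρ' : ∃ ρ > 0, ∀ z ∈ J, ρ ≤ r z := by
    rcases J.eq_empty_or_nonempty with rfl | hne
    · exact ⟨1, one_pos, by simp⟩
    · obtain ⟨z, hz, hmin⟩ := J.exists_min_image r hne
      exact ⟨r z, hr z, hmin⟩
  obtain ⟨ρ, hρ, hρmin⟩ := hρ'
  set L := ∑ z ∈ J, 2 / (r z / 2) with hL
  set M := ∑ z ∈ J, ‖e z‖ with hM
  have hL0 : 0 ≤ L := Finset.sum_nonneg fun z _ => by have := hr z; positivity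
  have hM0 : 0 ≤ M := Finset.sum_nonneg fun z _ => norm_nonneg _
  set κ := min (η / 2) (d / (L * M + 1) / 2) with hκ
  have hκpos : 0 < κ := by positivity
  have hunif := (isCompact_Icc.prod hKc).uniformContinuousOn_of_continuous hG
  obtain ⟨t₂, ht₂, hclose⟩ := Metric.uniformContinuousOn_iff.1 hunif κ hκpos
  refine ⟨min (min t₂ ρ) 1, by positivity, fun t ht => ?_⟩
  have htI : t ∈ Icc (0:ℝ) 1 := ⟨ht.1.le, ht.2.le.trans (min_le_right _ _)⟩
  have hdist : ∀ y ∈ K, |G t y - G 0 y| ≤ κ := by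
    intro y hy
    have := hclose (t, y) ⟨htI, hy⟩ (0, y) ⟨h01, hy⟩ (by
      rw [Prod.dist_eq, dist_self, max_eq_left dist_nonneg, Real.dist_eq, sub_zero,
        abs_of_pos ht.1]
      exact ht.2.trans_le ((min_le_left _ _).trans (min_le_left _ _)))
    exact (Real.dist_eq _ _ ▸ this).le
  have hcb : ∀ z : Z, Metric.closedBall (z : E) (r z / 2) ⊆ Metric.ball (z : E) (r z) := fun z =>
    Metric.closedBall_subset_ball (half_lt_self (hr z))
  have hatleast : ∀ z ∈ J, ∀ s ∈ Ico 0 (r z),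
      IncrAtLeast K (z : E) (e z) (r z / 2) d (G s) := by
    intro z hz s hs y hy hyb τ hτ hy' hyb'
    refine le_trans ?_ (hinc z s hs y hy (hcb z hyb) τ hτ hy' (hcb z hyb'))
    exact mul_le_mul_of_nonneg_right (hdmin z hz) hτ
  refine ⟨?_, ?_⟩
  swap
  · intro y hy h0
    have hyU : y ∈ U := by
      by_contra hyU
      have h1 := hηmin y hy hyU
      have h2 := hdist y hy
      have h3 : κ ≤ η / 2 := min_le_left _ _
      rw [h0, zero_sub, abs_neg] at h2
      linarith
    simp only [hU, mem_iUnion] at hyU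
    obtain ⟨z, hz, hzb⟩ := hyU
    have htr : t ∈ Ico 0 (r z) := ⟨ht.1.le, ht.2.trans_le
      (((min_le_left _ _).trans (min_le_right _ _)).trans (hρmin z hz))⟩
    have hrz := hr z
    have hez : 0 < ‖e z‖ := norm_pos_iff.2 (he z)
    have hyb : y ∈ Metric.ball (z : E) (r z) :=
      Metric.ball_subset_ball (by linarith) hzb
    have hnear : ∀ τ : ℝ, |τ| < r z / 2 / ‖e z‖ → y + τ • e z ∈ Metric.ball (z : E) (r z) := by
      intro τ hτ
      rw [lt_div_iff₀ hez] at hτ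
      rw [Metric.mem_ball] at hzb ⊢
      have h1 : dist (y + τ • e z) y = |τ| * ‖e z‖ := by
        rw [dist_eq_norm, add_sub_cancel_left, norm_smul, Real.norm_eq_abs]
      have := dist_triangle (y + τ • e z) y (z : E)
      linarith
    refine ⟨e z, r z / 2 / ‖e z‖, by positivity, fun τ hτ => ?_⟩
    have hp := hnear τ (by rw [abs_of_pos hτ.1]; exact hτ.2)
    have hm := hnear (-τ) (by rw [abs_neg, abs_of_pos hτ.1]; exact hτ.2)
    have e1 : y - τ • e z = y + (-τ) • e z := by rw [neg_smul]; abel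
    have e2 : y + (-τ) • e z + τ • e z = y := by module
    have hinvA : ∀ A ∈ 𝓐, y ∈ A → y - τ • e z ∈ A ∧ y + τ • e z ∈ A := fun A hA hyA =>
      ⟨e1 ▸ hinv z A hA y hyA hyb (-τ) hm, hinv z A hA y hyA hyb τ hp⟩
    have hδτ : 0 < δ z * τ := mul_pos (hδ z) hτ.1
    refine ⟨?_, ?_, hinvA⟩
    · have := hinc z t htr _ (e1 ▸ (hinvA K hKA hy).1) hm τ hτ.1.le
        (by rw [e2]; exact hy) (by rw [e2]; exact hyb)
      rw [e2, h0] at this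
      rw [e1]; linarith
    · have := hinc z t htr y hy hyb τ hτ.1.le (hinvA K hKA hy).2 hp
      linarith
  obtain ⟨h, h', H, hH⟩ := exists_patch hKc h𝓐 hKA J (x := fun z : Z => (z : E)) (e := e)
    (r := fun z => r z / 2) (δ := d) (κ := κ) (F₀ := G 0) (F₁ := G t)
    (fun z => half_pos (hr z)) he
    (fun z A hA y hy hyb τ hyb' => hinv z A hA y hy (hcb z hyb) τ (hcb z hyb'))
    (hGt 0 h01) (hGt t htI) (fun z hz => hatleast z hz 0 ⟨le_rfl, hr z⟩)
    (fun z hz => hatleast z hz t ⟨ht.1.le, ht.2.trans_le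
      (((min_le_left _ _).trans (min_le_right _ _)).trans (hρmin z hz))⟩)
    hdist (fun z hz => by
      have h1 : ‖e z‖ ≤ M := Finset.single_le_sum (f := fun z => ‖e z‖)
        (fun z _ => norm_nonneg _) hz
      have h2 : L * ‖e z‖ * κ ≤ L * M * κ := by gcongr
      have h3 : κ ≤ d / (L * M + 1) / 2 := min_le_right _ _
      have h4 : L * M * κ ≤ L * M * (d / (L * M + 1) / 2) := by gcongr
      have h5 : (L * M + 1) * (d / (L * M + 1)) = d := by field_simp
      have h6 : 0 < d / (L * M + 1) := by positivity
      change L * ‖e z‖ * κ < d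
      nlinarith) (Finset.Subset.refl J)
  refine ⟨h, h', H, fun x hx => ?_⟩
  have hy := H.maps K hKA hx
  have hkey := hH x hx
  simp only at hkey
  set y := h x with hy_def
  rw [← hkey]
  have hmul := multiCutoff_mem J (fun z : Z => (z : E)) (fun z => r z / 2) y
  by_cases hyU : y ∈ U
  · have h1 : multiCutoff J (fun z : Z => (z : E)) (fun z => r z / 2) y = 1 := by
      simp only [hU, mem_iUnion] at hyU
      obtain ⟨z, hz, hzb⟩ := hyU
      rw [multiCutoff, Finset.prod_eq_zero hz, sub_zero]
      rw [cutoff_eq_one (half_pos (hr z)), sub_self]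
      rw [Metric.mem_ball] at hzb
      linarith
    rw [h1]; ring_nf
  · have h1 := hηmin y hy hyU
    have h2 : κ ≤ η / 2 := min_le_left _ _
    have h3 := hdist y hy
    have h4 : |multiCutoff J (fun z : Z => (z : E)) (fun z => r z / 2) y *
        (G t y - G 0 y)| ≤ κ := by
      rw [abs_mul, abs_of_nonneg hmul.1]
      calc _ ≤ 1 * |G t y - G 0 y| := mul_le_mul_of_nonneg_right hmul.2 (abs_nonneg _)
        _ ≤ κ := by rwa [one_mul]
    refine iff_of_false (fun h0 => ?_) fun h0 => ?_
    · rw [h0, zero_sub, abs_neg] at h3; linarith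
    · rw [eq_neg_of_add_eq_zero_left h0, abs_neg] at h1; linarith

end Slide

section Quadrants

theorem quadRefl_add (s : Bool × Bool) (p q : ℝ × ℝ) :
    quadRefl s (p + q) = quadRefl s p + quadRefl s q := by
  rcases s with ⟨_ | _, _ | _⟩ <;> ext <;> simp [quadRefl] <;> ring

theorem quadRefl_smul (s : Bool × Bool) (a : ℝ) (q : ℝ × ℝ) :
    quadRefl s (a • q) = a • quadRefl s q := by
  rcases s with ⟨_ | _, _ | _⟩ <;> ext <;> simp [quadRefl]

theorem quadRefl_sub (s : Bool × Bool) (p q : ℝ × ℝ) :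
    quadRefl s (p - q) = quadRefl s p - quadRefl s q := by
  rcases s with ⟨_ | _, _ | _⟩ <;> ext <;> simp [quadRefl] <;> ring

theorem quadRefl_quadRefl (s : Bool × Bool) (q : ℝ × ℝ) : quadRefl s (quadRefl s q) = q := by
  rcases s with ⟨_ | _, _ | _⟩ <;> ext <;> simp [quadRefl]

theorem continuous_quadRefl (s : Bool × Bool) : Continuous (quadRefl s) := by
  rcases s with ⟨_ | _, _ | _⟩ <;> unfold quadRefl <;> 
    simp only [Bool.false_eq_true, if_true, if_false] <;> fun_prop

theorem dist_quadRefl (s : Bool × Bool) (p q : ℝ × ℝ) :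
    dist (quadRefl s p) (quadRefl s q) = dist p q := by
  rcases s with ⟨_ | _, _ | _⟩ <;> simp [quadRefl, Prod.dist_eq, dist_neg_neg]

/-- The signs of the coordinates of a point. -/
def quadrant (x : ℝ × ℝ) : Bool × Bool := (decide (x.1 < 0), decide (x.2 < 0))

/-- The representative of a point in the closed positive quadrant. -/
def absPt (x : ℝ × ℝ) : ℝ × ℝ := (|x.1|, |x.2|)

theorem quadRefl_quadrant (x : ℝ × ℝ) : quadRefl (quadrant x) (absPt x) = x := by
  ext
  · by_cases h : x.1 < 0
    · simp [quadRefl, quadrant, absPt, h, abs_of_neg h]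
    · simp [quadRefl, quadrant, absPt, h, abs_of_nonneg (not_lt.1 h)]
  · by_cases h : x.2 < 0
    · simp [quadRefl, quadrant, absPt, h, abs_of_neg h]
    · simp [quadRefl, quadrant, absPt, h, abs_of_nonneg (not_lt.1 h)]

theorem absPt_of_nonneg {q : ℝ × ℝ} (hq : 0 ≤ q.1 ∧ 0 ≤ q.2) : absPt q = q := by
  simp [absPt, abs_of_nonneg hq.1, abs_of_nonneg hq.2]

theorem absPt_quadRefl (s : Bool × Bool) {q : ℝ × ℝ} (hq : 0 ≤ q.1 ∧ 0 ≤ q.2) :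
    absPt (quadRefl s q) = q := by
  rw [← absPt_of_nonneg hq]
  rcases s with ⟨_ | _, _ | _⟩ <;> simp [quadRefl, absPt]

theorem quadrant_fst {s : Bool × Bool} {q : ℝ × ℝ} (hq : 0 < q.1) :
    (quadrant (quadRefl s q)).1 = s.1 := by
  rcases s with ⟨_ | _, b⟩
  · simp [quadrant, quadRefl, hq.le]
  · simp [quadrant, quadRefl, hq]

theorem quadrant_snd {s : Bool × Bool} {q : ℝ × ℝ} (hq : 0 < q.2) :
    (quadrant (quadRefl s q)).2 = s.2 := by
  rcases s with ⟨a, _ | _⟩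
  · simp [quadrant, quadRefl, hq.le]
  · simp [quadrant, quadRefl, hq]

theorem quadRefl_eq_of_ne {s s' : Bool × Bool} {q : ℝ × ℝ} (h1 : q.1 ≠ 0 → s.1 = s'.1)
    (h2 : q.2 ≠ 0 → s.2 = s'.2) : quadRefl s q = quadRefl s' q := by
  ext
  · by_cases h : q.1 = 0
    · simp [quadRefl, h]
    · simp [quadRefl, h1 h]
  · by_cases h : q.2 = 0
    · simp [quadRefl, h]
    · simp [quadRefl, h2 h]

theorem mem_tildeSet {A : Set (ℝ × ℝ)} {x : ℝ × ℝ} :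
    x ∈ tildeSet A ↔ ∃ s, ∃ q ∈ A, quadRefl s q = x := by
  simp only [tildeSet, mem_iUnion, mem_image]

theorem quadRefl_mem_tildeSet {A : Set (ℝ × ℝ)} (s : Bool × Bool) {q : ℝ × ℝ} (hq : q ∈ A) :
    quadRefl s q ∈ tildeSet A := mem_tildeSet.2 ⟨s, q, hq, rfl⟩

theorem isCompact_tildeSet {A : Set (ℝ × ℝ)} (hA : IsCompact A) : IsCompact (tildeSet A) :=
  isCompact_iUnion fun s => hA.image (continuous_quadRefl s)

/-- Continuity on the symmetric extension can be checked on every quadrant. -/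
theorem continuousOn_tildeSet {Z : Type*} [TopologicalSpace Z] {T : Set ℝ} (hT : IsClosed T)
    {A : Set (ℝ × ℝ)} (hA : IsCompact A) {f : ℝ × (ℝ × ℝ) → Z}
    (hf : ∀ s, ContinuousOn (fun p : ℝ × (ℝ × ℝ) => f (p.1, quadRefl s p.2)) (T ×ˢ A)) :
    ContinuousOn f (T ×ˢ tildeSet A) := by
  rw [tildeSet, prod_iUnion]
  refine (locallyFinite_of_finite _).continuousOn_iUnion
    (fun s => hT.prod (hA.image (continuous_quadRefl s)).isClosed) fun s => ?_
  have hc : ContinuousOn (fun p : ℝ × (ℝ × ℝ) => (p.1, quadRefl s p.2))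
      (T ×ˢ (quadRefl s '' A)) :=
    (continuous_fst.prodMk ((continuous_quadRefl s).comp continuous_snd)).continuousOn
  have := (hf s).comp hc (by
    rintro ⟨t, x⟩ ⟨ht, q, hq, hx⟩
    refine ⟨ht, ?_⟩
    simp only at hx ⊢
    rwa [← hx, quadRefl_quadRefl])
  refine this.congr fun p _ => ?_
  simp [quadRefl_quadRefl]

variable {ι : Type*} [Fintype ι] {v : ι → ℝ × ℝ} {ν : ι → ℝ} {sg : Bool × Bool → ι → ℝ}
  {c : ℝ → ι → ℝ}

/-- The sign attached to `i` in a quadrant depends on the sign of a coordinate only if the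
corresponding exponent does not vanish. -/
def SignCompat (v : ι → ℝ × ℝ) (sg : Bool × Bool → ι → ℝ) : Prop :=
  ∀ i s s', ((v i).1 ≠ 0 → s.1 = s'.1) → ((v i).2 ≠ 0 → s.2 = s'.2) → sg s i = sg s' i

omit [Fintype ι] in
theorem nonneg_of_mem_convexHull (hv : ∀ i, 0 ≤ (v i).1 ∧ 0 ≤ (v i).2) {q : ℝ × ℝ}
    (hq : q ∈ convexHull ℝ (range v)) : 0 ≤ q.1 ∧ 0 ≤ q.2 := by
  have : convexHull ℝ (range v) ⊆ Ici 0 := by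
    refine convexHull_min ?_ (convex_Ici 0)
    rintro _ ⟨i, rfl⟩
    exact ⟨(hv i).1, (hv i).2⟩
  exact this hq

theorem mom_fst_pos (hv : ∀ i, 0 ≤ (v i).1 ∧ 0 ≤ (v i).2) {z : ι → ℝ} (hz : ∀ i, 0 ≤ z i) {i : ι}
    (hi : 0 < z i) (h : (v i).1 ≠ 0) : 0 < (mom v z).1 := by
  rw [mom_fst]
  exact Finset.sum_pos' (fun j _ => mul_nonneg (hz j) (hv j).1)
    ⟨i, Finset.mem_univ i, mul_pos hi ((hv i).1.lt_of_ne h.symm)⟩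

theorem mom_snd_pos (hv : ∀ i, 0 ≤ (v i).1 ∧ 0 ≤ (v i).2) {z : ι → ℝ} (hz : ∀ i, 0 ≤ z i) {i : ι}
    (hi : 0 < z i) (h : (v i).2 ≠ 0) : 0 < (mom v z).2 := by
  rw [mom_snd]
  exact Finset.sum_pos' (fun j _ => mul_nonneg (hz j) (hv j).2)
    ⟨i, Finset.mem_univ i, mul_pos hi ((hv i).2.lt_of_ne h.symm)⟩

theorem quadRefl_mom_eq (hv : ∀ i, 0 ≤ (v i).1 ∧ 0 ≤ (v i).2) {z w : ι → ℝ} (hz : ∀ i, 0 ≤ z i)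
    (hw : ∀ i, z i = 0 → w i = 0) (s : Bool × Bool) :
    quadRefl (quadrant (quadRefl s (mom v z))) (mom v w) = quadRefl s (mom v w) := by
  refine quadRefl_eq_of_ne (fun h => ?_) fun h => ?_
  · obtain ⟨i, -, hi⟩ := Finset.exists_ne_zero_of_sum_ne_zero (mom_fst (v := v) w ▸ h)
    refine quadrant_fst (mom_fst_pos hv hz (i := i) ((hz i).lt_of_ne fun h0 => hi ?_)
      fun h0 => hi ?_)
    · rw [hw i h0.symm, zero_mul]
    · rw [h0, mul_zero]
  · obtain ⟨i, -, hi⟩ := Finset.exists_ne_zero_of_sum_ne_zero (mom_snd (v := v) w ▸ h)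
    refine quadrant_snd (mom_snd_pos hv hz (i := i) ((hz i).lt_of_ne fun h0 => hi ?_)
      fun h0 => hi ?_)
    · rw [hw i h0.symm, zero_mul]
    · rw [h0, mul_zero]

theorem mul_sign_quadrant (hv : ∀ i, 0 ≤ (v i).1 ∧ 0 ≤ (v i).2) (hsg : SignCompat v sg) {z : ι → ℝ}
    (hz : ∀ i, 0 ≤ z i) (s : Bool × Bool) (i : ι) :
    z i * sg (quadrant (quadRefl s (mom v z))) i = z i * sg s i := by
  rcases (hz i).eq_or_lt with h | h
  · simp [← h]
  · rw [hsg i _ s (fun h1 => quadrant_fst (mom_fst_pos hv hz h h1))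
      fun h1 => quadrant_snd (mom_snd_pos hv hz h h1)]

/-- The function on the symmetric extension of the polygon which is equal to `height` with the
coefficients `sg s i * c t i` on the copy of the polygon indexed by `s`. -/
def quadHeight (v : ι → ℝ × ℝ) (ν : ι → ℝ) (sg : Bool × Bool → ι → ℝ) (c : ℝ → ι → ℝ) (t : ℝ)
    (x : ℝ × ℝ) : ℝ :=
  height v ν (fun t i => sg (quadrant x) i * c t i) t (absPt x)

theorem quadHeight_quadRefl (hv : ∀ i, 0 ≤ (v i).1 ∧ 0 ≤ (v i).2) (hsg : SignCompat v sg)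
    (hint : (interior (convexHull ℝ (range v))).Nonempty) {t : ℝ} (ht : t ∈ Icc (0:ℝ) 1)
    {q : ℝ × ℝ} (hq : q ∈ convexHull ℝ (range v)) (s : Bool × Bool) :
    quadHeight v ν sg c t (quadRefl s q) = height v ν (fun t i => sg s i * c t i) t q := by
  have hs := lift_spec (ν := ν) hint ht hq
  have h := mul_sign_quadrant hv hsg hs.1.1.1 s
  rw [hs.2] at h
  rw [quadHeight, absPt_quadRefl s (nonneg_of_mem_convexHull hv hq), height, height]
  refine Finset.sum_congr rfl fun i _ => ?_
  rw [← mul_assoc, h i, mul_assoc]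

theorem isCompact_hull (v : ι → ℝ × ℝ) : IsCompact (convexHull ℝ (range v)) :=
  (finite_range v).isCompact_convexHull (𝕜 := ℝ)

theorem continuousOn_quadHeight (hv : ∀ i, 0 ≤ (v i).1 ∧ 0 ≤ (v i).2) (hsg : SignCompat v sg)
    (hint : (interior (convexHull ℝ (range v))).Nonempty) (hc : ContinuousOn c (Icc 0 1)) :
    ContinuousOn (fun p : ℝ × (ℝ × ℝ) => quadHeight v ν sg c p.1 p.2)
      (Icc (0:ℝ) 1 ×ˢ tildeSet (convexHull ℝ (range v))) := by
  refine continuousOn_tildeSet isClosed_Icc (isCompact_hull v) fun s => ?_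
  refine (continuousOn_height (ν := ν) (c := fun t i => sg s i * c t i) hint ?_).congr ?_
  · exact continuousOn_pi.2 fun i => continuousOn_const.mul
      ((continuous_apply i).comp_continuousOn hc)
  · rintro ⟨t, q⟩ ⟨ht, hq⟩
    exact quadHeight_quadRefl hv hsg hint ht hq s

/-- The symmetric extension of a polygon together with the reflected copies of its faces. -/
def quadFaces (Θ : Set (ℝ × ℝ)) : Set (Set (ℝ × ℝ)) :=
  {A | A = tildeSet Θ ∨ ∃ s Φ, IsExposed ℝ Θ Φ ∧ A = quadRefl s '' Φ}

theorem subset_of_mem_quadFaces {Θ A : Set (ℝ × ℝ)} (hA : A ∈ quadFaces Θ) : A ⊆ tildeSet Θ := by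
  rcases hA with rfl | ⟨s, Φ, hΦ, rfl⟩
  · exact Subset.rfl
  · rintro _ ⟨q, hq, rfl⟩
    exact quadRefl_mem_tildeSet s (hΦ.subset hq)

/-- If no zero at the time `0` is degenerate, then the zero sets of `quadHeight` at small times
are all equivalent, and at these times the function changes its sign at every zero. -/
theorem exists_autPair_quadHeight (hv : ∀ i, 0 ≤ (v i).1 ∧ 0 ≤ (v i).2) (hsg : SignCompat v sg)
    (hint : (interior (convexHull ℝ (range v))).Nonempty) (hc : ContinuousOn c (Icc 0 1))
    (hnd : ∀ s, ∀ q ∈ convexHull ℝ (range v), height v ν (fun t i => sg s i * c t i) 0 q = 0 →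
      mom v (fun i => lift v ν 0 q i * (sg s i * c 0 i)) ≠ 0) :
    ∃ t₀ > 0, ∀ t ∈ Ioo 0 t₀, (∃ h h', AutPair (tildeSet (convexHull ℝ (range v)))
        (quadFaces (convexHull ℝ (range v))) h h' ∧
      ∀ x ∈ tildeSet (convexHull ℝ (range v)),
        (quadHeight v ν sg c t (h x) = 0 ↔ quadHeight v ν sg c 0 x = 0)) ∧
      ∀ y ∈ tildeSet (convexHull ℝ (range v)), quadHeight v ν sg c t y = 0 →
        ∃ e : ℝ × ℝ, ∃ ρ > (0:ℝ), ∀ τ ∈ Ioo 0 ρ,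
        quadHeight v ν sg c t (y - τ • e) < 0 ∧ 0 < quadHeight v ν sg c t (y + τ • e) ∧
        ∀ A ∈ quadFaces (convexHull ℝ (range v)), y ∈ A → y - τ • e ∈ A ∧ y + τ • e ∈ A := by
  set Θ := convexHull ℝ (range v) with hΘ
  have h01 : (0:ℝ) ∈ Icc (0:ℝ) 1 := by simp
  have hcs : ∀ s, ContinuousOn (fun t i => sg s i * c t i) (Icc 0 1) := fun s =>
    continuousOn_pi.2 fun i => continuousOn_const.mul ((continuous_apply i).comp_continuousOn hc)
  refine exists_autPair_zeros (isCompact_tildeSet (isCompact_hull v))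
    (fun A hA => subset_of_mem_quadFaces hA) (Or.inl rfl)
    (continuousOn_quadHeight hv hsg hint hc) ?_
  intro x hx hx0
  obtain ⟨s₀, q₀, hq₀, rfl⟩ := mem_tildeSet.1 hx
  have hs₀ := lift_spec (ν := ν) hint h01 hq₀
  set e₀ := mom v (fun i => lift v ν 0 q₀ i * (sg s₀ i * c 0 i)) with he₀_def
  rw [quadHeight_quadRefl hv hsg hint h01 hq₀] at hx0
  have he₀ : e₀ ≠ 0 := hnd s₀ q₀ hq₀ hx0
  set e := quadRefl s₀ e₀ with he_def
  have he : e ≠ 0 := fun h => he₀ (by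
    rw [← quadRefl_quadRefl s₀ e₀, ← he_def, h]; simp [quadRefl])
  have hcopy : ∀ s, quadRefl s q₀ = quadRefl s₀ q₀ →
      (∀ i, lift v ν 0 q₀ i * sg s i = lift v ν 0 q₀ i * sg s₀ i) ∧ quadRefl s e₀ = e := by
    intro s hs
    constructor
    · intro i
      have h1 := mul_sign_quadrant hv hsg hs₀.1.1.1 s i
      have h2 := mul_sign_quadrant hv hsg hs₀.1.1.1 s₀ i
      rw [hs₀.2, hs] at h1
      rw [hs₀.2] at h2
      rw [← h1, ← h2]
    · have h1 := fun s => quadRefl_mom_eq hv hs₀.1.1.1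
        (w := fun i => lift v ν 0 q₀ i * (sg s₀ i * c 0 i)) (fun i hi => by simp [hi]) s
      simp only [hs₀.2] at h1
      have h2 := h1 s
      rw [hs, h1 s₀] at h2
      exact h2.symm
  have hlocal : ∀ s, ∃ δ > 0, ∃ r > 0, ∀ q ∈ Θ, quadRefl s q ∈ Metric.ball (quadRefl s₀ q₀) r →
      (∀ τ : ℝ, quadRefl s q + τ • e ∈ Metric.ball (quadRefl s₀ q₀) r →
        quadRefl s q + τ • e ∈ quadRefl s '' Θ ∧
        (∀ Φ, IsExposed ℝ Θ Φ → q ∈ Φ → quadRefl s q + τ • e ∈ quadRefl s '' Φ) ∧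
        (0 ≤ τ → ∀ t ∈ Ico 0 r, δ * τ ≤ quadHeight v ν sg c t (quadRefl s q + τ • e) -
          quadHeight v ν sg c t (quadRefl s q))) := by
    intro s
    by_cases hs : quadRefl s q₀ = quadRefl s₀ q₀
    · obtain ⟨hcoef, hes⟩ := hcopy s hs
      have hcoef' : ∀ i, lift v ν 0 q₀ i * (sg s i * c 0 i) =
          lift v ν 0 q₀ i * (sg s₀ i * c 0 i) := fun i => by
        rw [← mul_assoc, hcoef i, mul_assoc]
      have he_eq : mom v (fun i => lift v ν 0 q₀ i * (sg s i * c 0 i)) = e₀ := by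
        simp_rw [hcoef']; rfl
      have hx0' : height v ν (fun t i => sg s i * c t i) 0 q₀ = 0 := by
        exact (Finset.sum_congr rfl fun i _ => hcoef' i : _ = height v ν
          (fun t i => sg s₀ i * c t i) 0 q₀).trans hx0
      obtain ⟨δ, hδ, r₁, hr₁, H₁⟩ := exists_uniform_increase (ν := ν) hint (hcs s) hq₀ hx0'
        (by rw [he_eq]; exact he₀)
      obtain ⟨r₂, hr₂, H₂⟩ := exists_translation_invariant (ν := ν) hint
        (c := fun i => sg s i * c 0 i) hq₀ hx0' (by rw [he_eq]; exact he₀)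
      rw [he_eq] at H₁ H₂
      have hball : ∀ {q : ℝ × ℝ} {r}, r ≤ min (min r₁ r₂) 1 →
          quadRefl s q ∈ Metric.ball (quadRefl s₀ q₀) r →
          q ∈ Metric.ball q₀ r₁ ∧ q ∈ Metric.ball q₀ r₂ := by
        intro q r hr h
        rw [← hs, Metric.mem_ball, dist_quadRefl] at h
        exact ⟨h.trans_le (hr.trans ((min_le_left _ _).trans (min_le_left _ _))),
          h.trans_le (hr.trans ((min_le_left _ _).trans (min_le_right _ _)))⟩
      refine ⟨δ, hδ, min (min r₁ r₂) 1, by positivity, fun q hq hqb τ hτb => ?_⟩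
      have hmove : quadRefl s q + τ • e = quadRefl s (q + τ • e₀) := by
        rw [quadRefl_add, quadRefl_smul, hes]
      rw [hmove] at hτb ⊢
      have b1 := hball le_rfl hqb
      have b2 := hball le_rfl hτb
      obtain ⟨hinv, hface⟩ := H₂ q hq b1.2
      have hmem := hinv τ b2.2
      refine ⟨⟨_, hmem, rfl⟩, fun Φ hΦ hqΦ => ⟨_, ?_, rfl⟩, fun hτ t ht => ?_⟩
      · obtain ⟨l, rfl⟩ := hΦ ⟨q, hqΦ⟩
        have hl := hface l hqΦ.2
        refine ⟨hmem, fun y hy => ?_⟩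
        rw [map_add, map_smul, hl, smul_zero, add_zero]
        exact hqΦ.2 y hy
      · have htI : t ∈ Icc (0:ℝ) 1 := ⟨ht.1, ht.2.le.trans (min_le_right _ _)⟩
        rw [quadHeight_quadRefl hv hsg hint htI hmem, quadHeight_quadRefl hv hsg hint htI hq]
        exact H₁ t ⟨ht.1, ht.2.trans_le ((min_le_left _ _).trans (min_le_left _ _))⟩ q hq τ hτ hmem
          b1.1 b2.1
    · have hnot : quadRefl s₀ q₀ ∉ quadRefl s '' Θ := by
        rintro ⟨q, hq, h⟩
        have h1 := congrArg absPt h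
        rw [absPt_quadRefl s (nonneg_of_mem_convexHull hv hq),
          absPt_quadRefl s₀ (nonneg_of_mem_convexHull hv hq₀)] at h1
        exact hs (h1 ▸ h)
      obtain ⟨r, hr, hsub⟩ := Metric.isOpen_iff.1
        ((isCompact_hull v).image (continuous_quadRefl s)).isClosed.isOpen_compl _ hnot
      exact ⟨1, one_pos, r, hr, fun q hq hqb => absurd ⟨q, hq, rfl⟩ (hsub hqb)⟩
  choose δ hδ r hr H using hlocal
  obtain ⟨s₁, hs₁⟩ := Finite.exists_min δ
  obtain ⟨s₂, hs₂⟩ := Finite.exists_min r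
  refine ⟨e, he, δ s₁, hδ s₁, r s₂, hr s₂, ?_, ?_⟩
  · intro t ht y hy hyb τ hτ _ hyb'
    obtain ⟨s, q, hq, rfl⟩ := mem_tildeSet.1 hy
    have h1 := (H s q hq (Metric.ball_subset_ball (hs₂ s) hyb) τ
      (Metric.ball_subset_ball (hs₂ s) hyb')).2.2 hτ t ⟨ht.1, ht.2.trans_le (hs₂ s)⟩
    exact (mul_le_mul_of_nonneg_right (hs₁ s) hτ).trans h1
  · intro A hA y hy hyb τ hyb'
    rcases hA with rfl | ⟨s, Φ, hΦ, rfl⟩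
    · obtain ⟨s, q, hq, rfl⟩ := mem_tildeSet.1 hy
      obtain ⟨q', hq', h⟩ := (H s q hq (Metric.ball_subset_ball (hs₂ s) hyb) τ
        (Metric.ball_subset_ball (hs₂ s) hyb')).1
      exact h ▸ quadRefl_mem_tildeSet s hq'
    · obtain ⟨q, hq, rfl⟩ := hy
      exact (H s q (hΦ.subset hq) (Metric.ball_subset_ball (hs₂ s) hyb) τ
        (Metric.ball_subset_ball (hs₂ s) hyb')).2.1 Φ hΦ hq

end Quadrants

section Reparametrization

variable {ι : Type*} [Fintype ι] {v : ι → ℝ × ℝ} {ν : ι → ℝ} {sg : Bool × Bool → ι → ℝ}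

/-- The action of the torus on the simplex. -/
def twist (w z : ι → ℝ) (i : ι) : ℝ := w i * z i / ∑ j, w j * z j

theorem sum_twist_pos {w z : ι → ℝ} (hw : ∀ i, 0 < w i) (hz : z ∈ stdSimplex ℝ ι) :
    0 < ∑ i, w i * z i := by
  obtain ⟨i, -, hi⟩ := Finset.exists_ne_zero_of_sum_ne_zero (hz.2 ▸ one_ne_zero)
  exact Finset.sum_pos' (fun j _ => mul_nonneg (hw j).le (hz.1 j))
    ⟨i, Finset.mem_univ i, mul_pos (hw i) ((hz.1 i).lt_of_ne' hi)⟩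

theorem twist_mem_stdSimplex {w z : ι → ℝ} (hw : ∀ i, 0 < w i) (hz : z ∈ stdSimplex ℝ ι) :
    twist w z ∈ stdSimplex ℝ ι :=
  normalized_mem_stdSimplex (fun i => mul_nonneg (hw i).le (hz.1 i)) (sum_twist_pos hw hz)

theorem twist_eq_zero {w z : ι → ℝ} (hw : ∀ i, 0 < w i) (hz : z ∈ stdSimplex ℝ ι) (i : ι) :
    twist w z i = 0 ↔ z i = 0 := by
  simp [twist, (hw i).ne', (sum_twist_pos hw hz).ne']

theorem twist_inv_twist {w w' z : ι → ℝ} (hw : ∀ i, 0 < w i) (hww' : ∀ i, w' i * w i = 1)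
    (hz : z ∈ stdSimplex ℝ ι) : twist w' (twist w z) = z := by
  have hN := sum_twist_pos hw hz
  have h : ∀ i, w' i * twist w z i = z i / ∑ j, w j * z j := fun i => by
    rw [twist, mul_div_assoc', ← mul_assoc, hww', one_mul]
  funext i
  rw [twist]
  simp_rw [h]
  rw [← Finset.sum_div, hz.2]
  field_simp

theorem twist_mem_toricSlice {s u : ℝ} (hs : 0 ≤ s) (hu : 0 < u) {z : ι → ℝ}
    (hz : z ∈ toricSlice v ν s) : twist (fun i => u ^ ν i) z ∈ toricSlice v ν (s * u) := by
  have hw : ∀ i, 0 < u ^ ν i := fun i => Real.rpow_pos_of_pos hu _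
  refine ⟨twist_mem_stdSimplex hw hz.1, fun a b ha hb hsum hmom hle => ?_⟩
  have hN := sum_twist_pos hw hz.1
  have hprod : ∀ a : ι → ℝ, ∏ i, (u ^ ν i * z i) ^ a i =
      u ^ (∑ i, ν i * a i) * ∏ i, z i ^ a i := fun a => by
    rw [Real.rpow_sum_of_pos hu, ← Finset.prod_mul_distrib]
    refine Finset.prod_congr rfl fun i _ => ?_
    rw [Real.mul_rpow (hw i).le (hz.1.1 i), ← Real.rpow_mul hu.le]
  simp only [twist]
  rw [prod_normalized_rpow (fun i => mul_nonneg (hw i).le (hz.1.1 i)) hN,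
    prod_normalized_rpow (fun i => mul_nonneg (hw i).le (hz.1.1 i)) hN, hprod, hprod, hsum,
    hz.2 a b ha hb hsum hmom hle, Real.mul_rpow hs hu.le, Real.rpow_sub hu]
  have := (Real.rpow_pos_of_pos hu (∑ i, ν i * b i)).ne'
  field_simp

theorem continuousOn_twist {w : ι → ℝ} (hw : ∀ i, 0 < w i) :
    ContinuousOn (twist w) (stdSimplex ℝ ι) :=
  continuousOn_pi.2 fun i => ContinuousOn.div (by fun_prop) (by fun_prop)
    fun _ hz => (sum_twist_pos hw hz).ne'

/-- A face containing a barycentre contains the barycentres with smaller supports. -/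
theorem mom_mem_of_support_subset {Φ : Set (ℝ × ℝ)} (hΦ : IsExposed ℝ (convexHull ℝ (range v)) Φ)
    {z z' : ι → ℝ} (hz : z ∈ stdSimplex ℝ ι) (hz' : z' ∈ stdSimplex ℝ ι)
    (hsupp : ∀ i, z i = 0 → z' i = 0) (hmem : mom v z ∈ Φ) : mom v z' ∈ Φ := by
  obtain ⟨l, rfl⟩ := hΦ ⟨_, hmem⟩
  refine ⟨mom_mem_convexHull hz', fun y hy => (hmem.2 y hy).trans ?_⟩
  have hle : ∀ i, l (v i) ≤ l (mom v z) := fun i =>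
    hmem.2 _ (subset_convexHull ℝ _ (mem_range_self i))
  have hsum : ∑ i, z i * (l (mom v z) - l (v i)) = 0 := by
    simp_rw [mul_sub, Finset.sum_sub_distrib, ← Finset.sum_mul, hz.2, one_mul, ← map_mom, sub_self]
  have h0 := (Finset.sum_eq_zero_iff_of_nonneg
    fun i _ => mul_nonneg (hz.1 i) (sub_nonneg.2 (hle i))).1 hsum
  have : ∑ i, z' i * (l (mom v z) - l (v i)) = 0 := Finset.sum_eq_zero fun i hi => by
    rcases mul_eq_zero.1 (h0 i hi) with h | h
    · rw [hsupp i h, zero_mul]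
    · rw [h, mul_zero]
  simp_rw [mul_sub, Finset.sum_sub_distrib, ← Finset.sum_mul, hz'.2, one_mul, ← map_mom] at this
  linarith

/-- The identification of the polygon with itself given by the torus action between the slices
at the times `s` and `s * u`. -/
def shift (v : ι → ℝ × ℝ) (ν : ι → ℝ) (s u : ℝ) (q : ℝ × ℝ) : ℝ × ℝ :=
  mom v (twist (fun i => u ^ ν i) (lift v ν s q))

variable (hint : (interior (convexHull ℝ (range v))).Nonempty)
include hint

theorem lift_shift {s u : ℝ} (hs : s ∈ Icc (0:ℝ) 1) (hu : 0 < u) {q : ℝ × ℝ}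
    (hq : q ∈ convexHull ℝ (range v)) :
    lift v ν (s * u) (shift v ν s u q) = twist (fun i => u ^ ν i) (lift v ν s q) :=
  lift_mom (mul_nonneg hs.1 hu.le) (twist_mem_toricSlice hs.1 hu (lift_spec hint hs hq).1)

theorem shift_mem_hull {s u : ℝ} (hs : s ∈ Icc (0:ℝ) 1) (hu : 0 < u) {q : ℝ × ℝ}
    (hq : q ∈ convexHull ℝ (range v)) : shift v ν s u q ∈ convexHull ℝ (range v) :=
  mom_mem_convexHull (twist_mem_toricSlice hs.1 hu (lift_spec hint hs hq).1).1

theorem shift_shift {s u u' : ℝ} (hs : s ∈ Icc (0:ℝ) 1) (hu : 0 < u) (huu' : u' * u = 1)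
    {q : ℝ × ℝ} (hq : q ∈ convexHull ℝ (range v)) :
    shift v ν (s * u) u' (shift v ν s u q) = q := by
  have hu' : 0 < u' := by
    by_contra! h
    nlinarith
  have hspec := lift_spec (ν := ν) hint hs hq
  rw [shift, lift_shift hint hs hu hq, twist_inv_twist (fun i => Real.rpow_pos_of_pos hu _)
    (fun i => by rw [← Real.mul_rpow hu'.le hu.le, huu', Real.one_rpow]) hspec.1.1, hspec.2]

theorem shift_mem_face {s u : ℝ} (hs : s ∈ Icc (0:ℝ) 1) (hu : 0 < u) {q : ℝ × ℝ}
    {Φ : Set (ℝ × ℝ)} (hΦ : IsExposed ℝ (convexHull ℝ (range v)) Φ) (hq : q ∈ Φ) :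
    shift v ν s u q ∈ Φ := by
  have hspec := lift_spec (ν := ν) hint hs (hΦ.subset hq)
  have hw : ∀ i, 0 < u ^ ν i := fun i => Real.rpow_pos_of_pos hu _
  refine mom_mem_of_support_subset hΦ hspec.1.1 (twist_mem_stdSimplex hw hspec.1.1)
    (fun i => (twist_eq_zero hw hspec.1.1 i).2) ?_
  rwa [hspec.2]

theorem continuousOn_lift_slice {t : ℝ} (ht : t ∈ Icc (0:ℝ) 1) :
    ContinuousOn (lift v ν t) (convexHull ℝ (range v)) :=
  (continuousOn_lift (ν := ν) hint).comp (f := fun q : ℝ × ℝ => (t, q)) (by fun_prop)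
    fun _ hq => ⟨ht, hq⟩

theorem continuousOn_shift {s u : ℝ} (hs : s ∈ Icc (0:ℝ) 1) (hu : 0 < u) :
    ContinuousOn (shift v ν s u) (convexHull ℝ (range v)) := by
  refine continuous_mom.comp_continuousOn ((continuousOn_twist fun i =>
    Real.rpow_pos_of_pos hu _).comp (continuousOn_lift_slice hint hs) fun q hq => ?_)
  exact (lift_spec hint hs hq).1.1

theorem height_shift {s u : ℝ} (hs : s ∈ Icc (0:ℝ) 1) (hu : 0 < u) {q : ℝ × ℝ}
    (hq : q ∈ convexHull ℝ (range v)) (c : ℝ → ι → ℝ) :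
    height v ν c (s * u) (shift v ν s u q) = 0 ↔
      height v ν (fun _ i => u ^ ν i * c (s * u) i) s q = 0 := by
  have hN := sum_twist_pos (fun i => Real.rpow_pos_of_pos hu (ν i))
    (lift_spec (ν := ν) hint hs hq).1.1
  simp only [height, lift_shift hint hs hu hq, twist]
  simp_rw [div_mul_eq_mul_div]
  rw [← Finset.sum_div, div_eq_zero_iff, or_iff_left hN.ne']
  refine Eq.congr_left (Finset.sum_congr rfl fun i _ => by ring)

theorem mom_mem_interior {z : ι → ℝ} (hz : z ∈ stdSimplex ℝ ι) (hpos : ∀ i, 0 < z i) :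
    mom v z ∈ interior (convexHull ℝ (range v)) := by
  have := nonempty_index hint
  obtain ⟨q₁, hq₁⟩ := hint
  obtain ⟨hw, hw'⟩ := lift_spec (ν := 0) ⟨q₁, hq₁⟩ (t := 1) (by simp) (interior_subset hq₁)
  set w := lift v 0 1 q₁
  obtain ⟨i₀, hi₀⟩ := Finite.exists_min z
  have hw1 : ∀ i, w i ≤ 1 := fun i => hw.1.2 ▸
    Finset.single_le_sum (fun j _ => hw.1.1 j) (Finset.mem_univ i)
  have hz1 : z i₀ ≤ 1 := hz.2 ▸
    Finset.single_le_sum (fun j _ => hz.1 j) (Finset.mem_univ i₀)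
  set ε := z i₀ / 2
  have hε : 0 < ε := half_pos (hpos i₀)
  have hε1 : ε < 1 := by simp only [ε]; linarith
  have h1 : 0 < 1 - ε := by linarith
  have hz'' : (fun i => (z i - ε * w i) / (1 - ε)) ∈ stdSimplex ℝ ι := by
    refine ⟨fun i => div_nonneg ?_ h1.le, ?_⟩
    · have := mul_le_mul_of_nonneg_left (hw1 i) hε.le
      have := hi₀ i
      have := hpos i₀
      simp only [ε] at *
      linarith
    · rw [← Finset.sum_div, Finset.sum_sub_distrib, ← Finset.mul_sum, hz.2, hw.1.2, mul_one,
        div_self h1.ne']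
  have key := (convex_convexHull ℝ (range v)).combo_interior_self_mem_interior hq₁
    (mom_mem_convexHull hz'') hε h1.le (by ring)
  convert key using 1
  rw [← hw']
  simp only [mom, Finset.smul_sum, ← Finset.sum_add_distrib, smul_smul, ← add_smul]
  refine Finset.sum_congr rfl fun i _ => ?_
  congr 1
  field_simp
  ring

theorem mem_interior_iff_lift_pos {t : ℝ} (ht0 : 0 < t) (ht1 : t ≤ 1) {q : ℝ × ℝ}
    (hq : q ∈ convexHull ℝ (range v)) :
    q ∈ interior (convexHull ℝ (range v)) ↔ ∀ i, 0 < lift v ν t q i := by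
  have := nonempty_index hint
  refine ⟨fun h i => ?_, fun h => ?_⟩
  · obtain ⟨θ, hθ⟩ := lift_eq_gibbs (ν := ν) hint ht0 h
    rw [hθ]
    exact gibbs_pos (fun i => Real.rpow_pos_of_pos ht0 _) θ i
  · have hspec := lift_spec (ν := ν) hint ⟨ht0.le, ht1⟩ hq
    rw [← hspec.2]
    exact mom_mem_interior hint hspec.1.1 h

theorem shift_mem_interior_iff {s u : ℝ} (hs0 : 0 < s) (hs1 : s ≤ 1) (hu : 0 < u)
    (hsu : s * u ≤ 1) {q : ℝ × ℝ} (hq : q ∈ convexHull ℝ (range v)) :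
    shift v ν s u q ∈ interior (convexHull ℝ (range v)) ↔
      q ∈ interior (convexHull ℝ (range v)) := by
  have hs : s ∈ Icc (0:ℝ) 1 := ⟨hs0.le, hs1⟩
  have hspec := lift_spec (ν := ν) hint hs hq
  have hw : ∀ i, 0 < u ^ ν i := fun i => Real.rpow_pos_of_pos hu _
  rw [mem_interior_iff_lift_pos (ν := ν) hint (mul_pos hs0 hu) hsu (shift_mem_hull hint hs hu hq),
    mem_interior_iff_lift_pos (ν := ν) hint hs0 hs1 hq, lift_shift hint hs hu hq]
  refine forall_congr' fun i => ?_
  rw [((twist_mem_stdSimplex hw hspec.1.1).1 i).lt_iff_ne', (hspec.1.1.1 i).lt_iff_ne', ne_eq,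
    ne_eq, twist_eq_zero hw hspec.1.1]

omit hint in
/-- The symmetric extension of `shift`. -/
def quadShift (v : ι → ℝ × ℝ) (ν : ι → ℝ) (s u : ℝ) (x : ℝ × ℝ) : ℝ × ℝ :=
  quadRefl (quadrant x) (shift v ν s u (absPt x))

theorem quadShift_quadRefl (hv : ∀ i, 0 ≤ (v i).1 ∧ 0 ≤ (v i).2) {s u : ℝ}
    (hs : s ∈ Icc (0:ℝ) 1) (hu : 0 < u) {q : ℝ × ℝ}
    (hq : q ∈ convexHull ℝ (range v)) (σ : Bool × Bool) :
    quadShift v ν s u (quadRefl σ q) = quadRefl σ (shift v ν s u q) := by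
  have hspec := lift_spec (ν := ν) hint hs hq
  rw [quadShift, absPt_quadRefl σ (nonneg_of_mem_convexHull hv hq)]
  have := quadRefl_mom_eq hv hspec.1.1.1 (w := twist (fun i => u ^ ν i) (lift v ν s q))
    (fun i => (twist_eq_zero (fun i => Real.rpow_pos_of_pos hu _) hspec.1.1 i).2) σ
  rwa [hspec.2] at this

theorem continuousOn_quadShift (hv : ∀ i, 0 ≤ (v i).1 ∧ 0 ≤ (v i).2) {s u : ℝ}
    (hs : s ∈ Icc (0:ℝ) 1) (hu : 0 < u) :
    ContinuousOn (quadShift v ν s u) (tildeSet (convexHull ℝ (range v))) := by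
  have := continuousOn_tildeSet (T := univ) isClosed_univ (isCompact_hull v)
    (f := fun p : ℝ × (ℝ × ℝ) => quadShift v ν s u p.2) fun σ =>
      (((continuous_quadRefl σ).comp_continuousOn (continuousOn_shift (ν := ν) hint hs hu)).comp
        continuousOn_snd fun p hp => hp.2).congr fun p hp =>
        quadShift_quadRefl hint hv hs hu hp.2 σ
  exact this.comp (f := fun x : ℝ × ℝ => ((0:ℝ), x)) (by fun_prop) fun x hx => ⟨mem_univ _, hx⟩

theorem autPair_quadShift (hv : ∀ i, 0 ≤ (v i).1 ∧ 0 ≤ (v i).2) {s u u' : ℝ} (hs : 0 < s)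
    (hs1 : s ≤ 1) (hu : 0 < u) (huu' : u' * u = 1) (hsu : s * u ≤ 1) :
    AutPair (tildeSet (convexHull ℝ (range v))) (quadFaces (convexHull ℝ (range v)))
      (quadShift v ν s u) (quadShift v ν (s * u) u') := by
  have hsI : s ∈ Icc (0:ℝ) 1 := ⟨hs.le, hs1⟩
  have hsuI : s * u ∈ Icc (0:ℝ) 1 := ⟨(mul_pos hs hu).le, hsu⟩
  have hu' : 0 < u' := by
    by_contra! h
    nlinarith
  have hmaps : ∀ {s u}, s ∈ Icc (0:ℝ) 1 → 0 < u → ∀ A ∈ quadFaces (convexHull ℝ (range v)),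
      MapsTo (quadShift v ν s u) A A := by
    intro s u hs hu A hA
    rcases hA with rfl | ⟨σ, Φ, hΦ, rfl⟩
    · intro x hx
      obtain ⟨σ, q, hq, rfl⟩ := mem_tildeSet.1 hx
      rw [quadShift_quadRefl hint hv hs hu hq]
      exact quadRefl_mem_tildeSet σ (shift_mem_hull hint hs hu hq)
    · rintro _ ⟨q, hq, rfl⟩
      rw [quadShift_quadRefl hint hv hs hu (hΦ.subset hq)]
      exact ⟨_, shift_mem_face hint hs hu hΦ hq, rfl⟩
  refine ⟨continuousOn_quadShift hint hv hsI hu, continuousOn_quadShift hint hv hsuI hu', ?_, ?_,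
    hmaps hsI hu, hmaps hsuI hu'⟩
  · intro x hx
    obtain ⟨σ, q, hq, rfl⟩ := mem_tildeSet.1 hx
    rw [quadShift_quadRefl hint hv hsI hu hq, quadShift_quadRefl hint hv hsuI hu'
      (shift_mem_hull hint hsI hu hq), shift_shift hint hsI hu huu' hq]
  · intro x hx
    obtain ⟨σ, q, hq, rfl⟩ := mem_tildeSet.1 hx
    have h := shift_shift (ν := ν) hint hsuI hu' (u' := u) (by rw [mul_comm, huu']) hq
    have hss : s * u * u' = s := by rw [mul_assoc, mul_comm u, huu', mul_one]
    rw [hss] at h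
    rw [quadShift_quadRefl hint hv hsuI hu' hq, quadShift_quadRefl hint hv hsI hu
      (shift_mem_hull hint hsuI hu' hq), h]

theorem quadHeight_quadShift (hv : ∀ i, 0 ≤ (v i).1 ∧ 0 ≤ (v i).2) (hsg : SignCompat v sg)
    {s u : ℝ} (hs : s ∈ Icc (0:ℝ) 1) (hu : 0 < u) (hsu : s * u ≤ 1) (c : ℝ → ι → ℝ) {x : ℝ × ℝ}
    (hx : x ∈ tildeSet (convexHull ℝ (range v))) :
    quadHeight v ν sg c (s * u) (quadShift v ν s u x) = 0 ↔
      quadHeight v ν sg (fun _ i => u ^ ν i * c (s * u) i) s x = 0 := by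
  obtain ⟨σ, q, hq, rfl⟩ := mem_tildeSet.1 hx
  rw [quadShift_quadRefl hint hv hs hu hq, quadHeight_quadRefl hv hsg hint
    ⟨mul_nonneg hs.1 hu.le, hsu⟩ (shift_mem_hull hint hs hu hq),
    quadHeight_quadRefl hv hsg hint hs hq, height_shift hint hs hu hq]
  simp_rw [mul_left_comm]

end Reparametrization

section Density

/-- If a continuous function on a convex set changes its sign in the direction `e` at `q₀`, then
it has zeros arbitrarily close to `q₀` on segments parallel to `e` moved towards `p`. -/
theorem exists_zero_near {E : Type*} [NormedAddCommGroup E] [NormedSpace ℝ E] {Θ : Set E}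
    (hΘ : Convex ℝ Θ) {f : E → ℝ} (hf : ContinuousOn f Θ) {q₀ p e : E} (hp : p ∈ Θ) {ρ : ℝ}
    (hρ : 0 < ρ) (H : ∀ τ ∈ Ioo 0 ρ, q₀ - τ • e ∈ Θ ∧ q₀ + τ • e ∈ Θ ∧ f (q₀ - τ • e) < 0 ∧
      0 < f (q₀ + τ • e)) {r : ℝ} (hr : 0 < r) :
    ∃ q ∈ Θ, dist q q₀ < r ∧ f q = 0 ∧ ∃ η ∈ Ioo (0:ℝ) 1, ∃ σ : ℝ, q₀ + σ • e ∈ Θ ∧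
      q = (1 - η) • (q₀ + σ • e) + η • p := by
  obtain ⟨τ, hτ0, hτρ, hτr⟩ : ∃ τ > 0, τ < ρ ∧ τ * ‖e‖ < r / 2 := by
    have h1 : ∀ᶠ τ in 𝓝[>] (0:ℝ), τ < ρ := by
      filter_upwards [Ioo_mem_nhdsGT hρ] with τ h using h.2
    have h2 : ∀ᶠ τ in 𝓝[>] (0:ℝ), τ * ‖e‖ < r / 2 := by
      have : Tendsto (fun τ : ℝ => τ * ‖e‖) (𝓝 0) (𝓝 0) := by
        simpa using (continuous_mul_const ‖e‖).tendsto (0:ℝ)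
      exact (this.eventually_lt_const (half_pos hr)).filter_mono nhdsWithin_le_nhds
    obtain ⟨τ, h, h'⟩ := ((h1.and h2).and self_mem_nhdsWithin).exists
    exact ⟨τ, h', h⟩
  obtain ⟨hm, hpl, hneg, hpos⟩ := H τ ⟨hτ0, hτρ⟩
  have hseg : ∀ q ∈ Θ, ∀ η ∈ Icc (0:ℝ) 1, (1 - η) • q + η • p ∈ Θ := fun q hq η hη =>
    hΘ hq hp (by linarith [hη.2]) hη.1 (by ring)
  have hcont : ∀ q ∈ Θ, Tendsto (fun η : ℝ => f ((1 - η) • q + η • p)) (𝓝[>] 0) (𝓝 (f q)) := by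
    intro q hq
    have h1 : ContinuousOn (fun η : ℝ => f ((1 - η) • q + η • p)) (Icc 0 1) :=
      hf.comp (by fun_prop) fun η hη => hseg q hq η hη
    have h2 := h1 0 (by simp)
    rw [ContinuousWithinAt] at h2
    simp only [sub_zero, one_smul, zero_smul, add_zero] at h2
    refine h2.mono_left ?_
    rw [← nhdsWithin_Ioc_eq_nhdsGT one_pos]
    exact nhdsWithin_mono _ Ioc_subset_Icc_self
  have hη3 : ∀ᶠ η in 𝓝[>] (0:ℝ), η * ‖p - q₀‖ < r / 2 := by
    have : Tendsto (fun τ : ℝ => τ * ‖p - q₀‖) (𝓝 0) (𝓝 0) := by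
      simpa using (continuous_mul_const ‖p - q₀‖).tendsto (0:ℝ)
    exact (this.eventually_lt_const (half_pos hr)).filter_mono nhdsWithin_le_nhds
  obtain ⟨η, ⟨⟨⟨h1, h2⟩, h3⟩, h4⟩⟩ := (((((hcont _ hm).eventually_lt_const hneg).and
    ((hcont _ hpl).eventually_const_lt hpos)).and hη3).and (Ioo_mem_nhdsGT one_pos)).exists
  have hmem : ∀ σ ∈ Icc (-τ) τ, q₀ + σ • e ∈ Θ := by
    intro σ hσ
    have h : q₀ + σ • e = ((τ - σ) / (2 * τ)) • (q₀ - τ • e) +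
        ((τ + σ) / (2 * τ)) • (q₀ + τ • e) := by
      have e1 : (τ - σ) / (2 * τ) + (τ + σ) / (2 * τ) = 1 := by field_simp; ring
      have e2 : -((τ - σ) / (2 * τ)) * τ + ((τ + σ) / (2 * τ)) * τ = σ := by field_simp; ring
      calc q₀ + σ • e = ((τ - σ) / (2 * τ) + (τ + σ) / (2 * τ)) • q₀ +
            (-((τ - σ) / (2 * τ)) * τ + ((τ + σ) / (2 * τ)) * τ) • e := by rw [e1, e2, one_smul]
        _ = _ := by module
    rw [h]
    exact hΘ hm hpl (div_nonneg (by linarith [hσ.2]) (by linarith))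
      (div_nonneg (by linarith [hσ.1]) (by linarith)) (by field_simp; ring)
  have hg : ContinuousOn (fun σ : ℝ => f ((1 - η) • (q₀ + σ • e) + η • p)) (Icc (-τ) τ) :=
    hf.comp (by fun_prop) fun σ hσ => hseg _ (hmem σ hσ) η ⟨h4.1.le, h4.2.le⟩
  obtain ⟨σ, hσ, hσ0⟩ := intermediate_value_Icc (by linarith) hg
    (show (0:ℝ) ∈ Icc _ _ from ⟨by simpa [sub_eq_add_neg] using h1.le, h2.le⟩)
  refine ⟨_, hseg _ (hmem σ hσ) η ⟨h4.1.le, h4.2.le⟩, ?_, hσ0, η, h4, σ, hmem σ hσ, rfl⟩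
  have : (1 - η) • (q₀ + σ • e) + η • p - q₀ = ((1 - η) * σ) • e + η • (p - q₀) := by module
  rw [dist_eq_norm, this]
  refine (norm_add_le _ _).trans_lt ?_
  rw [norm_smul, norm_smul, Real.norm_of_nonneg h4.1.le, norm_mul,
    Real.norm_of_nonneg (by linarith [h4.2] : 0 ≤ 1 - η)]
  have : (1 - η) * ‖σ‖ ≤ τ := by
    have : ‖σ‖ ≤ τ := abs_le.2 hσ
    nlinarith [norm_nonneg σ, h4.1, h4.2]
  have := mul_le_mul_of_nonneg_right this (norm_nonneg e)
  linarith

variable {ι : Type*} [Fintype ι] {v : ι → ℝ × ℝ} {ν : ι → ℝ} {sg : Bool × Bool → ι → ℝ}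
  {c : ℝ → ι → ℝ}

theorem isClosed_zeros (hv : ∀ i, 0 ≤ (v i).1 ∧ 0 ≤ (v i).2) (hsg : SignCompat v sg)
    (hint : (interior (convexHull ℝ (range v))).Nonempty) {t : ℝ} (ht : t ∈ Icc (0:ℝ) 1)
    (c : ℝ → ι → ℝ) :
    IsClosed {x ∈ tildeSet (convexHull ℝ (range v)) | quadHeight v ν sg c t x = 0} := by
  have h1 := continuousOn_quadHeight (ν := ν) (c := fun _ => c t) hv hsg hint continuousOn_const
  have h2 : ContinuousOn (quadHeight v ν sg c t) (tildeSet (convexHull ℝ (range v))) :=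
    h1.comp (f := fun x : ℝ × ℝ => (t, x)) (by fun_prop) fun x hx => ⟨ht, hx⟩
  exact h2.preimage_isClosed_of_isClosed (isCompact_tildeSet (isCompact_hull v)).isClosed
    (isClosed_singleton (x := (0:ℝ)))

/-- If the function changes its sign at each of its zeros at the time `t`, then the zeros in the
interiors of the copies of the polygon are dense. -/
theorem closure_interior_zeros (hv : ∀ i, 0 ≤ (v i).1 ∧ 0 ≤ (v i).2) (hsg : SignCompat v sg)
    (hint : (interior (convexHull ℝ (range v))).Nonempty) {t : ℝ} (ht0 : 0 < t) (ht1 : t ≤ 1)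
    (hsign : ∀ y ∈ tildeSet (convexHull ℝ (range v)), quadHeight v ν sg c t y = 0 →
        ∃ e : ℝ × ℝ, ∃ ρ > (0:ℝ), ∀ τ ∈ Ioo 0 ρ,
        quadHeight v ν sg c t (y - τ • e) < 0 ∧ 0 < quadHeight v ν sg c t (y + τ • e) ∧
        ∀ A ∈ quadFaces (convexHull ℝ (range v)), y ∈ A → y - τ • e ∈ A ∧ y + τ • e ∈ A) :
    closure (⋃ s, quadRefl s '' {q ∈ interior (convexHull ℝ (range v)) |
      height v ν (fun _ i => sg s i * (t ^ ν i * c t i)) 1 q = 0}) =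
    {x ∈ tildeSet (convexHull ℝ (range v)) |
      quadHeight v ν sg (fun _ i => t ^ ν i * c t i) 1 x = 0} := by
  have h1I : (1:ℝ) ∈ Icc (0:ℝ) 1 := by simp
  have htI : t ∈ Icc (0:ℝ) 1 := ⟨ht0.le, ht1⟩
  refine (closure_minimal ?_ (isClosed_zeros hv hsg hint h1I _)).antisymm ?_
  · rintro _ ⟨_, ⟨s, rfl⟩, q, ⟨hq, hq0⟩, rfl⟩
    refine ⟨quadRefl_mem_tildeSet s (interior_subset hq), ?_⟩
    rwa [quadHeight_quadRefl hv hsg hint h1I (interior_subset hq)]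
  rintro x ⟨hx, hx0⟩
  set y := quadShift v ν 1 t x with hy_def
  have H := autPair_quadShift (ν := ν) hint hv (s := 1) (u := t) (u' := t⁻¹) one_pos le_rfl ht0
    (inv_mul_cancel₀ ht0.ne') (by rwa [one_mul])
  have hy : y ∈ tildeSet (convexHull ℝ (range v)) := H.maps _ (Or.inl rfl) hx
  have hy0 : quadHeight v ν sg c t y = 0 := by
    have := (quadHeight_quadShift (ν := ν) hint hv hsg (s := 1) (u := t) h1I ht0 (by rwa [one_mul])
      c hx).2
    rw [one_mul] at this
    exact this hx0
  obtain ⟨e, ρ, hρ, hch⟩ := hsign y hy hy0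
  obtain ⟨σ, q₀, hq₀, hq₀y⟩ := mem_tildeSet.1 hy
  have hexp : IsExposed ℝ (convexHull ℝ (range v)) (convexHull ℝ (range v)) := IsExposed.refl _
  have hA : quadRefl σ '' convexHull ℝ (range v) ∈ quadFaces (convexHull ℝ (range v)) :=
    Or.inr ⟨σ, _, hexp, rfl⟩
  have hrefl : ∀ {q}, quadRefl σ q ∈ quadRefl σ '' convexHull ℝ (range v) →
      q ∈ convexHull ℝ (range v) := by
    rintro q ⟨q', hq', h⟩
    rw [← quadRefl_quadRefl σ q, ← h, quadRefl_quadRefl]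
    exact hq'
  have hclos : y ∈ closure (quadRefl σ '' {q ∈ interior (convexHull ℝ (range v)) |
      quadHeight v ν sg c t (quadRefl σ q) = 0}) := by
    rw [Metric.mem_closure_iff]
    intro r hr
    obtain ⟨p, hp⟩ := hint
    have hf : ContinuousOn (fun q => quadHeight v ν sg c t (quadRefl σ q))
        (convexHull ℝ (range v)) := by
      have := continuousOn_quadHeight (ν := ν) (c := fun _ => c t) hv hsg ⟨p, hp⟩
        continuousOn_const
      exact this.comp (f := fun q => (t, quadRefl σ q))
        (continuous_const.prodMk (continuous_quadRefl σ)).continuousOn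
        fun q hq => ⟨htI, quadRefl_mem_tildeSet σ hq⟩
    have hm : ∀ τ : ℝ, quadRefl σ (q₀ - τ • quadRefl σ e) = y - τ • e := fun τ => by
      rw [quadRefl_sub, quadRefl_smul, quadRefl_quadRefl, hq₀y]
    have hpl : ∀ τ : ℝ, quadRefl σ (q₀ + τ • quadRefl σ e) = y + τ • e := fun τ => by
      rw [quadRefl_add, quadRefl_smul, quadRefl_quadRefl, hq₀y]
    obtain ⟨q, -, hd, hq0, η, hη, k, hk, rfl⟩ := exists_zero_near (convex_convexHull ℝ (range v)) hf
      (interior_subset hp) hρ (fun τ hτ => by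
        obtain ⟨a1, a2, a3⟩ := hch τ hτ
        obtain ⟨b1, b2⟩ := a3 _ hA ⟨q₀, hq₀, hq₀y⟩
        refine ⟨hrefl ?_, hrefl ?_, ?_, ?_⟩
        · rwa [hm]
        · rwa [hpl]
        · simpa only [hm] using a1
        · simpa only [hpl] using a2) hr
    refine ⟨_, ⟨_, ⟨?_, hq0⟩, rfl⟩, ?_⟩
    · exact (convex_convexHull ℝ (range v)).combo_self_interior_mem_interior hk hp
        (by linarith [hη.2]) hη.1 (by ring)
    · rw [← hq₀y, dist_quadRefl, dist_comm]
      exact hd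
  have hsub : quadRefl σ '' {q ∈ interior (convexHull ℝ (range v)) |
      quadHeight v ν sg c t (quadRefl σ q) = 0} ⊆ tildeSet (convexHull ℝ (range v)) := by
    rintro _ ⟨q, hq, rfl⟩
    exact quadRefl_mem_tildeSet σ (interior_subset hq.1)
  have hback : quadShift v ν (1 * t) t⁻¹ y = x := H.left_inv x hx
  rw [← hback]
  refine closure_mono ?_ (((H.cont' y hy).mono hsub).mem_closure_image hclos)
  rintro _ ⟨_, ⟨q, ⟨hq, hq0⟩, rfl⟩, rfl⟩
  have hqΘ := interior_subset hq
  have hti : 0 < t⁻¹ := inv_pos.2 ht0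
  have ht1' : t * t⁻¹ = 1 := mul_inv_cancel₀ ht0.ne'
  rw [one_mul, quadShift_quadRefl hint hv htI hti hqΘ]
  refine mem_iUnion.2 ⟨σ, _, ⟨?_, ?_⟩, rfl⟩
  · exact (shift_mem_interior_iff (ν := ν) hint ht0 ht1 hti ht1'.le hqΘ).2 hq
  · rw [quadHeight_quadRefl hv hsg hint htI hqΘ] at hq0
    have := (height_shift (ν := ν) hint (s := 1) (u := t) h1I ht0
      (shift_mem_hull (ν := ν) hint htI hti hqΘ) (fun t i => sg σ i * c t i)).1 (by
        have h2 := shift_shift (ν := ν) hint htI hti (u' := t) ht1' hqΘ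
        rw [ht1'] at h2
        rw [h2, one_mul]
        exact hq0)
    rw [one_mul] at this
    simp_rw [mul_left_comm (sg σ _)]
    exact this

/-- The support of `z` is not contained in a line. -/
def Spanning (v : ι → ℝ × ℝ) (z : ι → ℝ) : Prop :=
  ∀ (a : ℝ × ℝ →L[ℝ] ℝ) (k : ℝ), (∀ i, z i ≠ 0 → a (v i) = k) → a = 0

theorem functional_eq_zero {a a' : ℝ × ℝ →L[ℝ] ℝ} {x y : ℝ × ℝ} (hx : x ≠ 0) (hax : a x = 0)
    (hay : a y ≠ 0) (hx' : a' x = 0) (hy' : a' y = 0) : a' = 0 := by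
  have cramer : ∀ (b : ℝ × ℝ →L[ℝ] ℝ) (w : ℝ × ℝ), (x.1 * y.2 - x.2 * y.1) * b w =
      (w.1 * y.2 - w.2 * y.1) * b x + (x.1 * w.2 - x.2 * w.1) * b y := fun b w => by
    have : (x.1 * y.2 - x.2 * y.1) • w =
      (w.1 * y.2 - w.2 * y.1) • x + (x.1 * w.2 - x.2 * w.1) • y := by
      ext <;> simp <;> ring
    simpa using congrArg b this
  have hΔ : x.1 * y.2 - x.2 * y.1 ≠ 0 := by
    intro h
    have h1 := cramer a (-x.2, x.1)
    rw [h, hax, zero_mul, mul_zero, zero_add] at h1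
    have h2 := (mul_eq_zero.1 h1.symm).resolve_right hay
    simp only at h2
    have h3 : x.1 = 0 := by nlinarith [sq_nonneg x.1, sq_nonneg x.2]
    have h4 : x.2 = 0 := by nlinarith [sq_nonneg x.1, sq_nonneg x.2]
    exact hx (Prod.ext h3 h4)
  ext
  · have := cramer a' (1, 0)
    rw [hx', hy'] at this
    simpa [hΔ] using this
  · have := cramer a' (0, 1)
    rw [hx', hy'] at this
    simpa [hΔ] using this

theorem functional_eq_zero_of_const {s : Set (ℝ × ℝ)} (hs : (interior s).Nonempty)
    {a : ℝ × ℝ →L[ℝ] ℝ} {k : ℝ} (h : ∀ x ∈ s, a x = k) : a = 0 := by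
  obtain ⟨x, hx⟩ := hs
  refine ContinuousLinearMap.ext fun w => ?_
  have hcont : Continuous fun ε : ℝ => x + ε • w := by fun_prop
  have hev : ∀ᶠ ε in 𝓝 (0:ℝ), x + ε • w ∈ interior s :=
    hcont.continuousAt.eventually_mem (isOpen_interior.mem_nhds (by simpa using hx))
  obtain ⟨ε, hε, hε0⟩ := ((hev.filter_mono nhdsWithin_le_nhds).and
    (self_mem_nhdsWithin : ∀ᶠ ε in 𝓝[>] (0:ℝ), 0 < ε)).exists
  have h1 := h _ (interior_subset hε)
  rw [map_add, h x (interior_subset hx), map_smul, smul_eq_mul, add_eq_left] at h1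
  exact (mul_eq_zero.1 h1).resolve_left hε0.ne'

theorem map_mom_of_support {z : ι → ℝ} (hz : z ∈ stdSimplex ℝ ι) {a : ℝ × ℝ →L[ℝ] ℝ} {k : ℝ}
    (h : ∀ i, z i ≠ 0 → a (v i) = k) : a (mom v z) = k := by
  rw [map_mom]
  calc ∑ i, z i * a (v i) = ∑ i, z i * k := Finset.sum_congr rfl fun i _ => by
        by_cases hi : z i = 0
        · simp [hi]
        · rw [h i hi]
    _ = k := by rw [← Finset.sum_mul, hz.2, one_mul]

/-- Near a nondegenerate zero at the time `0` there are zeros with spanning support. -/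
theorem exists_spanning_zero_near (hint : (interior (convexHull ℝ (range v))).Nonempty)
    {c : ι → ℝ} {q₀ : ℝ × ℝ} (hq₀ : q₀ ∈ convexHull ℝ (range v))
    (h0 : ∑ i, lift v ν 0 q₀ i * c i = 0) (hnd : mom v (fun i => lift v ν 0 q₀ i * c i) ≠ 0)
    {r : ℝ} (hr : 0 < r) :
    ∃ q ∈ convexHull ℝ (range v), dist q q₀ < r ∧ ∑ i, lift v ν 0 q i * c i = 0 ∧
      Spanning v (lift v ν 0 q) := by
  have h01 : (0:ℝ) ∈ Icc (0:ℝ) 1 := by simp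
  by_cases hspan : Spanning v (lift v ν 0 q₀)
  · exact ⟨q₀, hq₀, by simpa using hr, h0, hspan⟩
  simp only [Spanning, not_forall] at hspan
  obtain ⟨a, k, hak, ha⟩ := hspan
  have hs₀ := lift_spec (ν := ν) hint h01 hq₀
  set e := mom v (fun i => lift v ν 0 q₀ i * c i) with he_def
  have hkill : ∀ (b : ℝ × ℝ →L[ℝ] ℝ) (k : ℝ), (∀ i, lift v ν 0 q₀ i ≠ 0 → b (v i) = k) →
      b e = 0 ∧ b q₀ = k := by
    intro b k hb
    constructor
    · rw [he_def, map_mom]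
      calc ∑ i, lift v ν 0 q₀ i * c i * b (v i) = ∑ i, lift v ν 0 q₀ i * c i * k :=
            Finset.sum_congr rfl fun i _ => by
              by_cases hi : lift v ν 0 q₀ i = 0
              · simp [hi]
              · rw [hb i hi]
        _ = 0 := by rw [← Finset.sum_mul, h0, zero_mul]
    · rw [← map_mom_of_support hs₀.1.1 hb, hs₀.2]
  obtain ⟨hae, haq⟩ := hkill a k hak
  obtain ⟨p, hp, hap⟩ : ∃ p ∈ convexHull ℝ (range v), a p ≠ k := by
    by_contra! h
    exact ha (functional_eq_zero_of_const hint h)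
  obtain ⟨r₁, hr₁, H₁⟩ := exists_translation_invariant (ν := ν) hint hq₀ h0 hnd
  obtain ⟨δ, hδ, r₂, hr₂, H₂⟩ := exists_uniform_increase (ν := ν) (c := fun _ => c) hint
    continuousOn_const hq₀ h0 hnd
  have hcontz := continuousOn_lift_slice (ν := ν) hint h01 q₀ hq₀
  have hev : ∀ᶠ q in 𝓝[convexHull ℝ (range v)] q₀, ∀ i, lift v ν 0 q₀ i ≠ 0 →
      lift v ν 0 q i ≠ 0 := by
    refine eventually_all.2 fun i => ?_
    by_cases hi : lift v ν 0 q₀ i = 0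
    · simp [hi]
    · have := (tendsto_pi_nhds.1 hcontz i).eventually_ne hi
      exact this.mono fun q hq _ => hq
  obtain ⟨r₃, hr₃, H₃⟩ := Metric.mem_nhdsWithin_iff.1 hev
  obtain ⟨ρ, hρ, hρball⟩ : ∃ ρ > 0, ∀ τ : ℝ, |τ| < ρ → q₀ + τ • e ∈ Metric.ball q₀ (min r₁ r₂) := by
    have hcont : Continuous fun τ : ℝ => q₀ + τ • e := by fun_prop
    obtain ⟨ρ, hρ, h⟩ := Metric.isOpen_iff.1 (Metric.isOpen_ball.preimage hcont) 0
      (show q₀ + (0:ℝ) • e ∈ Metric.ball q₀ (min r₁ r₂) by simp [hr₁, hr₂])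
    exact ⟨ρ, hρ, fun τ hτ => h (by simpa using hτ)⟩
  have hball1 : Metric.ball q₀ (min r₁ r₂) ⊆ Metric.ball q₀ r₁ :=
    Metric.ball_subset_ball (min_le_left _ _)
  have hball2 : Metric.ball q₀ (min r₁ r₂) ⊆ Metric.ball q₀ r₂ :=
    Metric.ball_subset_ball (min_le_right _ _)
  have hmem : ∀ τ : ℝ, |τ| < ρ → q₀ + τ • e ∈ convexHull ℝ (range v) := fun τ hτ =>
    (H₁ q₀ hq₀ (Metric.mem_ball_self hr₁)).1 τ (hball1 (hρball τ hτ))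
  have hf : ContinuousOn (fun q => ∑ i, lift v ν 0 q i * c i) (convexHull ℝ (range v)) :=
    continuousOn_finsetSum _ fun i _ =>
      ((continuous_apply i).comp_continuousOn (continuousOn_lift_slice hint h01)).mul
        continuousOn_const
  obtain ⟨q, hq, hd, hq0, η, hη, σ, -, rfl⟩ := exists_zero_near (e := e)
    (convex_convexHull ℝ (range v)) hf hp hρ (fun τ hτ => by
      have hτ1 : |τ| < ρ := by rw [abs_of_pos hτ.1]; exact hτ.2
      have hτ2 : |-τ| < ρ := by rwa [abs_neg]
      have hm : q₀ - τ • e = q₀ + (-τ) • e := by rw [neg_smul, sub_eq_add_neg]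
      have hback : q₀ + (-τ) • e + τ • e = q₀ := by module
      have i1 := H₂ 0 ⟨le_rfl, hr₂⟩ q₀ hq₀ τ hτ.1.le (hmem τ hτ1) (Metric.mem_ball_self hr₂)
        (hball2 (hρball τ hτ1))
      have i2 := H₂ 0 ⟨le_rfl, hr₂⟩ (q₀ + (-τ) • e) (hmem _ hτ2) τ hτ.1.le
        (by rw [hback]; exact hq₀) (hball2 (hρball _ hτ2))
        (by rw [hback]; exact Metric.mem_ball_self hr₂)
      rw [hback] at i2
      have hz : height v ν (fun _ => c) 0 q₀ = 0 := h0
      rw [hz] at i1 i2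
      have hpos := mul_pos hδ hτ.1
      rw [hm]
      refine ⟨hmem _ hτ2, hmem τ hτ1, ?_, ?_⟩
      · show height v ν (fun _ => c) 0 (q₀ + (-τ) • e) < 0
        linarith
      · show 0 < height v ν (fun _ => c) 0 (q₀ + τ • e)
        linarith) (lt_min hr hr₃)
  refine ⟨_, hq, hd.trans_le (min_le_left _ _), hq0, ?_⟩
  set q := (1 - η) • (q₀ + σ • e) + η • p with hq_def
  intro a' k' ha'
  have hsub := H₃ ⟨hd.trans_le (min_le_right _ _), hq⟩
  have hs := lift_spec (ν := ν) hint h01 hq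
  have hq' : a' q = k' := by rw [← map_mom_of_support hs.1.1 ha', hs.2]
  obtain ⟨h1, h2⟩ := hkill a' k' fun i hi => ha' i (hsub i hi)
  refine functional_eq_zero (a := a) (y := q - q₀) hnd hae ?_ h1
    (by rw [map_sub, hq', h2, sub_self])
  have : a (q - q₀) = η * (a p - k) := by
    rw [hq_def]
    simp only [map_sub, map_add, map_smul, smul_eq_mul, hae, haq]
    ring
  rw [this]
  exact mul_ne_zero hη.1.ne' (sub_ne_zero.2 hap)

/-- The zero set at the time `0` is the union of the closures of sets containing its points with
given spanning supports. -/
theorem zeros_eq_sUnion_closure (hv : ∀ i, 0 ≤ (v i).1 ∧ 0 ≤ (v i).2) (hsg : SignCompat v sg)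
    (hint : (interior (convexHull ℝ (range v))).Nonempty)
    (hnd : ∀ s, ∀ q ∈ convexHull ℝ (range v), height v ν (fun t i => sg s i * c t i) 0 q = 0 →
      mom v (fun i => lift v ν 0 q i * (sg s i * c 0 i)) ≠ 0)
    {𝓒 : Set (Set (ℝ × ℝ))}
    (h𝓒 : ∀ C ∈ 𝓒, C ⊆ {x ∈ tildeSet (convexHull ℝ (range v)) | quadHeight v ν sg c 0 x = 0})
    (hcover : ∀ S : Set ι, ∃ C ∈ insert ∅ 𝓒, ∀ s, ∀ q ∈ convexHull ℝ (range v),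
      {i | lift v ν 0 q i ≠ 0} = S → Spanning v (lift v ν 0 q) →
      height v ν (fun t i => sg s i * c t i) 0 q = 0 → quadRefl s q ∈ C) :
    {x ∈ tildeSet (convexHull ℝ (range v)) | quadHeight v ν sg c 0 x = 0} =
      ⋃₀ (closure '' 𝓒) := by
  have h01 : (0:ℝ) ∈ Icc (0:ℝ) 1 := by simp
  refine Subset.antisymm ?_ (sUnion_subset ?_)
  · choose C hC hCS using hcover
    rintro x ⟨hx, hx0⟩
    obtain ⟨s, q₀, hq₀, rfl⟩ := mem_tildeSet.1 hx
    rw [quadHeight_quadRefl hv hsg hint h01 hq₀] at hx0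
    have hclos : quadRefl s q₀ ∈ closure (⋃ S, C S) := by
      rw [Metric.mem_closure_iff]
      intro r hr
      obtain ⟨q, hq, hd, hq0, hspan⟩ := exists_spanning_zero_near (ν := ν) hint
        (c := fun i => sg s i * c 0 i) hq₀ hx0 (hnd s q₀ hq₀ hx0) hr
      exact ⟨quadRefl s q, mem_iUnion.2 ⟨_, hCS _ s q hq rfl hspan hq0⟩, by
        rwa [dist_quadRefl, dist_comm]⟩
    rw [closure_iUnion_of_finite] at hclos
    obtain ⟨S, hS⟩ := mem_iUnion.1 hclos
    refine ⟨_, ⟨C S, (hC S).resolve_left fun h => ?_, rfl⟩, hS⟩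
    rw [h, closure_empty] at hS
    exact hS
  · rintro _ ⟨C, hC, rfl⟩
    exact closure_minimal (h𝓒 C hC) (isClosed_zeros hv hsg hint h01 c)

end Density

section Relations

variable {ι : Type*} [Fintype ι] {v : ι → ℝ × ℝ} {ν : ι → ℝ}

theorem prod_rpow_pos_iff {z a : ι → ℝ} (hz : ∀ i, 0 ≤ z i) :
    0 < ∏ i, z i ^ a i ↔ ∀ i, a i ≠ 0 → z i ≠ 0 := by
  rw [(Finset.prod_nonneg fun i _ => Real.rpow_nonneg (hz i) _).lt_iff_ne', Finset.prod_ne_zero_iff]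
  refine forall_congr' fun i => ?_
  rw [imp_iff_right (Finset.mem_univ i), ne_eq, Real.rpow_eq_zero_iff_of_nonneg (hz i)]
  tauto

theorem log_prod_rpow {z a : ι → ℝ} (hz : ∀ i, 0 ≤ z i) (ha : ∀ i, a i ≠ 0 → z i ≠ 0) :
    Real.log (∏ i, z i ^ a i) = ∑ i, a i * Real.log (z i) := by
  rw [Real.log_prod fun i _ h => ?_]
  · refine Finset.sum_congr rfl fun i _ => ?_
    by_cases h : a i = 0
    · simp [h]
    · rw [Real.log_rpow ((hz i).lt_of_ne' (ha i h))]
  · rw [Real.rpow_eq_zero_iff_of_nonneg (hz i)] at h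
    exact ha i h.2 h.1

/-- Every affine relation in which the negative part is supported on the support of a point `z`
of the degenerate slice is an inequality between the heights, and equality holds if and only if
the whole relation is supported there. -/
theorem relation_of_mem_toricSlice {z : ι → ℝ} (hz : z ∈ toricSlice v ν 0) {α μ : ι → ℝ}
    (hα : ∀ i, 0 ≤ α i) (hμ : ∀ i, μ i ≠ 0 → z i ≠ 0) (hsum : ∑ i, α i = ∑ i, μ i)
    (hmom : mom v α = mom v μ) :
    ∑ i, ν i * μ i ≤ ∑ i, ν i * α i ∧
    (∑ i, ν i * α i = ∑ i, ν i * μ i ↔ ∀ i, α i ≠ 0 → z i ≠ 0) ∧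
    ((∀ i, α i ≠ 0 → z i ≠ 0) → ∑ i, α i * Real.log (z i) = ∑ i, μ i * Real.log (z i)) := by
  set a : ι → ℝ := fun i => α i + max (-μ i) 0
  set b : ι → ℝ := fun i => max (μ i) 0
  have hab : ∀ i, a i - b i = α i - μ i := fun i => by
    simp only [a, b]
    rcases le_total (μ i) 0 with h | h
    · rw [max_eq_left (by linarith), max_eq_right h]; ring
    · rw [max_eq_right (by linarith), max_eq_left h]; ring
  have ha : ∀ i, 0 ≤ a i := fun i => add_nonneg (hα i) (le_max_right _ _)
  have hb : ∀ i, 0 ≤ b i := fun i => le_max_right _ _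
  have hlin : ∀ f : ι → ℝ, ∑ i, f i * a i - ∑ i, f i * b i = ∑ i, f i * α i - ∑ i, f i * μ i :=
    fun f => by
      rw [← Finset.sum_sub_distrib, ← Finset.sum_sub_distrib]
      exact Finset.sum_congr rfl fun i _ => by rw [← mul_sub, hab, mul_sub]
  have hsum' : ∑ i, a i = ∑ i, b i := by
    have := hlin fun _ => 1
    simp only [one_mul] at this
    linarith
  have hmom' : mom v a = mom v b := by
    have h1 := congrArg Prod.fst hmom
    have h2 := congrArg Prod.snd hmom
    have h3 := hlin fun i => (v i).1
    have h4 := hlin fun i => (v i).2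
    simp only [mom_fst, mom_snd, mul_comm _ (Prod.fst _), mul_comm _ (Prod.snd _)] at h1 h2
    ext
    · simp only [mom_fst, mul_comm _ (Prod.fst _)]; linarith
    · simp only [mom_snd, mul_comm _ (Prod.snd _)]; linarith
  have hbz : ∀ i, b i ≠ 0 → z i ≠ 0 := fun i hi => hμ i fun h => hi (by simp [b, h])
  have haz : (∀ i, a i ≠ 0 → z i ≠ 0) ↔ ∀ i, α i ≠ 0 → z i ≠ 0 := by
    refine forall_congr' fun i => ⟨fun h hi => h ?_, fun h hi => ?_⟩
    · have := (hα i).lt_of_ne' hi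
      have h2 : 0 ≤ max (-μ i) 0 := le_max_right _ _
      simp only [a]; linarith
    · by_cases h0 : α i = 0
      · exact hμ i fun h' => hi (by simp [a, h0, h'])
      · exact h h0
  have hbpos := (prod_rpow_pos_iff hz.1.1).2 hbz
  have hνd := hlin ν
  have hle : ∑ i, ν i * b i ≤ ∑ i, ν i * a i := by
    by_contra! hlt
    have := hz.2 b a hb ha hsum'.symm hmom'.symm hlt.le
    rw [Real.zero_rpow (sub_pos.2 hlt).ne', zero_mul] at this
    exact hbpos.ne' this
  have hrel := hz.2 a b ha hb hsum' hmom' hle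
  have hiff : ∑ i, ν i * α i = ∑ i, ν i * μ i ↔ ∀ i, α i ≠ 0 → z i ≠ 0 := by
    rw [← haz, ← prod_rpow_pos_iff hz.1.1, hrel]
    constructor
    · intro h
      rw [show ∑ i, ν i * a i - ∑ i, ν i * b i = 0 by linarith, Real.rpow_zero, one_mul]
      exact hbpos
    · intro h
      by_contra hne
      rw [Real.zero_rpow (by rw [hνd]; exact sub_ne_zero.2 hne), zero_mul] at h
      exact lt_irrefl _ h
  refine ⟨by linarith, hiff, fun h => ?_⟩
  have h0 := hiff.2 h
  rw [show ∑ i, ν i * a i - ∑ i, ν i * b i = 0 by linarith, Real.rpow_zero, one_mul] at hrel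
  have hlog := congrArg Real.log hrel
  rw [log_prod_rpow hz.1.1 (haz.2 h), log_prod_rpow hz.1.1 hbz] at hlog
  have := hlin fun i => Real.log (z i)
  simp only [mul_comm _ (Real.log _)] at hlog ⊢
  linarith

theorem sum_ite_delta [DecidableEq ι] (f : ι → ℝ) (i : ι) :
    ∑ j, f j * (if j = i then (1:ℝ) else 0) = f i := by simp

theorem mom_delta [DecidableEq ι] (i : ι) : mom v (fun j => if j = i then (1:ℝ) else 0) = v i := by
  simp [mom, ite_smul]

theorem mom_add (a b : ι → ℝ) : mom v (fun i => a i + b i) = mom v a + mom v b := by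
  simp [mom, add_smul, Finset.sum_add_distrib]

theorem mom_mul_left (r : ℝ) (a : ι → ℝ) : mom v (fun i => r * a i) = r • mom v a := by
  simp [mom, Finset.smul_sum, smul_smul]

/-- On a spanning set of points every function can be interpolated, by three of its values, by an
affine function. -/
theorem exists_affine_coordinates [DecidableEq ι] {S : Set ι} (hne : S.Nonempty)
    (hS : ∀ (a : ℝ × ℝ →L[ℝ] ℝ) (k : ℝ), (∀ i ∈ S, a (v i) = k) → a = 0) :
    ∃ μ : ι → ι → ℝ, (∀ i j, μ i j ≠ 0 → j ∈ S) ∧ (∀ i, ∑ j, μ i j = 1) ∧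
      (∀ i, mom v (μ i) = v i) ∧
      (∀ g : ι → ℝ, ∃ (θ : ℝ × ℝ) (κ : ℝ), ∀ i, ∑ j, g j * μ i j = pairing θ (v i) + κ) ∧
      ∀ C : Set (ℝ × ℝ), Convex ℝ C → (∀ i ∈ S, v i ∈ C) → (interior C).Nonempty := by
  obtain ⟨i₀, hi₀⟩ := hne
  obtain ⟨i₁, hi₁, h01⟩ : ∃ i₁ ∈ S, v i₁ ≠ v i₀ := by
    by_contra! h
    have := hS (ContinuousLinearMap.fst ℝ ℝ ℝ) (v i₀).1 fun i hi => by rw [h i hi]; rfl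
    simpa using congrArg (fun a : ℝ × ℝ →L[ℝ] ℝ => a (1, 0)) this
  obtain ⟨i₂, hi₂, hΔ⟩ : ∃ i₂ ∈ S, ((v i₁).1 - (v i₀).1) * ((v i₂).2 - (v i₀).2) -
      ((v i₁).2 - (v i₀).2) * ((v i₂).1 - (v i₀).1) ≠ 0 := by
    by_contra! h
    set a := pairing (-((v i₁).2 - (v i₀).2), (v i₁).1 - (v i₀).1) with ha_def
    have ha : a = 0 := hS a (a (v i₀)) fun i hi => by
      simp only [ha_def, pairing_apply]
      linarith [h i hi]
    apply h01
    have h1 := congrArg (fun a : ℝ × ℝ →L[ℝ] ℝ => a (1, 0)) ha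
    have h2 := congrArg (fun a : ℝ × ℝ →L[ℝ] ℝ => a (0, 1)) ha
    simp [ha_def] at h1 h2
    ext <;> linarith
  set Δ := ((v i₁).1 - (v i₀).1) * ((v i₂).2 - (v i₀).2) -
      ((v i₁).2 - (v i₀).2) * ((v i₂).1 - (v i₀).1) with hΔ_def
  set A : ℝ × ℝ → ℝ := fun x => ((x.1 - (v i₀).1) * ((v i₂).2 - (v i₀).2) -
    (x.2 - (v i₀).2) * ((v i₂).1 - (v i₀).1)) / Δ with hA
  set B : ℝ × ℝ → ℝ := fun x => (((v i₁).1 - (v i₀).1) * (x.2 - (v i₀).2) -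
    ((v i₁).2 - (v i₀).2) * (x.1 - (v i₀).1)) / Δ with hB
  have hdecomp : ∀ x, x = v i₀ + (A x • (v i₁ - v i₀) + B x • (v i₂ - v i₀)) := by
    intro x
    ext
    · simp only [hA, hB, Prod.fst_add, Prod.smul_fst, Prod.fst_sub, smul_eq_mul]
      field_simp
      rw [hΔ_def]; ring
    · simp only [hA, hB, Prod.snd_add, Prod.smul_snd, Prod.snd_sub, smul_eq_mul]
      field_simp
      rw [hΔ_def]; ring
  let μ : ι → ι → ℝ := fun i j => (1 - A (v i) - B (v i)) * (if j = i₀ then 1 else 0) +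
    (A (v i) * (if j = i₁ then 1 else 0) + B (v i) * (if j = i₂ then 1 else 0))
  have hμsum : ∀ (g : ι → ℝ) i, ∑ j, g j * μ i j =
      (1 - A (v i) - B (v i)) * g i₀ + (A (v i) * g i₁ + B (v i) * g i₂) := fun g i => by
    simp only [μ, mul_add, Finset.sum_add_distrib, mul_left_comm (g _), ← Finset.mul_sum,
      sum_ite_delta]
  refine ⟨μ, fun i j hj => ?_, fun i => ?_, fun i => ?_, fun g => ?_, fun C hC hCS => ?_⟩
  · by_contra hjS
    have h0 : j ≠ i₀ := fun h => hjS (h ▸ hi₀)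
    have h1 : j ≠ i₁ := fun h => hjS (h ▸ hi₁)
    have h2 : j ≠ i₂ := fun h => hjS (h ▸ hi₂)
    exact hj (by simp [μ, h0, h1, h2])
  · have := hμsum (fun _ => 1) i
    simp only [one_mul] at this
    rw [this]; ring
  · conv_rhs => rw [hdecomp (v i)]
    simp only [μ]
    rw [mom_add, mom_add, mom_mul_left, mom_mul_left, mom_mul_left, mom_delta, mom_delta, mom_delta]
    module
  · refine ⟨(((g i₁ - g i₀) * ((v i₂).2 - (v i₀).2) - (g i₂ - g i₀) * ((v i₁).2 - (v i₀).2)) / Δ,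
      ((g i₂ - g i₀) * ((v i₁).1 - (v i₀).1) - (g i₁ - g i₀) * ((v i₂).1 - (v i₀).1)) / Δ),
      g i₀ - (((g i₁ - g i₀) * ((v i₂).2 - (v i₀).2) - (g i₂ - g i₀) * ((v i₁).2 - (v i₀).2)) / Δ *
        (v i₀).1 + ((g i₂ - g i₀) * ((v i₁).1 - (v i₀).1) -
        (g i₁ - g i₀) * ((v i₂).1 - (v i₀).1)) / Δ * (v i₀).2), fun i => ?_⟩
    rw [hμsum]
    simp only [hA, hB, pairing_apply]
    field_simp
    ring
  · rw [hC.interior_nonempty_iff_affineSpan_eq_top, eq_top_iff]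
    intro x _
    have hmem : ∀ i ∈ S, v i ∈ affineSpan ℝ C := fun i hi => subset_affineSpan ℝ C (hCS i hi)
    rw [hdecomp x, add_comm]
    refine AffineSubspace.vadd_mem_of_mem_direction ?_ (hmem i₀ hi₀)
    exact add_mem (Submodule.smul_mem _ _ (AffineSubspace.vsub_mem_direction (hmem i₁ hi₁)
      (hmem i₀ hi₀))) (Submodule.smul_mem _ _ (AffineSubspace.vsub_mem_direction (hmem i₂ hi₂)
      (hmem i₀ hi₀)))

/-- The heights and the points of the degenerate slice with spanning support `S` are described by
affine functions. -/
theorem exists_cell_functional {S : Set ι} (hne : S.Nonempty)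
    (hS : ∀ (a : ℝ × ℝ →L[ℝ] ℝ) (k : ℝ), (∀ i ∈ S, a (v i) = k) → a = 0) :
    ∃ (θ : ℝ × ℝ) (κ : ℝ), ∀ z ∈ toricSlice v ν 0, {i | z i ≠ 0} = S →
      (∀ i, pairing θ (v i) + κ ≤ ν i) ∧ (∀ i, ν i = pairing θ (v i) + κ ↔ i ∈ S) ∧
      ∃ (η : ℝ × ℝ) (β : ℝ), ∀ i ∈ S, z i = Real.exp (pairing η (v i) + β) := by
  classical
  obtain ⟨μ, hμS, hμ1, hμv, hint, -⟩ := exists_affine_coordinates (v := v) hne hS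
  obtain ⟨θ, κ, hθ⟩ := hint ν
  refine ⟨θ, κ, fun z hz hzS => ?_⟩
  have hmemS : ∀ i, z i ≠ 0 ↔ i ∈ S := fun i => by rw [← hzS]; rfl
  have key := fun i => relation_of_mem_toricSlice hz (α := fun j => if j = i then (1:ℝ) else 0)
    (μ := μ i) (fun j => by positivity) (fun j hj => (hmemS j).2 (hμS i j hj))
    (by rw [hμ1]; simp) (by rw [hμv, mom_delta])
  have hsupp : ∀ i, (∀ j, (if j = i then (1:ℝ) else 0) ≠ 0 → z j ≠ 0) ↔ i ∈ S := fun i => by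
    simp [hmemS]
  simp only [hsupp, sum_ite_delta, hθ] at key
  refine ⟨fun i => (key i).1, fun i => (key i).2.1, ?_⟩
  obtain ⟨η, β, hη⟩ := hint fun i => Real.log (z i)
  refine ⟨η, β, fun i hi => ?_⟩
  have h1 := (key i).2.2 hi
  have h2 := hη i
  simp only [mul_comm (Real.log _)] at h2
  rw [h2] at h1
  simp only [ite_mul, one_mul, zero_mul, Finset.sum_ite_eq', Finset.mem_univ, if_true] at h1
  rw [← h1, Real.exp_log ((hz.1.1 i).lt_of_ne' ((hmemS i).2 hi))]

end Relations

section LowerFaces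

/-- The Minkowski sum of a set with the upward ray. -/
def raised (Q : Set (ℝ × ℝ × ℝ)) : Set (ℝ × ℝ × ℝ) :=
  {p : ℝ × ℝ × ℝ | ∃ a ∈ Q, ∃ s : ℝ, 0 ≤ s ∧ p = a + ((s, 0, 0) : ℝ × ℝ × ℝ)}

/-- The union of the compact faces of the raised set. -/
def lowerFaces (Q : Set (ℝ × ℝ × ℝ)) : Set (ℝ × ℝ × ℝ) :=
  ⋃₀ {F : Set (ℝ × ℝ × ℝ) | IsExposed ℝ (raised Q) F ∧ IsCompact F}

/-- The part of `Q` in the graph of an affine function. -/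
def graphSection (Q : Set (ℝ × ℝ × ℝ)) (θ : ℝ × ℝ) (κ : ℝ) : Set (ℝ × ℝ × ℝ) :=
  {x ∈ Q | x.1 = pairing θ x.2 + κ}

variable {Q : Set (ℝ × ℝ × ℝ)} {θ : ℝ × ℝ} {κ : ℝ}

theorem subset_raised : Q ⊆ raised Q := fun x hx => ⟨x, hx, 0, le_rfl, by ext <;> simp⟩

theorem le_of_mem_raised (h : ∀ x ∈ Q, pairing θ x.2 + κ ≤ x.1) :
    ∀ x ∈ raised Q, pairing θ x.2 + κ ≤ x.1 := by
  rintro _ ⟨a, ha, s, hs, rfl⟩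
  have := h a ha
  have e : (a + ((s, 0, 0) : ℝ × ℝ × ℝ)).2 = a.2 := by ext <;> simp
  rw [e, Prod.fst_add]
  linarith

theorem isExposed_graphSection (h : ∀ x ∈ Q, pairing θ x.2 + κ ≤ x.1) :
    IsExposed ℝ Q (graphSection Q θ κ) := by
  rintro ⟨w, hw, hw'⟩
  refine ⟨(pairing θ).comp (ContinuousLinearMap.snd ℝ ℝ (ℝ × ℝ)) -
    ContinuousLinearMap.fst ℝ ℝ (ℝ × ℝ), ?_⟩
  ext x
  simp only [graphSection, mem_ofPred_eq, _root_.sub_apply,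
    ContinuousLinearMap.comp_apply, ContinuousLinearMap.coe_snd', ContinuousLinearMap.coe_fst']
  refine and_congr_right fun hx => ⟨fun hx' y hy => ?_, fun hx' => ?_⟩
  · linarith [h y hy]
  · linarith [hx' w hw, h x hx]

theorem graphSection_subset_lowerFaces (hQ : IsCompact Q)
    (h : ∀ x ∈ Q, pairing θ x.2 + κ ≤ x.1) : graphSection Q θ κ ⊆ lowerFaces Q := by
  have e : graphSection (raised Q) θ κ = graphSection Q θ κ := by
    ext x
    refine ⟨?_, fun hx => ⟨subset_raised hx.1, hx.2⟩⟩
    rintro ⟨⟨a, ha, s, hs, rfl⟩, hx⟩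
    have e : (a + ((s, 0, 0) : ℝ × ℝ × ℝ)).2 = a.2 := by ext <;> simp
    rw [e, Prod.fst_add] at hx
    have h0 : s = 0 := by
      have := h a ha
      simp only at hx
      linarith
    subst h0
    have e0 : a + ((0, 0, 0) : ℝ × ℝ × ℝ) = a := by ext <;> simp
    rw [e0]
    exact ⟨ha, by simpa using hx⟩
  refine fun x hx => ⟨graphSection Q θ κ, ⟨?_, ?_⟩, hx⟩
  · rw [← e]
    exact isExposed_graphSection (le_of_mem_raised h)
  · exact hQ.inter_right (isClosed_eq (by fun_prop) (by fun_prop))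

theorem exists_support_of_mem_lowerFaces {x : ℝ × ℝ × ℝ} (hx : x ∈ lowerFaces Q) :
    ∃ (θ : ℝ × ℝ) (κ : ℝ), (∀ y ∈ Q, pairing θ y.2 + κ ≤ y.1) ∧ x.1 = pairing θ x.2 + κ := by
  obtain ⟨G, ⟨hG, hGc⟩, hxG⟩ := hx
  obtain ⟨l, rfl⟩ := hG ⟨x, hxG⟩
  have hl : ∀ y : ℝ × ℝ × ℝ, l y = y.1 * l (1, 0, 0) + (y.2.1 * l (0, 1, 0) +
      y.2.2 * l (0, 0, 1)) := fun y => by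
    have : y = y.1 • ((1, 0, 0) : ℝ × ℝ × ℝ) + (y.2.1 • ((0, 1, 0) : ℝ × ℝ × ℝ) +
        y.2.2 • ((0, 0, 1) : ℝ × ℝ × ℝ)) := by ext <;> simp
    conv_lhs => rw [this]
    simp only [map_add, map_smul, smul_eq_mul]
  obtain ⟨⟨a, ha, s, hs, hxa⟩, hxmax⟩ := hxG
  have hup : ∀ r : ℝ, 0 ≤ r → x + ((r, 0, 0) : ℝ × ℝ × ℝ) ∈ raised Q := fun r hr =>
    ⟨a, ha, s + r, by positivity, by rw [hxa]; ext <;> simp [add_assoc]⟩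
  have hle : l (1, 0, 0) < 0 := by
    refine lt_of_le_of_ne ?_ fun h0 => ?_
    · have := hxmax _ (hup 1 zero_le_one)
      rw [map_add] at this
      linarith
    · obtain ⟨R, hR⟩ := hGc.isBounded.subset_closedBall x
      have hmem : x + ((|R| + 1, 0, 0) : ℝ × ℝ × ℝ) ∈
          {x ∈ raised Q | ∀ y ∈ raised Q, l y ≤ l x} := by
        refine ⟨hup _ (by positivity), fun y hy => (hxmax y hy).trans_eq ?_⟩
        rw [map_add, hl (|R| + 1, 0, 0), h0]
        simp
      have := hR hmem
      rw [Metric.mem_closedBall, dist_eq_norm, add_sub_cancel_left, Prod.norm_mk,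
        Real.norm_of_nonneg (by positivity)] at this
      linarith [le_max_left (|R| + 1) ‖((0, 0) : ℝ × ℝ)‖, le_abs_self R]
  refine ⟨(-(l (0, 1, 0)) / l (1, 0, 0), -(l (0, 0, 1)) / l (1, 0, 0)), l x / l (1, 0, 0),
    fun y hy => ?_, ?_⟩
  · have := hxmax y (subset_raised hy)
    rw [hl y] at this
    rw [pairing_apply]
    have e : -l (0, 1, 0) / l (1, 0, 0) * y.2.1 + -l (0, 0, 1) / l (1, 0, 0) * y.2.2 +
        l x / l (1, 0, 0) = (l x - (y.2.1 * l (0, 1, 0) + y.2.2 * l (0, 0, 1))) / l (1, 0, 0) := by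
      ring
    rw [e, div_le_iff_of_neg hle]
    linarith
  · have := hl x
    rw [pairing_apply]
    have hne := hle.ne
    field_simp
    linarith

/-- Every full-dimensional lower face is the part of `Q` in the graph of a supporting affine
function. -/
theorem exists_support_of_subset_lowerFaces {F : Set (ℝ × ℝ × ℝ)} (hQ : Convex ℝ Q)
    (hF : IsExposed ℝ Q F) (hFl : F ⊆ lowerFaces Q) (hint : (interior (Prod.snd '' F)).Nonempty) :
    ∃ (θ : ℝ × ℝ) (κ : ℝ), (∀ x ∈ Q, pairing θ x.2 + κ ≤ x.1) ∧ F = graphSection Q θ κ := by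
  obtain ⟨q₀, hq₀⟩ := hint
  obtain ⟨x₀, hx₀, hx₀q⟩ := interior_subset hq₀
  obtain ⟨θ, κ, hsup, hx₀'⟩ := exists_support_of_mem_lowerFaces (hFl hx₀)
  have hFQ : F ⊆ Q := hF.subset
  have hFc : Convex ℝ F := hF.convex hQ
  have hFp : ∀ y ∈ F, y.1 = pairing θ y.2 + κ := by
    intro y hy
    have hcont : Continuous fun ε : ℝ => q₀ + ε • (q₀ - y.2) := by fun_prop
    have hev : ∀ᶠ ε in 𝓝[>] (0:ℝ), q₀ + ε • (q₀ - y.2) ∈ Prod.snd '' F :=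
      (hcont.continuousAt.eventually_mem
        (mem_interior_iff_mem_nhds.1 (by simpa using hq₀))).filter_mono nhdsWithin_le_nhds
    obtain ⟨ε, ⟨y', hy', hy'q⟩, hε⟩ := (hev.and self_mem_nhdsWithin).exists
    have hε : 0 < ε := hε
    set w := (ε / (1 + ε)) • y + (1 / (1 + ε)) • y' with hw
    have hwF : w ∈ F := hFc hy hy' (by positivity) (by positivity) (by field_simp; ring)
    have hw2 : w.2 = q₀ := by
      have : w.2 = (ε / (1 + ε)) • y.2 + (1 / (1 + ε)) • y'.2 := rfl
      rw [this, hy'q]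
      ext <;> simp <;> field_simp <;> ring
    obtain ⟨θ', κ', hsup', hw'⟩ := exists_support_of_mem_lowerFaces (hFl hwF)
    have h1 := hsup' x₀ (hFQ hx₀)
    have h2 := hsup w (hFQ hwF)
    rw [hw2] at hw' h2
    rw [hx₀q] at h1 hx₀'
    have hwe : w.1 = pairing θ w.2 + κ := by rw [hw2]; linarith
    have h3 := hsup y (hFQ hy)
    have h4 := hsup y' (hFQ hy')
    have e1 : w.1 = (ε / (1 + ε)) * y.1 + (1 / (1 + ε)) * y'.1 := rfl
    have e2 : pairing θ w.2 = (ε / (1 + ε)) * pairing θ y.2 + (1 / (1 + ε)) * pairing θ y'.2 := by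
      have : w.2 = (ε / (1 + ε)) • y.2 + (1 / (1 + ε)) • y'.2 := rfl
      rw [this, map_add, map_smul, map_smul, smul_eq_mul, smul_eq_mul]
    rw [e1, e2] at hwe
    field_simp at hwe
    nlinarith
  refine ⟨θ, κ, hsup, Subset.antisymm (fun y hy => ⟨hFQ hy, hFp y hy⟩) ?_⟩
  obtain ⟨l, hl⟩ := hF ⟨x₀, hx₀⟩
  have hconst : ∀ y ∈ F, l y = l x₀ := fun y hy => by
    rw [hl] at hy hx₀
    exact le_antisymm (hx₀.2 y hy.1) (hy.2 x₀ hx₀.1)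
  set a : ℝ × ℝ →L[ℝ] ℝ := l.comp ((pairing θ).prod (ContinuousLinearMap.id ℝ (ℝ × ℝ)))
  have hla : ∀ y : ℝ × ℝ × ℝ, y.1 = pairing θ y.2 + κ → l y = a y.2 + l (κ, 0) := fun y hy => by
    have : y = (pairing θ y.2, y.2) + (κ, 0) := by
      ext
      · simpa using hy
      · simp
      · simp
    conv_lhs => rw [this]
    rw [map_add]
    rfl
  have ha : a = 0 := by
    refine functional_eq_zero_of_const (s := Prod.snd '' F) (k := l x₀ - l (κ, 0)) ⟨q₀, hq₀⟩ ?_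
    rintro _ ⟨y, hy, rfl⟩
    rw [← hconst y hy, hla y (hFp y hy)]
    ring
  rintro y ⟨hy, hy'⟩
  have : l y = l x₀ := by rw [hla y hy', hla x₀ (hFp x₀ hx₀), ha]; rfl
  rw [hl] at hx₀ ⊢
  exact ⟨hy, fun w hw => (hx₀.2 w hw).trans_eq this.symm⟩

end LowerFaces

section Cells

theorem support_line {ι : Type*} [DecidableEq ι] {S : Set ι} {i₀ i₁ : ι} (h₀ : i₀ ∈ S) (h₁ : i₁ ∈ S)
    (τ : ℝ)
    (i : ι) (hi : (if i = i₀ then (1:ℝ) else 0) + τ * ((if i = i₁ then (1:ℝ) else 0) -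
      (if i = i₀ then (1:ℝ) else 0)) ≠ 0) : i ∈ S := by
  by_cases h : i = i₀
  · exact h ▸ h₀
  by_cases h' : i = i₁
  · exact h' ▸ h₁
  simp [h, h'] at hi

variable {ι : Type*} [Fintype ι] {v : ι → ℝ × ℝ} {ν : ι → ℝ}

/-- A family of points in a line either consists of one point, or contains two points spanning the
line. -/
theorem collinear_cases {S : Set ι} (hne : S.Nonempty) {a : ℝ × ℝ →L[ℝ] ℝ} (ha : a ≠ 0) {k : ℝ}
    (hS : ∀ i ∈ S, a (v i) = k) :
    (∃ p ∈ S, ∀ i ∈ S, v i = v p) ∨ ∃ i₀ ∈ S, ∃ i₁ ∈ S, v i₁ - v i₀ ≠ 0 ∧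
      ∀ x, a x = k → ∃ τ : ℝ, x = v i₀ + τ • (v i₁ - v i₀) := by
  by_cases h : ∃ p ∈ S, ∀ i ∈ S, v i = v p
  · exact Or.inl h
  refine Or.inr ?_
  push Not at h
  obtain ⟨i₀, hi₀⟩ := hne
  obtain ⟨i₁, hi₁, h01⟩ := h i₀ hi₀
  refine ⟨i₀, hi₀, i₁, hi₁, sub_ne_zero.2 h01, fun x hx => ?_⟩
  set w := v i₁ - v i₀ with hw
  have hw0 : w ≠ 0 := sub_ne_zero.2 h01
  have haw : a w = 0 := by rw [hw, map_sub, hS i₁ hi₁, hS i₀ hi₀, sub_self]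
  have hau : a (x - v i₀) = 0 := by rw [map_sub, hx, hS i₀ hi₀, sub_self]
  have hexp : ∀ y : ℝ × ℝ, a y = y.1 * a (1, 0) + y.2 * a (0, 1) := fun y => by
    have : y = y.1 • ((1, 0) : ℝ × ℝ) + y.2 • ((0, 1) : ℝ × ℝ) := by ext <;> simp
    conv_lhs => rw [this]
    simp only [map_add, map_smul, smul_eq_mul]
  have hcross : w.1 * (x - v i₀).2 = w.2 * (x - v i₀).1 := by
    by_contra hne
    have hne := sub_ne_zero.2 hne
    rw [hexp] at haw hau
    apply ha
    have h1 : a (1, 0) = 0 := by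
      refine (mul_eq_zero.1 (?_ : (w.1 * (x - v i₀).2 - w.2 * (x - v i₀).1) * _ = 0)).resolve_left
        hne
      linear_combination (x - v i₀).2 * haw - w.2 * hau
    have h2 : a (0, 1) = 0 := by
      refine (mul_eq_zero.1 (?_ : (w.1 * (x - v i₀).2 - w.2 * (x - v i₀).1) * _ = 0)).resolve_left
        hne
      linear_combination w.1 * hau - (x - v i₀).1 * haw
    ext
    · simpa using h1
    · simpa using h2
  have hpos : 0 < w.1 ^ 2 + w.2 ^ 2 := by
    by_contra! hle
    exact hw0 (Prod.ext (by simp only [Prod.fst_zero]; nlinarith)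
      (by simp only [Prod.snd_zero]; nlinarith))
  refine ⟨(w.1 * (x - v i₀).1 + w.2 * (x - v i₀).2) / (w.1 ^ 2 + w.2 ^ 2), ?_⟩
  rw [← sub_eq_iff_eq_add']
  ext
  · simp only [Prod.smul_fst, smul_eq_mul]
    field_simp
    linear_combination -w.2 * hcross
  · simp only [Prod.smul_snd, smul_eq_mul]
    field_simp
    linear_combination w.1 * hcross

theorem sum_line [DecidableEq ι] (f : ι → ℝ) (i₀ i₁ : ι) (τ : ℝ) :
    ∑ i, f i * ((if i = i₀ then (1:ℝ) else 0) + τ * ((if i = i₁ then (1:ℝ) else 0) -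
      (if i = i₀ then (1:ℝ) else 0))) = f i₀ + τ * (f i₁ - f i₀) := by
  simp only [mul_add, mul_sub, Finset.sum_add_distrib, Finset.sum_sub_distrib, mul_left_comm _ τ,
    ← Finset.mul_sum, sum_ite_delta]

theorem mom_line [DecidableEq ι] (i₀ i₁ : ι) (τ : ℝ) :
    mom v (fun i => (if i = i₀ then (1:ℝ) else 0) + τ * ((if i = i₁ then (1:ℝ) else 0) -
      (if i = i₀ then (1:ℝ) else 0))) = v i₀ + τ • (v i₁ - v i₀) := by
  ext
  · simp only [mom_fst, mul_comm _ (Prod.fst _), sum_line]; simp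
  · simp only [mom_snd, mul_comm _ (Prod.snd _), sum_line]; simp

/-- The coordinates of a point of the degenerate slice are exponentials of an affine function on
the support. -/
theorem exists_exp_eq {z : ι → ℝ} (hz : z ∈ toricSlice v ν 0) :
    ∃ (η : ℝ × ℝ) (β : ℝ), ∀ i, z i ≠ 0 → z i = Real.exp (pairing η (v i) + β) := by
  classical
  have hne : {i | z i ≠ 0}.Nonempty := by
    by_contra h
    rw [not_nonempty_iff_eq_empty, eq_empty_iff_forall_notMem] at h
    have : ∀ i, z i = 0 := fun i => not_not.1 (h i)
    simpa [this] using hz.1.2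
  by_cases hS : ∀ (a : ℝ × ℝ →L[ℝ] ℝ) (k : ℝ), (∀ i ∈ {i | z i ≠ 0}, a (v i) = k) → a = 0
  · obtain ⟨θ, κ, h⟩ := exists_cell_functional (ν := ν) hne hS
    exact (h z hz rfl).2.2
  push Not at hS
  obtain ⟨a, k, hak, ha⟩ := hS
  have hpos : ∀ i, z i ≠ 0 → 0 < z i := fun i hi => (hz.1.1 i).lt_of_ne' hi
  rcases collinear_cases hne ha hak with ⟨p, hp, hall⟩ | ⟨i₀, hi₀, i₁, hi₁, hw, hline⟩
  · refine ⟨0, Real.log (z p), fun i hi => ?_⟩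
    have := (relation_of_mem_toricSlice hz (α := fun j => if j = i then (1:ℝ) else 0)
      (μ := fun j => if j = p then (1:ℝ) else 0) (fun j => by positivity)
      (fun j hj => by
        have : j = p := by by_contra h; simp [h] at hj
        exact this ▸ hp) (by simp) (by rw [mom_delta, mom_delta]; exact hall i hi)).2.2
      (fun j hj => by
        have : j = i := by by_contra h; simp [h] at hj
        exact this ▸ hi)
    simp only [ite_mul, one_mul, zero_mul, Finset.sum_ite_eq', Finset.mem_univ, if_true] at this
    rw [← this]
    simp [Real.exp_log (hpos i hi)]
  · set w := v i₁ - v i₀ with hw_def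
    have hw2 : 0 < w.1 ^ 2 + w.2 ^ 2 := by
      by_contra! hle
      exact hw (Prod.ext (by simp only [Prod.fst_zero]; nlinarith)
        (by simp only [Prod.snd_zero]; nlinarith))
    set D := (Real.log (z i₁) - Real.log (z i₀)) / (w.1 ^ 2 + w.2 ^ 2) with hD
    have hηw : pairing (D • w) w = Real.log (z i₁) - Real.log (z i₀) := by
      rw [pairing_apply, hD]
      simp only [Prod.smul_fst, Prod.smul_snd, smul_eq_mul]
      field_simp
    refine ⟨D • w, Real.log (z i₀) - pairing (D • w) (v i₀), fun i hi => ?_⟩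
    obtain ⟨τ, hτ⟩ := hline (v i) (hak i hi)
    have := (relation_of_mem_toricSlice hz (α := fun j => if j = i then (1:ℝ) else 0)
      (fun j => by positivity) (support_line hi₀ hi₁ τ)
      (by
        have := sum_line (fun _ => 1) i₀ i₁ τ
        simp only [one_mul] at this
        rw [this]; simp) (by rw [mom_delta, mom_line]; exact hτ)).2.2
      (fun j hj => by
        have : j = i := by by_contra h; simp [h] at hj
        exact this ▸ hi)
    simp only [mul_comm _ (Real.log _), sum_line, sum_ite_delta] at this
    rw [hτ, map_add, map_smul, hηw, smul_eq_mul]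
    rw [show pairing (D • w) (v i₀) + τ * (Real.log (z i₁) - Real.log (z i₀)) +
      (Real.log (z i₀) - pairing (D • w) (v i₀)) = Real.log (z i) by rw [this]; ring,
      Real.exp_log (hpos i hi)]

/-- A subset of a finite configuration which is closed under affine relations, and is not
spanning, is cut out by a supporting line. -/
theorem exists_supporting_functional {S T : Set ι} (hne : S.Nonempty) {a₀ : ℝ × ℝ →L[ℝ] ℝ}
    (ha₀ : a₀ ≠ 0) {k₀ : ℝ} (hak : ∀ i ∈ S, a₀ (v i) = k₀)
    (hface : ∀ α μ : ι → ℝ, (∀ i, 0 ≤ α i) → (∀ i, α i ≠ 0 → i ∈ T) → (∀ i, μ i ≠ 0 → i ∈ S) →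
      ∑ i, α i = ∑ i, μ i → mom v α = mom v μ → ∀ i, α i ≠ 0 → i ∈ S) :
    ∃ (a : ℝ × ℝ →L[ℝ] ℝ) (k : ℝ), (∀ i ∈ S, a (v i) = k) ∧ ∀ i ∈ T, i ∉ S → a (v i) < k := by
  classical
  rcases collinear_cases hne ha₀ hak with ⟨p, hp, hall⟩ | ⟨i₀, hi₀, i₁, hi₁, hw, hline⟩
  · set D : Set (ι → ℝ) := stdSimplex ℝ ι ∩ ⋂ i ∈ (T \ S)ᶜ, {α | α i = 0}
    have hDconv : Convex ℝ D := (convex_stdSimplex ℝ ι).inter <| convex_iInter₂ fun i _ => by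
      intro x hx y hy r s _ _ _
      simp only [mem_ofPred_eq] at hx hy
      simp [hx, hy]
    have hDcomp : IsCompact D := (isCompact_stdSimplex ℝ ι).inter_right <|
      isClosed_biInter fun i _ => isClosed_eq (continuous_apply i) continuous_const
    have hlin : IsLinearMap ℝ (mom v) :=
      ⟨fun x y => by simp [mom, add_smul, Finset.sum_add_distrib],
        fun r x => by simp [mom, Finset.smul_sum, smul_smul]⟩
    obtain ⟨f, u, hfu, hfD⟩ := geometric_hahn_banach_point_closed (x := v p)
      (t := mom v '' D) (hDconv.is_linear_image hlin) (hDcomp.image continuous_mom).isClosed (by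
        rintro ⟨α, ⟨hα, hα0⟩, hαp⟩
        simp only [mem_iInter, mem_ofPred_eq] at hα0
        have hsub : ∀ i, α i ≠ 0 → i ∈ T \ S := fun i hi => by
          by_contra h
          exact hi (hα0 i h)
        have := hface α (fun j => if j = p then (1:ℝ) else 0) hα.1 (fun i hi => (hsub i hi).1)
          (fun j hj => by
            have : j = p := by by_contra h; simp [h] at hj
            exact this ▸ hp) (by rw [hα.2]; simp) (by rw [hαp, mom_delta])
        have h0 : ∀ i, α i = 0 := fun i => by
          by_contra hi
          exact (hsub i hi).2 (this i hi)
        simpa [h0] using hα.2)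
    refine ⟨-f, -f (v p), fun i hi => by rw [hall i hi]; rfl, fun i hiT hiS => ?_⟩
    have := hfD (v i) ⟨fun j => if j = i then (1:ℝ) else 0, ⟨⟨fun j => by positivity, by simp⟩, by
      simp only [mem_iInter, mem_ofPred_eq]
      intro j hj
      exact if_neg fun h : j = i => hj (h ▸ ⟨hiT, hiS⟩)⟩, mom_delta i⟩
    show -f (v i) < -f (v p)
    linarith
  · have hmem : ∀ i ∈ T, a₀ (v i) = k₀ → i ∈ S := fun i hi hai => by
      obtain ⟨τ, hτ⟩ := hline (v i) hai
      refine hface (fun j => if j = i then (1:ℝ) else 0) _ (fun j => by positivity) (fun j hj => ?_)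
        (support_line hi₀ hi₁ τ) ?_ (by rw [mom_delta, mom_line]; exact hτ) i (by simp)
      · have : j = i := by by_contra h; simp [h] at hj
        exact this ▸ hi
      · have := sum_line (fun _ => 1) i₀ i₁ τ
        simp only [one_mul] at this
        rw [this]; simp
    have hside : ∀ i ∈ T, ∀ j ∈ T, a₀ (v i) < k₀ → k₀ < a₀ (v j) → False := by
      intro i hi j hj hik hjk
      set r := (k₀ - a₀ (v i)) / (a₀ (v j) - a₀ (v i)) with hr
      have hd : 0 < a₀ (v j) - a₀ (v i) := by linarith
      have hr0 : 0 < r := div_pos (by linarith) hd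
      have hr1 : r < 1 := (div_lt_one hd).2 (by linarith)
      obtain ⟨τ, hτ⟩ := hline (v i + r • (v j - v i)) (by
        rw [map_add, map_smul, map_sub, smul_eq_mul, hr]
        field_simp
        ring)
      have := hface (fun l => (if l = i then (1:ℝ) else 0) + r * ((if l = j then (1:ℝ) else 0) -
          (if l = i then (1:ℝ) else 0))) _ (fun l => by split_ifs <;> simp <;> linarith)
        (support_line hi hj r) (support_line hi₀ hi₁ τ) (by
          have h1 := sum_line (fun _ => 1) i₀ i₁ τ
          have h2 := sum_line (fun _ => 1) i j r
          simp only [one_mul] at h1 h2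
          rw [h1, h2]; simp) (by rw [mom_line, mom_line]; exact hτ) i (by
            have hij : i ≠ j := by rintro rfl; linarith
            simp [hij]; linarith)
      linarith [hak i this]
    by_cases h : ∃ i ∈ T, a₀ (v i) < k₀
    · obtain ⟨i, hi, hik⟩ := h
      refine ⟨a₀, k₀, hak, fun j hj hjS => ?_⟩
      by_contra! hle
      exact hside i hi j hj hik (hle.lt_of_ne fun h => hjS (hmem j hj h.symm))
    · push Not at h
      refine ⟨-a₀, -k₀, fun i hi => congrArg Neg.neg (hak i hi), fun j hj hjS => ?_⟩
      show -a₀ (v j) < -k₀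
      exact neg_lt_neg ((h j hj).lt_of_ne fun h => hjS (hmem j hj h.symm))

end Cells

section LowerHull

/-- The monomials, at the point with logarithmic coordinates `η`, with exponents in `Λ`. -/
def faceWeight {ι : Type*} (v : ι → ℝ × ℝ) (Λ : Set (ℝ × ℝ)) (η : ℝ × ℝ) : ι → ℝ :=
  (v ⁻¹' Λ).indicator fun i => Real.exp (pairing η (v i))

theorem faceWeight_nonneg {ι : Type*} {v : ι → ℝ × ℝ} (Λ : Set (ℝ × ℝ)) (η : ℝ × ℝ)
    (i : ι) : 0 ≤ faceWeight v Λ η i :=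
  indicator_nonneg (fun _ _ => (Real.exp_pos _).le) i

variable {ι : Type*} [Fintype ι] {v : ι → ℝ × ℝ} {ν : ι → ℝ} {sg : Bool × Bool → ι → ℝ}
  {c : ℝ → ι → ℝ} {Q : Set (ℝ × ℝ × ℝ)} {θ : ℝ × ℝ} {κ : ℝ}

/-- The numbers `ν i` are the lowest heights of the body `Q` over the points `v i`, and these
points determine the lower part of `Q`. -/
structure IsLowerHull (Q : Set (ℝ × ℝ × ℝ)) (v : ι → ℝ × ℝ) (ν : ι → ℝ) : Prop where
  isCompact : IsCompact Q
  convex : Convex ℝ Q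
  mem : ∀ i, (ν i, v i) ∈ Q
  le : ∀ i k, (k, v i) ∈ Q → ν i ≤ k
  combination : ∀ x ∈ Q, ∃ α ∈ stdSimplex ℝ ι, mom v α = x.2 ∧ ∑ i, α i * ν i ≤ x.1

/-- The full-dimensional lower faces. -/
def lowerCells (Q : Set (ℝ × ℝ × ℝ)) : Set (Set (ℝ × ℝ × ℝ)) :=
  {F | IsExposed ℝ Q F ∧ F ⊆ lowerFaces Q ∧ (interior (Prod.snd '' F)).Nonempty}

/-- The normalization of `faceWeight`. -/
def facePoint (v : ι → ℝ × ℝ) (Λ : Set (ℝ × ℝ)) (η : ℝ × ℝ) (i : ι) : ℝ :=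
  faceWeight v Λ η i / ∑ j, faceWeight v Λ η j

/-- The image under the moment map of `Λ` of the curve with the coefficients `sg s i * c₀ i`. -/
def cellCurve (v : ι → ℝ × ℝ) (sg : Bool × Bool → ι → ℝ) (c₀ : ι → ℝ) (Λ : Set (ℝ × ℝ)) :
    Set (ℝ × ℝ) :=
  ⋃ s, quadRefl s '' {x | ∃ η, x = mom v (facePoint v Λ η) ∧
    ∑ i, faceWeight v Λ η i * (sg s i * c₀ i) = 0}

theorem sum_pairing_add {α : ι → ℝ} (hα : α ∈ stdSimplex ℝ ι) (θ : ℝ × ℝ) (κ : ℝ) :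
    ∑ i, α i * (pairing θ (v i) + κ) = pairing θ (mom v α) + κ := by
  rw [map_mom]
  simp only [mul_add, Finset.sum_add_distrib, ← Finset.sum_mul, hα.2, one_mul]

theorem sum_faceWeight_pos {Λ : Set (ℝ × ℝ)} (η : ℝ × ℝ) (hΛ : (v ⁻¹' Λ).Nonempty) :
    0 < ∑ i, faceWeight v Λ η i := by
  obtain ⟨i, hi⟩ := hΛ
  refine Finset.sum_pos' (fun j _ => faceWeight_nonneg Λ η j) ⟨i, Finset.mem_univ i, ?_⟩
  rw [faceWeight, indicator_of_mem hi]
  exact Real.exp_pos _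

variable (hQ : IsLowerHull Q v ν)

include hQ in
theorem IsLowerHull.le_of_forall (h : ∀ i, pairing θ (v i) + κ ≤ ν i) {x : ℝ × ℝ × ℝ}
    (hx : x ∈ Q) : pairing θ x.2 + κ ≤ x.1 := by
  obtain ⟨α, hα, hm, hle⟩ := hQ.combination x hx
  rw [← hm, ← sum_pairing_add hα]
  exact (Finset.sum_le_sum fun i _ => mul_le_mul_of_nonneg_left (h i) (hα.1 i)).trans hle

include hQ in
theorem IsLowerHull.mem_snd_graphSection (h : ∀ i, pairing θ (v i) + κ ≤ ν i) (i : ι) :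
    v i ∈ Prod.snd '' graphSection Q θ κ ↔ ν i = pairing θ (v i) + κ := by
  constructor
  · rintro ⟨⟨k, y⟩, ⟨hx, hx'⟩, rfl⟩
    exact ((hQ.le i k hx).trans_eq hx').antisymm (h i)
  · exact fun hi => ⟨(ν i, v i), ⟨hQ.mem i, hi⟩, rfl⟩

include hQ in
theorem IsLowerHull.exists_combination (h : ∀ i, pairing θ (v i) + κ ≤ ν i) {x : ℝ × ℝ}
    (hx : x ∈ Prod.snd '' graphSection Q θ κ) :
    ∃ α ∈ stdSimplex ℝ ι, mom v α = x ∧ ∀ i, α i ≠ 0 → ν i = pairing θ (v i) + κ := by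
  obtain ⟨y, ⟨hy, hy'⟩, rfl⟩ := hx
  obtain ⟨α, hα, hm, hle⟩ := hQ.combination y hy
  refine ⟨α, hα, hm, fun i hi => ?_⟩
  rw [hy', ← hm, ← sum_pairing_add hα] at hle
  have hterm : ∀ i ∈ Finset.univ, α i * (pairing θ (v i) + κ) ≤ α i * ν i :=
    fun i _ => mul_le_mul_of_nonneg_left (h i) (hα.1 i)
  have := (Finset.sum_eq_sum_iff_of_le hterm).1 (le_antisymm (Finset.sum_le_sum hterm) hle) i
    (Finset.mem_univ i)
  exact (mul_left_cancel₀ hi this).symm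

include hQ in
theorem IsLowerHull.exists_support {F : Set (ℝ × ℝ × ℝ)} (hF : F ∈ lowerCells Q) :
    ∃ (θ : ℝ × ℝ) (κ : ℝ), (∀ i, pairing θ (v i) + κ ≤ ν i) ∧ F = graphSection Q θ κ := by
  obtain ⟨θ, κ, h, hF⟩ := exists_support_of_subset_lowerFaces hQ.convex hF.1 hF.2.1 hF.2.2
  exact ⟨θ, κ, fun i => h _ (hQ.mem i), hF⟩

include hQ in
theorem IsLowerHull.graphSection_mem_lowerCells (h : ∀ i, pairing θ (v i) + κ ≤ ν i)
    (hint : (interior (Prod.snd '' graphSection Q θ κ)).Nonempty) :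
    graphSection Q θ κ ∈ lowerCells Q :=
  ⟨isExposed_graphSection fun _ => hQ.le_of_forall h,
    graphSection_subset_lowerFaces hQ.isCompact fun _ => hQ.le_of_forall h, hint⟩

/-- The normalized monomials of a cell are points of the degenerate slice. -/
theorem facePoint_mem_toricSlice {Λ : Set (ℝ × ℝ)} (h : ∀ i, pairing θ (v i) + κ ≤ ν i)
    (hΛ : ∀ i, v i ∈ Λ ↔ ν i = pairing θ (v i) + κ) (hne : (v ⁻¹' Λ).Nonempty) (η : ℝ × ℝ) :
    facePoint v Λ η ∈ toricSlice v ν 0 := by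
  have hN := sum_faceWeight_pos η hne
  refine ⟨normalized_mem_stdSimplex (faceWeight_nonneg Λ η) hN, fun a b ha hb hsum hmom hle => ?_⟩
  set ε : ι → ℝ := fun i => ν i - (θ.1 * (v i).1 + θ.2 * (v i).2 + κ) with hε_def
  have hε : ∀ i, 0 ≤ ε i := fun i => by
    have := h i
    rw [pairing_apply] at this
    simp only [hε_def]; linarith
  have hw : ∀ i, faceWeight v Λ η i = 0 ^ ε i *
      Real.exp (η.1 * (v i).1 + η.2 * (v i).2 + 0) := fun i => by
    by_cases hi : v i ∈ Λ
    · have h0 : ε i = 0 := by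
        have := (hΛ i).1 hi
        rw [pairing_apply] at this
        simp only [hε_def]; linarith
      rw [faceWeight, indicator_of_mem (show i ∈ v ⁻¹' Λ from hi), h0, Real.rpow_zero, one_mul,
        pairing_apply, add_zero]
    · have h0 : ε i ≠ 0 := fun h0 => hi <| (hΛ i).2 <| by
        rw [pairing_apply]
        simp only [hε_def] at h0; linarith
      rw [faceWeight, indicator_of_notMem (show i ∉ v ⁻¹' Λ from hi), Real.zero_rpow h0, zero_mul]
  have hprod : ∀ a : ι → ℝ, (∀ i, 0 ≤ a i) → ∏ i, faceWeight v Λ η i ^ a i =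
      0 ^ (∑ i, ε i * a i) * Real.exp (∑ i, (η.1 * (v i).1 + η.2 * (v i).2 + 0) * a i) := by
    intro a ha
    rw [← prod_exp_rpow, Real.rpow_sum_of_nonneg le_rfl fun i _ => mul_nonneg (hε i) (ha i),
      ← Finset.prod_mul_distrib]
    refine Finset.prod_congr rfl fun i _ => ?_
    rw [hw, Real.mul_rpow (Real.rpow_nonneg le_rfl _) (Real.exp_pos _).le, Real.rpow_mul le_rfl]
  unfold facePoint
  rw [prod_normalized_rpow (faceWeight_nonneg Λ η) hN, prod_normalized_rpow
    (faceWeight_nonneg Λ η) hN, hsum, hprod a ha, hprod b hb, sum_affine_eq hsum hmom η 0]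
  have hεa : ∀ a : ι → ℝ, ∑ i, ε i * a i =
      ∑ i, ν i * a i - ∑ i, (θ.1 * (v i).1 + θ.2 * (v i).2 + κ) * a i := fun a => by
    simp only [hε_def, sub_mul, Finset.sum_sub_distrib]
  have hsplit : ∑ i, ε i * a i = (∑ i, ν i * a i - ∑ i, ν i * b i) + ∑ i, ε i * b i := by
    rw [hεa, hεa, sum_affine_eq hsum hmom θ κ]
    ring
  rw [hsplit, Real.rpow_add_of_nonneg le_rfl (sub_nonneg.2 hle)
    (Finset.sum_nonneg fun i _ => mul_nonneg (hε i) (hb i))]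
  ring

include hQ in
theorem IsLowerHull.nonempty_preimage (h : ∀ i, pairing θ (v i) + κ ≤ ν i) {x : ℝ × ℝ}
    (hx : x ∈ Prod.snd '' graphSection Q θ κ) :
    (v ⁻¹' (Prod.snd '' graphSection Q θ κ)).Nonempty := by
  obtain ⟨α, hα, -, h'⟩ := hQ.exists_combination h hx
  obtain ⟨i, hi⟩ : ∃ i, α i ≠ 0 := by
    by_contra! h0
    simpa [h0] using hα.2
  exact ⟨i, (hQ.mem_snd_graphSection h i).2 (h' i hi)⟩

include hQ in
theorem IsLowerHull.cellCurve_subset (hv : ∀ i, 0 ≤ (v i).1 ∧ 0 ≤ (v i).2)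
    (hsg : SignCompat v sg) (hint : (interior (convexHull ℝ (range v))).Nonempty)
    {F : Set (ℝ × ℝ × ℝ)} (hF : F ∈ lowerCells Q) :
    cellCurve v sg (c 0) (Prod.snd '' F) ⊆
      {x ∈ tildeSet (convexHull ℝ (range v)) | quadHeight v ν sg c 0 x = 0} := by
  obtain ⟨θ, κ, h, rfl⟩ := hQ.exists_support hF
  obtain ⟨x₀, hx₀⟩ := hF.2.2
  refine iUnion_subset fun s => ?_
  rintro _ ⟨_, ⟨η, rfl, h0⟩, rfl⟩
  have hz := facePoint_mem_toricSlice h (hQ.mem_snd_graphSection h)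
    (hQ.nonempty_preimage h (interior_subset hx₀)) η
  have hm : mom v (facePoint v (Prod.snd '' graphSection Q θ κ) η) ∈ convexHull ℝ (range v) :=
    mom_mem_convexHull hz.1
  refine ⟨quadRefl_mem_tildeSet s hm, ?_⟩
  rw [quadHeight_quadRefl hv hsg hint (by simp) hm, height, lift_mom le_rfl hz]
  simp only [facePoint, div_mul_eq_mul_div, ← Finset.sum_div, h0, zero_div]

include hQ in
/-- A spanning support determines a cell. -/
theorem IsLowerHull.exists_cell {S : Set ι} (hint : (interior (convexHull ℝ (range v))).Nonempty)
    {q₀ : ℝ × ℝ} (hq₀ : q₀ ∈ convexHull ℝ (range v)) (hS : {i | lift v ν 0 q₀ i ≠ 0} = S)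
    (hspan : Spanning v (lift v ν 0 q₀)) :
    ∃ (θ : ℝ × ℝ) (κ : ℝ), (∀ i, pairing θ (v i) + κ ≤ ν i) ∧
      (∀ i, ν i = pairing θ (v i) + κ ↔ i ∈ S) ∧ graphSection Q θ κ ∈ lowerCells Q := by
  classical
  have hz := (lift_spec (ν := ν) hint (by simp : (0:ℝ) ∈ Icc (0:ℝ) 1) hq₀).1
  have hne : S.Nonempty := by
    by_contra h
    rw [not_nonempty_iff_eq_empty, ← hS, eq_empty_iff_forall_notMem] at h
    have : ∀ i, lift v ν 0 q₀ i = 0 := fun i => not_not.1 (h i)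
    simpa [this] using hz.1.2
  have hspan' : ∀ (a : ℝ × ℝ →L[ℝ] ℝ) (k : ℝ), (∀ i ∈ S, a (v i) = k) → a = 0 := by
    intro a k h
    exact hspan a k fun i hi => h i (hS ▸ hi)
  obtain ⟨θ, κ, H⟩ := exists_cell_functional (ν := ν) hne hspan'
  obtain ⟨h1, h2, -⟩ := H _ hz hS
  obtain ⟨-, -, -, -, -, hC⟩ := exists_affine_coordinates hne hspan'
  refine ⟨θ, κ, h1, h2, hQ.graphSection_mem_lowerCells h1 (hC _ ?_ fun i hi => ?_)⟩
  · exact ((isExposed_graphSection fun _ => hQ.le_of_forall h1).convex hQ.convex).is_linear_image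
      ⟨fun _ _ => rfl, fun _ _ => rfl⟩
  · exact (hQ.mem_snd_graphSection h1 i).2 ((h2 i).2 hi)

/-- A point of the degenerate slice which is supported on `Φ` is a normalization of monomials. -/
theorem exists_eq_mul_faceWeight {z : ι → ℝ} (hz : z ∈ toricSlice v ν 0) {Φ : Set (ℝ × ℝ)}
    (hΦ : ∀ i, v i ∈ Φ ↔ z i ≠ 0) :
    ∃ (η : ℝ × ℝ) (r : ℝ), 0 < r ∧ ∀ i, z i = r * faceWeight v Φ η i := by
  obtain ⟨η, β, h⟩ := exists_exp_eq hz
  refine ⟨η, Real.exp β, Real.exp_pos β, fun i => ?_⟩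
  by_cases hi : v i ∈ Φ
  · rw [faceWeight, indicator_of_mem (show i ∈ v ⁻¹' Φ from hi), h i ((hΦ i).1 hi), add_comm,
      Real.exp_add]
  · rw [faceWeight, indicator_of_notMem (show i ∉ v ⁻¹' Φ from hi), mul_zero]
    exact not_not.1 fun h0 => hi ((hΦ i).2 h0)

include hQ in
/-- The curves of the cells contain all the zeros with spanning supports. -/
theorem IsLowerHull.exists_cellCurve (hint : (interior (convexHull ℝ (range v))).Nonempty)
    (S : Set ι) :
    ∃ C ∈ insert ∅ ((fun F => cellCurve v sg (c 0) (Prod.snd '' F)) '' lowerCells Q),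
      ∀ s, ∀ q ∈ convexHull ℝ (range v), {i | lift v ν 0 q i ≠ 0} = S →
        Spanning v (lift v ν 0 q) → height v ν (fun t i => sg s i * c t i) 0 q = 0 →
        quadRefl s q ∈ C := by
  by_cases hex : ∃ q ∈ convexHull ℝ (range v), {i | lift v ν 0 q i ≠ 0} = S ∧
      Spanning v (lift v ν 0 q)
  · obtain ⟨q₀, hq₀, hS, hspan⟩ := hex
    obtain ⟨θ, κ, h, hT, hF⟩ := hQ.exists_cell hint hq₀ hS hspan
    refine ⟨_, Or.inr ⟨_, hF, rfl⟩, fun s q hq hqS _ h0 => ?_⟩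
    obtain ⟨hz, hzq⟩ := lift_spec (ν := ν) hint (by simp : (0:ℝ) ∈ Icc (0:ℝ) 1) hq
    obtain ⟨η, r, hr, hzr⟩ := exists_eq_mul_faceWeight hz
      (Φ := Prod.snd '' graphSection Q θ κ) fun i => by
        rw [hQ.mem_snd_graphSection h, hT, ← hqS]; rfl
    refine mem_iUnion.2 ⟨s, q, ⟨η, ?_, ?_⟩, rfl⟩
    · conv_lhs => rw [← hzq]
      congr 1
      funext i
      have hsum := hz.1.2
      simp only [hzr, ← Finset.mul_sum] at hsum
      rw [hzr, facePoint, eq_div_iff (right_ne_zero_of_mul (hsum.trans_ne one_ne_zero))]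
      linear_combination faceWeight v (Prod.snd '' graphSection Q θ κ) η i * hsum
    · simp only [height, hzr, mul_assoc, ← Finset.mul_sum] at h0
      exact (mul_eq_zero.1 h0).resolve_left hr.ne'
  · exact ⟨∅, mem_insert _ _, fun s q hq hqS hsp _ => (hex ⟨q, hq, hqS, hsp⟩).elim⟩

end LowerHull

section Nondegeneracy

variable {ι : Type*} [Fintype ι] {v : ι → ℝ × ℝ} {ν : ι → ℝ} {sg : Bool × Bool → ι → ℝ}
  {c : ℝ → ι → ℝ} {Q : Set (ℝ × ℝ × ℝ)}

theorem dense_compl_level {a : ℝ × ℝ →L[ℝ] ℝ} (ha : a ≠ 0) (k : ℝ) :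
    Dense {x : ℝ × ℝ | a x ≠ k} := by
  have : {x : ℝ × ℝ | a x ≠ k} = {x | a x = k}ᶜ := rfl
  rw [this, ← interior_eq_empty_iff_dense_compl]
  by_contra h
  exact ha (functional_eq_zero_of_const (nonempty_iff_ne_empty.2 h) fun x hx => hx)

/-- Every point has arbitrarily close points with spanning support, and the supports of these
contain its support. -/
theorem exists_spanning_support (hint : (interior (convexHull ℝ (range v))).Nonempty)
    {q : ℝ × ℝ} (hq : q ∈ convexHull ℝ (range v)) :
    ∃ q' ∈ convexHull ℝ (range v), Spanning v (lift v ν 0 q') ∧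
      ∀ i, lift v ν 0 q i ≠ 0 → lift v ν 0 q' i ≠ 0 := by
  have h01 : (0:ℝ) ∈ Icc (0:ℝ) 1 := by simp
  have hev : ∀ᶠ q' in 𝓝[convexHull ℝ (range v)] q, ∀ i, lift v ν 0 q i ≠ 0 →
      lift v ν 0 q' i ≠ 0 := by
    refine eventually_all.2 fun i => ?_
    by_cases hi : lift v ν 0 q i = 0
    · simp [hi]
    · exact ((tendsto_pi_nhds.1 (continuousOn_lift_slice (ν := ν) hint h01 q hq) i).eventually_ne
        hi).mono fun q' hq' _ => hq'
  obtain ⟨U, hU, hqU, hUsub⟩ := mem_nhdsWithin.1 hev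
  have hline : ∀ p : ι × ι, ∃ b : ℝ × ℝ →L[ℝ] ℝ, b ≠ 0 ∧
      (v p.1 ≠ v p.2 → b (v p.1) = b (v p.2)) := by
    intro p
    by_cases h : v p.1 = v p.2
    · refine ⟨pairing (1, 0), fun h0 => ?_, fun hne => (hne h).elim⟩
      have := congrArg (fun a : ℝ × ℝ →L[ℝ] ℝ => a (1, 0)) h0
      simp at this
    · refine ⟨pairing (-((v p.2).2 - (v p.1).2), (v p.2).1 - (v p.1).1), fun h0 => h ?_,
        fun _ => ?_⟩
      · have h1 := congrArg (fun a : ℝ × ℝ →L[ℝ] ℝ => a (1, 0)) h0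
        have h2 := congrArg (fun a : ℝ × ℝ →L[ℝ] ℝ => a (0, 1)) h0
        simp at h1 h2
        ext <;> linarith
      · simp only [pairing_apply]; ring
  choose b hb hbv using hline
  have hdense : Dense (⋂ p : ι × ι, {x : ℝ × ℝ | b p x ≠ b p (v p.1)}) :=
    dense_iInter_of_isOpen (fun p => isOpen_ne_fun (b p).continuous continuous_const)
      fun p => dense_compl_level (hb p) _
  have hne : (U ∩ interior (convexHull ℝ (range v))).Nonempty := by
    have : q ∈ closure (interior (convexHull ℝ (range v))) := by
      rw [(convex_convexHull ℝ _).closure_interior_eq_closure_of_nonempty_interior hint]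
      exact subset_closure hq
    exact mem_closure_iff.1 this U hU hqU
  obtain ⟨q', ⟨hq'U, hq'int⟩, hq'⟩ := hdense.inter_open_nonempty _ (hU.inter isOpen_interior) hne
  have hq'h := interior_subset hq'int
  refine ⟨q', hq'h, fun a k hak => ?_, hUsub ⟨hq'U, hq'h⟩⟩
  by_contra ha
  obtain ⟨hz, hzq⟩ := lift_spec (ν := ν) hint h01 hq'h
  have hS : {i | lift v ν 0 q' i ≠ 0}.Nonempty := by
    by_contra h
    rw [not_nonempty_iff_eq_empty, eq_empty_iff_forall_notMem] at h
    have : ∀ i, lift v ν 0 q' i = 0 := fun i => not_not.1 (h i)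
    simpa [this] using hz.1.2
  simp only [mem_iInter, mem_ofPred_eq] at hq'
  rcases collinear_cases hS ha hak with ⟨p, hp, hall⟩ | ⟨i₀, hi₀, i₁, hi₁, hw, hl⟩
  · refine hq' (p, p) ?_
    have := map_mom_of_support (v := v) hz.1 (a := b (p, p)) (k := b (p, p) (v p))
      fun i hi => by rw [hall i hi]
    rwa [hzq] at this
  · obtain ⟨τ, hτ⟩ := hl q' (by rw [← map_mom_of_support hz.1 hak, hzq])
    refine hq' (i₀, i₁) ?_
    rw [hτ, map_add, map_smul, map_sub,
      ← hbv (i₀, i₁) fun h => hw (sub_eq_zero.2 h.symm)]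
    simp

/-- The support of a point of the degenerate slice is the set of points of the configuration in a
face of a cell. -/
theorem IsLowerHull.exists_face (hQ : IsLowerHull Q v ν)
    (hint : (interior (convexHull ℝ (range v))).Nonempty) {q : ℝ × ℝ}
    (hq : q ∈ convexHull ℝ (range v)) :
    ∃ F ∈ lowerCells Q, ∃ Φ : Set (ℝ × ℝ), Φ.Nonempty ∧ IsExposed ℝ (Prod.snd '' F) Φ ∧
      ∀ i, v i ∈ Φ ↔ lift v ν 0 q i ≠ 0 := by
  have h01 : (0:ℝ) ∈ Icc (0:ℝ) 1 := by simp
  obtain ⟨q', hq', hspan, hsub⟩ := exists_spanning_support (ν := ν) hint hq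
  obtain ⟨θ, κ, h, hT, hF⟩ := hQ.exists_cell hint hq' rfl hspan
  simp only [mem_ofPred_eq] at hT
  obtain ⟨hz, hzq⟩ := lift_spec (ν := ν) hint h01 hq
  set z := lift v ν 0 q
  set T := {i | lift v ν 0 q' i ≠ 0}
  set S := {i | z i ≠ 0}
  have hS : S.Nonempty := by
    by_contra h
    rw [not_nonempty_iff_eq_empty, eq_empty_iff_forall_notMem] at h
    have : ∀ i, z i = 0 := fun i => not_not.1 (h i)
    simpa [this] using hz.1.2
  have hface : ∀ α μ : ι → ℝ, (∀ i, 0 ≤ α i) → (∀ i, α i ≠ 0 → i ∈ T) → (∀ i, μ i ≠ 0 → i ∈ S) →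
      ∑ i, α i = ∑ i, μ i → mom v α = mom v μ → ∀ i, α i ≠ 0 → i ∈ S := by
    intro α μ hα hαT hμS hsum hmom
    refine (relation_of_mem_toricSlice hz hα hμS hsum hmom).2.1.1 ?_
    have e : ∀ γ : ι → ℝ, (∀ i, γ i ≠ 0 → i ∈ T) → ∑ i, ν i * γ i =
        ∑ i, (θ.1 * (v i).1 + θ.2 * (v i).2 + κ) * γ i := fun γ hγ =>
      Finset.sum_congr rfl fun i _ => by
        by_cases hi : γ i = 0
        · simp [hi]
        · rw [(hT i).2 (hγ i hi), pairing_apply]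
    rw [e α hαT, e μ fun i hi => hsub i (hμS i hi), sum_affine_eq hsum hmom]
  obtain ⟨a, k, hak, halt⟩ : ∃ (a : ℝ × ℝ →L[ℝ] ℝ) (k : ℝ), (∀ i ∈ S, a (v i) = k) ∧
      ∀ i ∈ T, i ∉ S → a (v i) < k := by
    by_cases hS' : ∀ (a : ℝ × ℝ →L[ℝ] ℝ) (k : ℝ), (∀ i ∈ S, a (v i) = k) → a = 0
    · refine ⟨0, 0, fun _ _ => rfl, fun i hi hiS => (hiS ?_).elim⟩
      classical
      obtain ⟨μ, hμS, hμ1, hμv, -⟩ := exists_affine_coordinates hS hS'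
      exact hface (fun j => if j = i then (1:ℝ) else 0) (μ i) (fun j => by positivity)
        (fun j hj => by
          have : j = i := by by_contra h; simp [h] at hj
          exact this ▸ hi) (hμS i) (by rw [hμ1]; simp) (by rw [hμv, mom_delta]) i (by simp)
    · push Not at hS'
      obtain ⟨a₀, k₀, hak₀, ha₀⟩ := hS'
      exact exists_supporting_functional hS ha₀ hak₀ hface
  have hcell := hQ.mem_snd_graphSection h
  obtain ⟨p, hp⟩ := hS
  have hpF : v p ∈ Prod.snd '' graphSection Q θ κ := (hcell p).2 ((hT p).2 (hsub p hp))
  refine ⟨_, hF, {x ∈ Prod.snd '' graphSection Q θ κ | a x = k}, ⟨v p, hpF, hak p hp⟩, ?_,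
    fun i => ⟨fun hi => ?_, fun hi => ⟨(hcell i).2 ((hT i).2 (hsub i hi)), hak i hi⟩⟩⟩
  · intro _
    refine ⟨a, ?_⟩
    have hle : ∀ x ∈ Prod.snd '' graphSection Q θ κ, a x ≤ k := by
      intro x hx
      obtain ⟨α, hα, rfl, hαT⟩ := hQ.exists_combination h hx
      rw [map_mom]
      calc ∑ i, α i * a (v i) ≤ ∑ i, α i * k := Finset.sum_le_sum fun i _ => by
            by_cases hi : α i = 0
            · simp [hi]
            · refine mul_le_mul_of_nonneg_left ?_ (hα.1 i)
              by_cases hiS : i ∈ S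
              · exact (hak i hiS).le
              · exact (halt i ((hT i).1 (hαT i hi)) hiS).le
        _ = k := by rw [← Finset.sum_mul, hα.2, one_mul]
    ext x
    refine and_congr_right fun hx => ⟨fun hxk y hy => (hle y hy).trans_eq hxk.symm, fun hx' => ?_⟩
    exact (hle x hx).antisymm (by rw [← hak p hp]; exact hx' _ hpF)
  · by_contra hiS
    exact (halt i ((hT i).1 ((hcell i).1 hi.1)) fun h : i ∈ S => h hiS).ne hi.2

/-- Nondegeneracy of the polynomials of the faces of the cells implies that the moment does not
vanish at the zeros at the time `0`. -/
theorem IsLowerHull.mom_ne_zero (hQ : IsLowerHull Q v ν)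
    (hint : (interior (convexHull ℝ (range v))).Nonempty)
    (hnd : ∀ F ∈ lowerCells Q, ∀ Φ : Set (ℝ × ℝ), Φ.Nonempty → IsExposed ℝ (Prod.snd '' F) Φ →
      ∀ s η, ∑ i, faceWeight v Φ η i * (sg s i * c 0 i) = 0 →
        mom v (fun i => faceWeight v Φ η i * (sg s i * c 0 i)) ≠ 0) :
    ∀ s, ∀ q ∈ convexHull ℝ (range v), height v ν (fun t i => sg s i * c t i) 0 q = 0 →
      mom v (fun i => lift v ν 0 q i * (sg s i * c 0 i)) ≠ 0 := by
  intro s q hq h0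
  obtain ⟨F, hF, Φ, hΦ, hΦF, hsupp⟩ := hQ.exists_face hint hq
  obtain ⟨η, r, hr, hz⟩ := exists_eq_mul_faceWeight
    (lift_spec (ν := ν) hint (by simp : (0:ℝ) ∈ Icc (0:ℝ) 1) hq).1 hsupp
  simp only [height, hz, mul_assoc, ← Finset.mul_sum] at h0
  simp only [hz, mul_assoc, mom_mul_left]
  exact smul_ne_zero hr.ne' (hnd F hF Φ hΦ hΦF s η ((mul_eq_zero.1 h0).resolve_left hr.ne'))

end Nondegeneracy

section Patchworking

variable {ι : Type*} [Fintype ι] {v : ι → ℝ × ℝ} {ν : ι → ℝ} {sg : Bool × Bool → ι → ℝ}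
  {c : ℝ → ι → ℝ} {Q : Set (ℝ × ℝ × ℝ)}

theorem gibbs_one_eq_facePoint (ν : ι → ℝ) (η : ℝ × ℝ) :
    gibbs v (fun i => (1:ℝ) ^ ν i) η = facePoint v (convexHull ℝ (range v)) η := by
  have hw : ∀ i, faceWeight v (convexHull ℝ (range v)) η i = Real.exp (pairing η (v i)) :=
    fun i => indicator_of_mem (s := v ⁻¹' _) (subset_convexHull ℝ _ (mem_range_self i)) _
  funext i
  simp only [gibbs, facePoint, hw, Real.one_rpow, one_mul, pairing_apply]

theorem height_mom_facePoint (hint : (interior (convexHull ℝ (range v))).Nonempty)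
    (a : ι → ℝ) (η : ℝ × ℝ) :
    height v ν (fun _ i => a i) 1 (mom v (facePoint v (convexHull ℝ (range v)) η)) = 0 ↔
      ∑ i, faceWeight v (convexHull ℝ (range v)) η i * a i = 0 := by
  have := nonempty_index hint
  have hmem := gibbs_mem_toricSlice (v := v) (ν := ν) one_pos η
  rw [gibbs_one_eq_facePoint] at hmem
  have hpos := sum_faceWeight_pos (v := v) (Λ := convexHull ℝ (range v)) η
    ⟨Classical.arbitrary ι, subset_convexHull ℝ _ (mem_range_self _)⟩
  rw [height, lift_mom zero_le_one hmem]
  simp only [facePoint, div_mul_eq_mul_div, ← Finset.sum_div, div_eq_zero_iff, hpos.ne', or_false]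

theorem interior_zeros_eq_cellCurve (hint : (interior (convexHull ℝ (range v))).Nonempty)
    (ν : ι → ℝ) (a : ι → ℝ) :
    (⋃ s, quadRefl s '' {q ∈ interior (convexHull ℝ (range v)) |
      height v ν (fun _ i => sg s i * a i) 1 q = 0}) =
    cellCurve v sg a (convexHull ℝ (range v)) := by
  have := nonempty_index hint
  refine iUnion_congr fun s => congrArg _ (Set.ext fun q => ⟨?_, ?_⟩)
  · rintro ⟨hq, hq0⟩
    obtain ⟨η, hη⟩ := lift_eq_gibbs (ν := ν) hint one_pos hq
    have hqm : q = mom v (facePoint v (convexHull ℝ (range v)) η) := by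
      rw [← gibbs_one_eq_facePoint ν, ← hη]
      exact (lift_spec hint ⟨zero_le_one, le_rfl⟩ (interior_subset hq)).2.symm
    refine ⟨η, hqm, ?_⟩
    rw [hqm] at hq0
    exact (height_mom_facePoint hint _ η).1 hq0
  · rintro ⟨η, rfl, hη⟩
    refine ⟨?_, (height_mom_facePoint hint _ η).2 hη⟩
    rw [← gibbs_one_eq_facePoint ν]
    exact mom_mem_interior hint (gibbs_mem_toricSlice one_pos η).1
      (gibbs_pos (fun i => by simp) η)

/-- Patchworking of curves given by their coefficients `t ^ ν i * c t i`. -/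
theorem IsLowerHull.exists_autPair (hQ : IsLowerHull Q v ν)
    (hv : ∀ i, 0 ≤ (v i).1 ∧ 0 ≤ (v i).2) (hsg : SignCompat v sg)
    (hint : (interior (convexHull ℝ (range v))).Nonempty) (hc : ContinuousOn c (Icc 0 1))
    (hnd : ∀ F ∈ lowerCells Q, ∀ Φ : Set (ℝ × ℝ), Φ.Nonempty → IsExposed ℝ (Prod.snd '' F) Φ →
      ∀ s η, ∑ i, faceWeight v Φ η i * (sg s i * c 0 i) = 0 →
        mom v (fun i => faceWeight v Φ η i * (sg s i * c 0 i)) ≠ 0) :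
    ∃ t₀ > 0, ∀ t ∈ Ioo 0 t₀, ∃ h g, AutPair (tildeSet (convexHull ℝ (range v)))
      (quadFaces (convexHull ℝ (range v))) h g ∧
      h '' closure (cellCurve v sg (fun i => t ^ ν i * c t i) (convexHull ℝ (range v))) =
        ⋃₀ (closure '' ((fun F => cellCurve v sg (c 0) (Prod.snd '' F)) '' lowerCells Q)) := by
  have hnd' := hQ.mom_ne_zero hint hnd
  obtain ⟨t₀, ht₀, H⟩ := exists_autPair_quadHeight hv hsg hint hc hnd'
  refine ⟨min t₀ 1, lt_min ht₀ one_pos, fun t ht => ?_⟩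
  have ht1 : t ≤ 1 := (ht.2.trans_le (min_le_right _ _)).le
  obtain ⟨⟨k, k', hk, hkz⟩, hsign⟩ := H t ⟨ht.1, ht.2.trans_le (min_le_left _ _)⟩
  have hshift := autPair_quadShift (ν := ν) hint hv one_pos le_rfl ht.1
    (inv_mul_cancel₀ ht.1.ne') (by rwa [one_mul])
  have hmem : tildeSet (convexHull ℝ (range v)) ∈ quadFaces (convexHull ℝ (range v)) := Or.inl rfl
  have hcomp := hshift.comp hmem hk.symm
  refine ⟨_, _, hcomp, ?_⟩
  rw [← zeros_eq_sUnion_closure hv hsg hint hnd'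
    (by rintro _ ⟨F, hF, rfl⟩; exact hQ.cellCurve_subset hv hsg hint hF)
    (hQ.exists_cellCurve hint), ← interior_zeros_eq_cellCurve hint ν,
    closure_interior_zeros hv hsg hint ht.1 ht1 hsign]
  have hz : ∀ x ∈ tildeSet (convexHull ℝ (range v)),
      (quadHeight v ν sg (fun _ i => t ^ ν i * c t i) 1 x = 0 ↔
        quadHeight v ν sg c 0 ((k' ∘ quadShift v ν 1 t) x) = 0) := by
    intro x hx
    have h1 := quadHeight_quadShift hint hv hsg ⟨zero_le_one, le_rfl⟩ ht.1
      (by rwa [one_mul]) c hx (ν := ν)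
    rw [one_mul] at h1
    have hy := hshift.maps _ hmem hx
    rw [← h1, Function.comp_apply, ← hkz _ (hk.maps' _ hmem hy), hk.right_inv _ hy]
  ext x
  constructor
  · rintro ⟨y, ⟨hy, hy0⟩, rfl⟩
    exact ⟨hcomp.maps _ hmem hy, (hz y hy).1 hy0⟩
  · rintro ⟨hx, hx0⟩
    refine ⟨_, ⟨hcomp.maps' _ hmem hx, (hz _ (hcomp.maps' _ hmem hx)).2 ?_⟩,
      hcomp.right_inv x hx⟩
    rwa [hcomp.right_inv x hx]

end Patchworking

section LatticePolynomials

/-- The lattice points of a region. -/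
abbrev LatticePoints (Θ : Set (ℝ × ℝ)) : Type := {p : ℤ × ℤ // latticeEmb p ∈ Θ}

theorem finite_latticePoints {Θ : Set (ℝ × ℝ)} (h : IsCompact Θ) : Finite (LatticePoints Θ) := by
  have he : IsClosedEmbedding latticeEmb :=
    Int.isClosedEmbedding_coe_real.prodMap Int.isClosedEmbedding_coe_real
  exact (he.isCompact_preimage h).finite_of_discrete

/-- The position of a lattice point in the plane. -/
def position (Θ : Set (ℝ × ℝ)) (i : LatticePoints Θ) : ℝ × ℝ := latticeEmb i.1

/-- The exponent of the monomial with given nonnegative integral exponents. -/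
def exponent (p : ℤ × ℤ) : Fin 2 →₀ ℕ :=
  Finsupp.single 0 p.1.toNat + Finsupp.single 1 p.2.toNat

theorem exponent_zero (p : ℤ × ℤ) : exponent p 0 = p.1.toNat := by simp [exponent]

theorem exponent_one (p : ℤ × ℤ) : exponent p 1 = p.2.toNat := by simp [exponent]

/-- The value of a sign-changing monomial at a vertex of the unit square. -/
def monomialSign (s : Bool × Bool) (p : ℤ × ℤ) : ℝ :=
  (if s.1 then (-1) ^ p.1.toNat else 1) * (if s.2 then (-1) ^ p.2.toNat else 1)

/-- The point with logarithmic coordinates `η`. -/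
def expPoint (η : ℝ × ℝ) : ℝ × ℝ := (Real.exp η.1, Real.exp η.2)

theorem exists_quadRefl_expPoint {q : ℝ × ℝ} (hq : q ∈ realTorus) :
    ∃ s η, q = quadRefl s (expPoint η) := by
  refine ⟨quadrant q, (Real.log |q.1|, Real.log |q.2|), ?_⟩
  rw [expPoint, Real.exp_log (abs_pos.2 hq.1), Real.exp_log (abs_pos.2 hq.2)]
  exact (quadRefl_quadrant q).symm

theorem quadRefl_expPoint_mem (s : Bool × Bool) (η : ℝ × ℝ) :
    quadRefl s (expPoint η) ∈ realTorus := by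
  obtain ⟨s₁, s₂⟩ := s
  cases s₁ <;> cases s₂ <;> simp [quadRefl, expPoint, realTorus, (Real.exp_pos _).ne']

theorem natCast_toNat {n : ℤ} (h : 0 ≤ n) : (n.toNat : ℝ) = n := by
  exact_mod_cast Int.toNat_of_nonneg h

theorem position_eq {Θ : Set (ℝ × ℝ)} (hpos : ∀ i : LatticePoints Θ, 0 ≤ i.1.1 ∧ 0 ≤ i.1.2)
    (i : LatticePoints Θ) :
    ((exponent i.1 0 : ℝ), (exponent i.1 1 : ℝ)) = position Θ i := by
  rw [exponent_zero, exponent_one, position, latticeEmb]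
  exact Prod.ext (natCast_toNat (hpos i).1) (natCast_toNat (hpos i).2)

theorem monomial_quadRefl_expPoint (s : Bool × Bool) (η : ℝ × ℝ) {p : ℤ × ℤ}
    (hp : 0 ≤ p.1 ∧ 0 ≤ p.2) :
    (quadRefl s (expPoint η)).1 ^ p.1.toNat * (quadRefl s (expPoint η)).2 ^ p.2.toNat =
      Real.exp (pairing η (latticeEmb p)) * monomialSign s p := by
  have e : Real.exp (pairing η (latticeEmb p)) =
      Real.exp η.1 ^ p.1.toNat * Real.exp η.2 ^ p.2.toNat := by
    rw [← Real.exp_nat_mul, ← Real.exp_nat_mul, ← Real.exp_add, natCast_toNat hp.1,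
      natCast_toNat hp.2, pairing_apply, latticeEmb]
    ring_nf
  rw [e]
  obtain ⟨s₁, s₂⟩ := s
  cases s₁ <;> cases s₂ <;> simp [quadRefl, expPoint, monomialSign] <;>
    (try rw [neg_pow (Real.exp η.1)]) <;> (try rw [neg_pow (Real.exp η.2)]) <;> ring

theorem tildeMomentMap_quadRefl_expPoint (Λ : Set (ℝ × ℝ)) (s : Bool × Bool) (η : ℝ × ℝ) :
    tildeMomentMap Λ (quadRefl s (expPoint η)) = quadRefl s (momentMap Λ (expPoint η)) := by
  have h (x : ℝ) : (-Real.exp x).sign = -1 := Real.sign_of_neg (neg_lt_zero.2 (Real.exp_pos x))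
  have h' (x : ℝ) : (Real.exp x).sign = 1 := Real.sign_of_pos (Real.exp_pos x)
  obtain ⟨s₁, s₂⟩ := s
  cases s₁ <;> cases s₂ <;> simp [tildeMomentMap, quadRefl, expPoint, h, h']

theorem signCompat_monomialSign (Θ : Set (ℝ × ℝ)) :
    SignCompat (position Θ) (fun s i => monomialSign s i.1) := by
  intro i s s' h1 h2
  simp only [monomialSign]
  congr 1
  · by_cases h : i.1.1 = 0
    · simp [h]
    · rw [h1 (by simpa [position, latticeEmb] using h)]
  · by_cases h : i.1.2 = 0
    · simp [h]
    · rw [h2 (by simpa [position, latticeEmb] using h)]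

variable {Θ : Set (ℝ × ℝ)} [Fintype (LatticePoints Θ)]

theorem finsum_latticeEmb {M : Type*} [AddCommMonoid M] {Λ : Set (ℝ × ℝ)} (hΛ : Λ ⊆ Θ)
    (f : ℤ × ℤ → M) :
    ∑ᶠ (p : ℤ × ℤ) (_ : latticeEmb p ∈ Λ), f p =
      ∑ i, (position Θ ⁻¹' Λ).indicator (fun i => f i.1) i := by
  classical
  have h1 : ∀ p : ℤ × ℤ, (∑ᶠ (_ : latticeEmb p ∈ Λ), f p) = (latticeEmb ⁻¹' Λ).indicator f p :=
    fun p => by rw [finsum_eq_if]; rfl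
  rw [finsum_congr h1, finsum_eq_sum_of_support_subset
    (s := Finset.univ.map (Function.Embedding.subtype fun p => latticeEmb p ∈ Θ)),
    Finset.sum_map]
  · rfl
  · intro p hp
    have hp' : latticeEmb p ∈ Λ := (indicator_apply_ne_zero.1 hp).1
    simpa using hΛ hp'

theorem momentMap_expPoint {Λ : Set (ℝ × ℝ)} (hΛ : Λ ⊆ Θ) (η : ℝ × ℝ) :
    momentMap Λ (expPoint η) = mom (position Θ) (facePoint (position Θ) Λ η) := by
  have e : ∀ p : ℤ × ℤ, Real.exp η.1 ^ p.1 * Real.exp η.2 ^ p.2 =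
      Real.exp (pairing η (latticeEmb p)) := fun p => by
    rw [mul_comm, ← Real.rpow_intCast, ← Real.rpow_intCast, ← Real.exp_mul, ← Real.exp_mul,
      ← Real.exp_add, pairing_apply, latticeEmb, add_comm]
  rw [momentMap, finsum_latticeEmb hΛ, finsum_latticeEmb hΛ]
  simp only [expPoint, e]
  rw [mom, Finset.smul_sum]
  refine Finset.sum_congr rfl fun i _ => ?_
  rw [facePoint, div_eq_inv_mul, mul_smul]
  congr 1
  by_cases hi : i ∈ position Θ ⁻¹' Λ
  · rw [faceWeight, indicator_of_mem hi, indicator_of_mem hi]; rfl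
  · rw [faceWeight, indicator_of_notMem hi, indicator_of_notMem hi, zero_smul]

/-- The polynomial with given coefficients. -/
def latticePoly (Θ : Set (ℝ × ℝ)) [Fintype (LatticePoints Θ)] (a : LatticePoints Θ → ℝ) :
    MvPolynomial (Fin 2) ℝ :=
  ∑ i, MvPolynomial.monomial (exponent i.1) (a i)

theorem evalQ_latticePoly (hpos : ∀ i : LatticePoints Θ, 0 ≤ i.1.1 ∧ 0 ≤ i.1.2)
    (a : LatticePoints Θ → ℝ) (s : Bool × Bool) (η : ℝ × ℝ) :
    evalQ (quadRefl s (expPoint η)) (latticePoly Θ a) =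
      ∑ i, Real.exp (pairing η (position Θ i)) * (monomialSign s i.1 * a i) := by
  rw [evalQ, latticePoly, map_sum]
  refine Finset.sum_congr rfl fun i _ => ?_
  rw [position, ← mul_assoc, ← monomial_quadRefl_expPoint s η (hpos i), MvPolynomial.eval_monomial,
    Finsupp.prod_fintype _ _ (fun _ => pow_zero _), Fin.prod_univ_two, exponent_zero, exponent_one]
  simp [mul_comm]

theorem X_mul_pderiv_latticePoly (a : LatticePoints Θ → ℝ) (k : Fin 2) :
    MvPolynomial.X k * MvPolynomial.pderiv k (latticePoly Θ a) =
      latticePoly Θ fun i => exponent i.1 k * a i := by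
  rw [latticePoly, latticePoly, map_sum, Finset.mul_sum]
  refine Finset.sum_congr rfl fun i _ => ?_
  rw [MvPolynomial.X_mul_pderiv_monomial, MvPolynomial.smul_monomial, nsmul_eq_mul]

theorem coeff_trunc (Q : MvPolynomial (Fin 2) ℝ) (Φ : Set (ℝ × ℝ)) (m : Fin 2 →₀ ℕ)
    [Decidable (((m 0 : ℝ), (m 1 : ℝ)) ∈ Φ)] :
    MvPolynomial.coeff m (trunc Q Φ) =
      if ((m 0 : ℝ), (m 1 : ℝ)) ∈ Φ then MvPolynomial.coeff m Q else 0 := by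
  classical
  have h1 : ∀ d : Fin 2 →₀ ℕ, (∑ᶠ (_ : ((d 0 : ℝ), (d 1 : ℝ)) ∈ Φ),
      MvPolynomial.monomial d (MvPolynomial.coeff d Q)) =
      MvPolynomial.monomial d
        (if ((d 0 : ℝ), (d 1 : ℝ)) ∈ Φ then MvPolynomial.coeff d Q else 0) := fun d => by
    rw [finsum_eq_if]; split_ifs <;> simp
  rw [trunc, finsum_congr h1, finsum_eq_sum_of_support_subset (s := Q.support)]
  · rw [MvPolynomial.coeff_sum]
    simp only [MvPolynomial.coeff_monomial, Finset.sum_ite_eq']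
    split_ifs with h2 h3 h3
    · rfl
    · rfl
    · exact (MvPolynomial.notMem_support_iff.1 h2).symm
    · rfl
  · intro d hd
    by_contra hd'
    rw [Finset.mem_coe, MvPolynomial.notMem_support_iff] at hd'
    simp [hd'] at hd

theorem trunc_latticePoly (hpos : ∀ i : LatticePoints Θ, 0 ≤ i.1.1 ∧ 0 ≤ i.1.2)
    (a : LatticePoints Θ → ℝ) (Φ : Set (ℝ × ℝ)) :
    trunc (latticePoly Θ a) Φ = latticePoly Θ ((position Θ ⁻¹' Φ).indicator a) := by
  classical
  ext m
  rw [coeff_trunc, latticePoly, latticePoly, MvPolynomial.coeff_sum, MvPolynomial.coeff_sum]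
  simp only [MvPolynomial.coeff_monomial]
  have hterm : ∀ i : LatticePoints Θ, exponent i.1 = m → ((m 0 : ℝ), (m 1 : ℝ)) = position Θ i := by
    rintro i rfl
    exact position_eq hpos i
  split_ifs with hm
  · refine Finset.sum_congr rfl fun i _ => ite_congr rfl (fun h => ?_) fun _ => rfl
    rw [indicator_of_mem (by rwa [mem_preimage, ← hterm i h])]
  · refine (Finset.sum_eq_zero fun i _ => ite_eq_right_iff.2 fun h => ?_).symm
    rw [indicator_of_notMem (by rwa [mem_preimage, ← hterm i h])]

/-- A polynomial with nonnegative exponents is nondegenerate only if no face has a curve of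
zeros at which both logarithmic derivatives vanish. -/
theorem mom_ne_zero_of_realNonDeg (hpos : ∀ i : LatticePoints Θ, 0 ≤ i.1.1 ∧ 0 ≤ i.1.2)
    {a b : LatticePoints Θ → ℝ} {Λ Φ : Set (ℝ × ℝ)} (h : RealNonDeg (latticePoly Θ a) Λ)
    (hab : ∀ i, position Θ i ∈ Λ → a i = b i)
    (hΦ : Φ.Nonempty) (hΛΦ : IsExposed ℝ Λ Φ) (s : Bool × Bool) (η : ℝ × ℝ)
    (h0 : ∑ i, faceWeight (position Θ) Φ η i * (monomialSign s i.1 * b i) = 0) :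
    mom (position Θ) (fun i => faceWeight (position Θ) Φ η i * (monomialSign s i.1 * b i)) ≠ 0 := by
  have hterm : ∀ i, Real.exp (pairing η (position Θ i)) *
      (monomialSign s i.1 * (position Θ ⁻¹' Φ).indicator a i) =
      faceWeight (position Θ) Φ η i * (monomialSign s i.1 * b i) := by
    intro i
    by_cases hi : i ∈ position Θ ⁻¹' Φ
    · rw [faceWeight, indicator_of_mem hi, indicator_of_mem hi, hab i (hΛΦ.subset hi)]
    · rw [faceWeight, indicator_of_notMem hi, indicator_of_notMem hi]; simp
  have heval : ∀ k : Fin 2, evalQ (quadRefl s (expPoint η))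
      (MvPolynomial.X k * MvPolynomial.pderiv k (trunc (latticePoly Θ a) Φ)) =
      ∑ i, (exponent i.1 k : ℝ) * (faceWeight (position Θ) Φ η i * (monomialSign s i.1 * b i)) := by
    intro k
    rw [trunc_latticePoly hpos, X_mul_pderiv_latticePoly, evalQ_latticePoly hpos]
    refine Finset.sum_congr rfl fun i _ => ?_
    rw [← hterm]; ring
  intro hm
  have hmul : ∀ k : Fin 2, (∑ i, (exponent i.1 k : ℝ) *
      (faceWeight (position Θ) Φ η i * (monomialSign s i.1 * b i)) = 0) →
      evalQ (quadRefl s (expPoint η)) (MvPolynomial.pderiv k (trunc (latticePoly Θ a) Φ)) = 0 := by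
    intro k hk
    rw [← heval, evalQ, map_mul, MvPolynomial.eval_X, mul_eq_zero] at hk
    refine hk.resolve_left ?_
    have := quadRefl_expPoint_mem s η
    fin_cases k
    · exact this.1
    · exact this.2
  have hfst := congrArg Prod.fst hm
  have hsnd := congrArg Prod.snd hm
  rw [mom_fst] at hfst
  rw [mom_snd] at hsnd
  refine (h Φ hΦ hΛΦ _ (quadRefl_expPoint_mem s η) ?_).elim
    (fun h' => h' (hmul 0 ?_)) (fun h' => h' (hmul 1 ?_))
  · rw [trunc_latticePoly hpos, evalQ_latticePoly hpos, ← h0]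
    exact Finset.sum_congr rfl fun i _ => hterm i
  · rw [← Prod.fst_zero (M := ℝ) (N := ℝ), ← hfst]
    refine Finset.sum_congr rfl fun i _ => ?_
    rw [← congrArg Prod.fst (position_eq hpos i), mul_comm]
  · rw [← Prod.snd_zero (M := ℝ) (N := ℝ), ← hsnd]
    refine Finset.sum_congr rfl fun i _ => ?_
    rw [← congrArg Prod.snd (position_eq hpos i), mul_comm]

theorem chart_latticePoly (hpos : ∀ i : LatticePoints Θ, 0 ≤ i.1.1 ∧ 0 ≤ i.1.2)
    {a b : LatticePoints Θ → ℝ} {Λ : Set (ℝ × ℝ)} (hΛ : Λ ⊆ Θ)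
    (hab : (position Θ ⁻¹' Λ).indicator b = a) :
    chart Λ (latticePoly Θ a) =
      closure (cellCurve (position Θ) (fun s i => monomialSign s i.1) b Λ) := by
  have hterm : ∀ s η, evalQ (quadRefl s (expPoint η)) (latticePoly Θ a) =
      ∑ i, faceWeight (position Θ) Λ η i * (monomialSign s i.1 * b i) := by
    intro s η
    rw [evalQ_latticePoly hpos, ← hab]
    refine Finset.sum_congr rfl fun i _ => ?_
    by_cases hi : i ∈ position Θ ⁻¹' Λ
    · rw [faceWeight, indicator_of_mem hi, indicator_of_mem hi]
    · rw [faceWeight, indicator_of_notMem hi, indicator_of_notMem hi]; simp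
  rw [chart]
  congr 1
  ext x
  simp only [cellCurve, mem_iUnion]
  constructor
  · rintro ⟨q, ⟨hq, hq0⟩, rfl⟩
    obtain ⟨s, η, rfl⟩ := exists_quadRefl_expPoint hq
    rw [tildeMomentMap_quadRefl_expPoint, momentMap_expPoint hΛ]
    exact ⟨s, mem_image_of_mem _ ⟨η, rfl, (hterm s η).symm.trans hq0⟩⟩
  · rintro ⟨s, _, ⟨η, rfl, h0⟩, rfl⟩
    refine ⟨_, ⟨quadRefl_expPoint_mem s η, (hterm s η).trans h0⟩, ?_⟩
    rw [tildeMomentMap_quadRefl_expPoint, momentMap_expPoint hΛ]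

end LatticePolynomials

section NewtonPolytope

variable {P : MvPolynomial (Fin 3) ℝ} {Θ : Set (ℝ × ℝ)}

/-- The exponents of the last two variables. -/
def lastExponents (d : Fin 3 →₀ ℕ) : ℤ × ℤ := (d 1, d 2)

theorem exponent_lastExponents (d : Fin 3 →₀ ℕ) :
    exponent (lastExponents d) = Finsupp.single 0 (d 1) + Finsupp.single 1 (d 2) := by
  simp [exponent, lastExponents]

theorem exponent_injOn {p q : ℤ × ℤ} (hp : 0 ≤ p.1 ∧ 0 ≤ p.2) (hq : 0 ≤ q.1 ∧ 0 ≤ q.2)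
    (h : exponent p = exponent q) : p = q := by
  have h0 := DFunLike.congr_fun h 0
  have h1 := DFunLike.congr_fun h 1
  rw [exponent_zero, exponent_zero] at h0
  rw [exponent_one, exponent_one] at h1
  ext <;> omega

theorem expEmb3_eq (d : Fin 3 →₀ ℕ) :
    expEmb3 d = ((d 0 : ℝ), latticeEmb (lastExponents d)) := by
  simp [expEmb3, latticeEmb, lastExponents]

theorem eq_of_lastExponents {d e : Fin 3 →₀ ℕ} (h0 : d 0 = e 0)
    (h : lastExponents d = lastExponents e) : d = e := by
  simp only [lastExponents, Prod.mk.injEq, Nat.cast_inj] at h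
  ext k
  fin_cases k
  exacts [h0, h.1, h.2]

theorem substT_eq_sum (P : MvPolynomial (Fin 3) ℝ) (t : ℝ) :
    substT P t = ∑ d ∈ P.support,
      MvPolynomial.monomial (exponent (lastExponents d)) (MvPolynomial.coeff d P * t ^ d 0) := by
  simp only [exponent_lastExponents]
  refine finsum_eq_sum_of_support_subset _ fun d hd => ?_
  by_contra hd'
  rw [Finset.mem_coe, MvPolynomial.notMem_support_iff] at hd'
  simp [hd'] at hd

open Classical in
theorem truncAtOne_eq_sum (P : MvPolynomial (Fin 3) ℝ) (F : Set (ℝ × ℝ × ℝ)) :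
    truncAtOne P F = ∑ d ∈ P.support, MvPolynomial.monomial (exponent (lastExponents d))
      (if expEmb3 d ∈ F then MvPolynomial.coeff d P else 0) := by
  have h1 : ∀ d : Fin 3 →₀ ℕ, (∑ᶠ (_ : expEmb3 d ∈ F),
      MvPolynomial.monomial (Finsupp.single (0 : Fin 2) (d 1) + Finsupp.single 1 (d 2))
        (MvPolynomial.coeff d P)) = MvPolynomial.monomial (exponent (lastExponents d))
        (if expEmb3 d ∈ F then MvPolynomial.coeff d P else 0) := fun d => by
    rw [finsum_eq_if, exponent_lastExponents]; split_ifs <;> simp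
  rw [truncAtOne, finsum_congr h1]
  refine finsum_eq_sum_of_support_subset _ fun d hd => ?_
  by_contra hd'
  rw [Finset.mem_coe, MvPolynomial.notMem_support_iff] at hd'
  simp [hd'] at hd

theorem sum_monomial_eq_latticePoly [Fintype (LatticePoints Θ)]
    (hP : ∀ d ∈ P.support, latticeEmb (lastExponents d) ∈ Θ) (b : (Fin 3 →₀ ℕ) → ℝ) :
    ∑ d ∈ P.support, MvPolynomial.monomial (exponent (lastExponents d)) (b d) =
      latticePoly Θ fun i => ∑ d ∈ P.support with lastExponents d = i.1, b d := by
  classical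
  simp only [latticePoly, map_sum, Finset.sum_filter]
  rw [Finset.sum_comm]
  refine Finset.sum_congr rfl fun d hd => ?_
  rw [Finset.sum_eq_single ⟨lastExponents d, hP d hd⟩]
  · simp
  · intro i _ hi
    rw [if_neg fun h => hi (Subtype.ext h.symm), map_zero]
  · exact fun h => (h (Finset.mem_univ _)).elim

theorem exists_mem_support_substT {d : Fin 3 →₀ ℕ} (hd : d ∈ P.support) {t₁ : ℝ} (ht₁ : 0 < t₁) :
    ∃ t ∈ Ioo 0 t₁, exponent (lastExponents d) ∈ (substT P t).support := by
  classical
  let R : Polynomial ℝ := ∑ e ∈ P.support with lastExponents e = lastExponents d,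
    Polynomial.monomial (e 0) (MvPolynomial.coeff e P)
  have hR : R ≠ 0 := fun h => by
    have h2 := congrArg (Polynomial.coeff · (d 0)) h
    simp only [R, Polynomial.finsetSum_coeff, Polynomial.coeff_monomial, Polynomial.coeff_zero]
      at h2
    rw [Finset.sum_eq_single_of_mem d (by simp [MvPolynomial.mem_support_iff.1 hd]), if_pos rfl]
      at h2
    · exact MvPolynomial.mem_support_iff.1 hd h2
    · intro e he hed
      exact if_neg fun h0 => hed (eq_of_lastExponents h0 (Finset.mem_filter.1 he).2)
  have hroot : ∃ t ∈ Ioo 0 t₁, R.eval t ≠ 0 := by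
    by_contra! hall
    exact hR (Polynomial.eq_zero_of_infinite_isRoot R
      ((Ioo_infinite ht₁).mono fun t ht => hall t ht))
  obtain ⟨t, ht, hne⟩ := hroot
  refine ⟨t, ht, MvPolynomial.mem_support_iff.2 ?_⟩
  convert hne using 1
  rw [substT_eq_sum, MvPolynomial.coeff_sum, Polynomial.eval_finsetSum, Finset.sum_filter]
  refine Finset.sum_congr rfl fun e _ => ?_
  rw [MvPolynomial.coeff_monomial, Polynomial.eval_monomial]
  refine if_congr ⟨exponent_injOn ?_ ?_, fun h => by rw [h]⟩ rfl rfl <;>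
    simp [lastExponents]

theorem exists_of_mem_support_substT {t : ℝ} {m : Fin 2 →₀ ℕ} (hm : m ∈ (substT P t).support) :
    ∃ d ∈ P.support, ((m 0 : ℝ), (m 1 : ℝ)) = latticeEmb (lastExponents d) := by
  classical
  rw [substT_eq_sum, MvPolynomial.mem_support_iff, MvPolynomial.coeff_sum] at hm
  obtain ⟨d, hd, hd'⟩ := Finset.exists_ne_zero_of_sum_ne_zero hm
  refine ⟨d, hd, ?_⟩
  rw [MvPolynomial.coeff_monomial] at hd'
  rw [← (ite_ne_right_iff.1 hd').1, exponent_lastExponents]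
  simp [latticeEmb, lastExponents]

theorem isCompact_newtonPolygon (Q : MvPolynomial (Fin 2) ℝ) : IsCompact (newtonPolygon Q) :=
  (Q.support.finite_toSet.image _).isCompact_convexHull (𝕜 := ℝ)

theorem nonneg_of_mem_newtonPolygon {Q : MvPolynomial (Fin 2) ℝ} {x : ℝ × ℝ}
    (hx : x ∈ newtonPolygon Q) : 0 ≤ x.1 ∧ 0 ≤ x.2 := by
  have hc : Convex ℝ {x : ℝ × ℝ | 0 ≤ x.1 ∧ 0 ≤ x.2} :=
    (convex_Ici (0 : ℝ × ℝ))
  refine convexHull_min ?_ hc hx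
  rintro _ ⟨d, _, rfl⟩
  exact ⟨Nat.cast_nonneg _, Nat.cast_nonneg _⟩

theorem convexHull_range_position {Q : MvPolynomial (Fin 2) ℝ} (hQ : newtonPolygon Q = Θ) :
    convexHull ℝ (range (position Θ)) = Θ := by
  have hconv : Convex ℝ Θ := hQ ▸ convex_convexHull ℝ _
  refine (convexHull_min (range_subset_iff.2 fun i => i.2) hconv).antisymm ?_
  rw [← hQ]
  refine convexHull_mono ?_
  rintro _ ⟨d, hd, rfl⟩
  have hd' : latticeEmb ((d 0 : ℤ), (d 1 : ℤ)) ∈ newtonPolygon Q :=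
    subset_convexHull ℝ _ ⟨d, hd, by simp [latticeEmb]⟩
  exact ⟨⟨_, hd'⟩, by simp [position, latticeEmb]⟩

theorem snd_newtonPolytope3 (P : MvPolynomial (Fin 3) ℝ) :
    Prod.snd '' newtonPolytope3 P =
      convexHull ℝ ((fun d => latticeEmb (lastExponents d)) '' (P.support : Set (Fin 3 →₀ ℕ))) := by
  have := (LinearMap.snd ℝ ℝ (ℝ × ℝ)).image_convexHull (expEmb3 '' (P.support : Set (Fin 3 →₀ ℕ)))
  rw [newtonPolytope3]
  refine this.trans ?_
  rw [image_image]
  simp only [LinearMap.snd_apply, expEmb3_eq]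

/-- The lowest height of the Newton polytope over a lattice point. -/
def lowestHeight (P : MvPolynomial (Fin 3) ℝ) (Θ : Set (ℝ × ℝ)) (i : LatticePoints Θ) : ℝ :=
  sInf {k | (k, position Θ i) ∈ newtonPolytope3 P}

theorem isCompact_newtonPolytope3 (P : MvPolynomial (Fin 3) ℝ) : IsCompact (newtonPolytope3 P) :=
  (P.support.finite_toSet.image _).isCompact_convexHull (𝕜 := ℝ)

theorem isLowerHull_newtonPolytope3 [Fintype (LatticePoints Θ)]
    (hP : Prod.snd '' newtonPolytope3 P = Θ) :
    IsLowerHull (newtonPolytope3 P) (position Θ) (lowestHeight P Θ) := by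
  classical
  have hK := isCompact_newtonPolytope3 P
  have hsec : ∀ i : LatticePoints Θ, IsCompact {k | (k, position Θ i) ∈ newtonPolytope3 P} := by
    intro i
    have : {k | (k, position Θ i) ∈ newtonPolytope3 P} =
        Prod.fst '' (newtonPolytope3 P ∩ Prod.snd ⁻¹' {position Θ i}) := by
      ext k
      constructor
      · exact fun hk => ⟨(k, position Θ i), ⟨hk, rfl⟩, rfl⟩
      · rintro ⟨⟨k', y⟩, ⟨h1, h2⟩, rfl⟩
        obtain rfl : y = position Θ i := h2
        exact h1
    rw [this]
    exact (hK.inter_right (isClosed_singleton.preimage continuous_snd)).image continuous_fst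
  have hle : ∀ (i : LatticePoints Θ) k, (k, position Θ i) ∈ newtonPolytope3 P →
      lowestHeight P Θ i ≤ k := fun i k hk => csInf_le (hsec i).bddBelow hk
  refine ⟨hK, convex_convexHull ℝ _, fun i => ?_, hle, fun x hx => ?_⟩
  · refine (hsec i).sInf_mem ?_
    obtain ⟨⟨k, y⟩, hy, hyi⟩ : position Θ i ∈ Prod.snd '' newtonPolytope3 P := hP ▸ i.2
    obtain rfl : y = position Θ i := hyi
    exact ⟨k, hy⟩
  · have hconv : Convex ℝ {x : ℝ × ℝ × ℝ | ∃ α ∈ stdSimplex ℝ (LatticePoints Θ),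
        mom (position Θ) α = x.2 ∧ ∑ i, α i * lowestHeight P Θ i ≤ x.1} := by
      rintro x ⟨α, hα, hx, hx'⟩ y ⟨β, hβ, hy, hy'⟩ a b ha hb hab
      refine ⟨a • α + b • β, convex_stdSimplex ℝ _ hα hβ ha hb hab, ?_, ?_⟩
      · rw [Prod.snd_add, Prod.smul_snd, Prod.smul_snd, ← hx, ← hy]
        simp only [mom, Pi.add_apply, Pi.smul_apply, smul_eq_mul, add_smul, mul_smul,
          Finset.sum_add_distrib, Finset.smul_sum]
      · have e : ∑ i, (a • α + b • β) i * lowestHeight P Θ i =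
            a * ∑ i, α i * lowestHeight P Θ i + b * ∑ i, β i * lowestHeight P Θ i := by
          simp only [Pi.add_apply, Pi.smul_apply, smul_eq_mul, add_mul,
            Finset.sum_add_distrib, Finset.mul_sum, mul_assoc]
        rw [e, Prod.fst_add, Prod.smul_fst, Prod.smul_fst, smul_eq_mul, smul_eq_mul]
        gcongr
    refine convexHull_min ?_ hconv hx
    rintro _ ⟨d, hd, rfl⟩
    have hmem : expEmb3 d ∈ newtonPolytope3 P := subset_convexHull ℝ _ ⟨d, hd, rfl⟩
    have hd' : latticeEmb (lastExponents d) ∈ Θ := by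
      rw [← hP, expEmb3_eq] at *
      exact ⟨_, hmem, rfl⟩
    refine ⟨Pi.single ⟨_, hd'⟩ 1, single_mem_stdSimplex ℝ _, ?_, ?_⟩
    · rw [expEmb3_eq, mom, Finset.sum_eq_single ⟨_, hd'⟩]
      · rw [Pi.single_eq_same, one_smul]; rfl
      · intro i _ hi
        rw [Pi.single_eq_of_ne hi, zero_smul]
      · exact fun h => (h (Finset.mem_univ _)).elim
    · rw [Finset.sum_eq_single ⟨_, hd'⟩]
      · rw [Pi.single_eq_same, one_mul]
        refine hle ⟨_, hd'⟩ _ ?_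
        rw [expEmb3_eq] at hmem ⊢
        exact hmem
      · intro i _ hi
        rw [Pi.single_eq_of_ne hi, zero_mul]
      · exact fun h => (h (Finset.mem_univ _)).elim

end NewtonPolytope

section Interface

variable {P : MvPolynomial (Fin 3) ℝ} {Θ : Set (ℝ × ℝ)}

/-- The coefficients of `substT P t` after division by the lowest powers of `t`. -/
def reducedCoeff (P : MvPolynomial (Fin 3) ℝ) (Θ : Set (ℝ × ℝ)) (t : ℝ) (i : LatticePoints Θ) : ℝ :=
  ∑ d ∈ P.support with lastExponents d = i.1,
    MvPolynomial.coeff d P * t ^ ((d 0 : ℝ) - lowestHeight P Θ i)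

theorem mem_of_lastExponents_eq {d : Fin 3 →₀ ℕ} (hd : d ∈ P.support) {i : LatticePoints Θ}
    (h : lastExponents d = i.1) : expEmb3 d = ((d 0 : ℝ), position Θ i) ∧
      ((d 0 : ℝ), position Θ i) ∈ newtonPolytope3 P := by
  have e : expEmb3 d = ((d 0 : ℝ), position Θ i) := by rw [expEmb3_eq, h]; rfl
  exact ⟨e, e ▸ subset_convexHull ℝ _ ⟨d, hd, rfl⟩⟩

theorem continuous_reducedCoeff [Fintype (LatticePoints Θ)]
    (hQ : IsLowerHull (newtonPolytope3 P) (position Θ) (lowestHeight P Θ)) :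
    Continuous (reducedCoeff P Θ) := by
  refine continuous_pi fun i => continuous_finsetSum _ fun d hd => continuous_const.mul ?_
  obtain ⟨hd, hdi⟩ := Finset.mem_filter.1 hd
  exact Real.continuous_rpow_const (sub_nonneg.2 (hQ.le i _ (mem_of_lastExponents_eq hd hdi).2))

theorem substT_eq_latticePoly [Fintype (LatticePoints Θ)]
    (hP : ∀ d ∈ P.support, latticeEmb (lastExponents d) ∈ Θ) {t : ℝ} (ht : 0 < t) :
    substT P t = latticePoly Θ fun i => t ^ lowestHeight P Θ i * reducedCoeff P Θ t i := by
  rw [substT_eq_sum, sum_monomial_eq_latticePoly hP]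
  congr 1
  funext i
  rw [reducedCoeff, Finset.mul_sum]
  refine Finset.sum_congr rfl fun d _ => ?_
  rw [mul_left_comm, ← Real.rpow_add ht, add_sub_cancel, Real.rpow_natCast]

theorem truncAtOne_eq_latticePoly [Fintype (LatticePoints Θ)]
    (hP : ∀ d ∈ P.support, latticeEmb (lastExponents d) ∈ Θ)
    (hQ : IsLowerHull (newtonPolytope3 P) (position Θ) (lowestHeight P Θ))
    {F : Set (ℝ × ℝ × ℝ)} (hF : F ∈ lowerCells (newtonPolytope3 P)) :
    truncAtOne P F =
      latticePoly Θ ((position Θ ⁻¹' (Prod.snd '' F)).indicator (reducedCoeff P Θ 0)) := by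
  classical
  obtain ⟨θ, κ, hθ, rfl⟩ := hQ.exists_support hF
  rw [truncAtOne_eq_sum, sum_monomial_eq_latticePoly hP]
  congr 1
  funext i
  have hmem : ∀ d ∈ P.support, lastExponents d = i.1 →
      (expEmb3 d ∈ graphSection (newtonPolytope3 P) θ κ ↔
        (d 0 : ℝ) = pairing θ (position Θ i) + κ) := by
    intro d hd hdi
    obtain ⟨e, h⟩ := mem_of_lastExponents_eq hd hdi
    rw [e]
    exact ⟨fun h' => h'.2, fun h' => ⟨h, h'⟩⟩
  by_cases hi : i ∈ position Θ ⁻¹' (Prod.snd '' graphSection (newtonPolytope3 P) θ κ)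
  · rw [indicator_of_mem hi, reducedCoeff]
    have hν := (hQ.mem_snd_graphSection hθ i).1 hi
    refine Finset.sum_congr rfl fun d hd => ?_
    obtain ⟨hd, hdi⟩ := Finset.mem_filter.1 hd
    split_ifs with h
    · rw [hν, (hmem d hd hdi).1 h, sub_self, Real.rpow_zero, mul_one]
    · rw [Real.zero_rpow, mul_zero]
      rw [hν]
      exact sub_ne_zero.2 fun h' => h ((hmem d hd hdi).2 h')
  · rw [indicator_of_notMem hi]
    refine Finset.sum_eq_zero fun d hd => if_neg fun h => hi ?_
    obtain ⟨hd, hdi⟩ := Finset.mem_filter.1 hd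
    rw [mem_preimage, hQ.mem_snd_graphSection hθ]
    refine (hθ i).antisymm' ?_
    rw [← (hmem d hd hdi).1 h]
    exact hQ.le i _ (mem_of_lastExponents_eq hd hdi).2

end Interface

end Viro

/-- generalized Viro patchworking: if the Newton polygon of `P_t` equals the fixed
two-dimensional polygon `Θ` for all small `t > 0`, and for every face `Λ̂` of `Θ̂` contained in
the lower part `Θ̂_c` the polynomial `P^Λ̂_1` is real nondegenerate with respect to the projection
`Λ` of `Λ̂`, then for all small `t > 0` there is a homeomorphism of `Θ̃` onto itself preserving
each reflected copy of each face of `Θ` and carrying `Ch_Θ(P_t)` onto the union of the charts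
`Ch_Λ(P^Λ̂_1)` over the two-dimensional cells `Λ` of the induced subdivision of `Θ`. -/
theorem viro_patchworking
    (P : MvPolynomial (Fin 3) ℝ) (Θ : Set (ℝ × ℝ)) (t₁ : ℝ) (ht₁ : 0 < t₁)
    (hNP : ∀ t : ℝ, 0 < t → t < t₁ → newtonPolygon (substT P t) = Θ)
    (hdim : (interior Θ).Nonempty)
    (hnd : ∀ F : Set (ℝ × ℝ × ℝ), IsExposed ℝ (newtonPolytope3 P) F → F ⊆ lowerPart P →
      RealNonDeg (truncAtOne P F) (proj23 '' F)) :
    ∃ t₀ : ℝ, 0 < t₀ ∧ ∀ t : ℝ, 0 < t → t < t₀ →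
      ∃ h g : ℝ × ℝ → ℝ × ℝ,
        ContinuousOn h (tildeSet Θ) ∧ ContinuousOn g (tildeSet Θ) ∧
        (∀ p ∈ tildeSet Θ, h p ∈ tildeSet Θ ∧ g (h p) = p) ∧
        (∀ p ∈ tildeSet Θ, g p ∈ tildeSet Θ ∧ h (g p) = p) ∧
        (∀ Φ : Set (ℝ × ℝ), IsExposed ℝ Θ Φ → ∀ s : Bool × Bool,
          h '' (quadRefl s '' Φ) = quadRefl s '' Φ) ∧
        h '' chart Θ (substT P t) =
          ⋃₀ {C : Set (ℝ × ℝ) | ∃ F : Set (ℝ × ℝ × ℝ),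
                IsExposed ℝ (newtonPolytope3 P) F ∧ F ⊆ lowerPart P ∧
                (interior (proj23 '' F)).Nonempty ∧
                C = chart (proj23 '' F) (truncAtOne P F)} := by
  open Viro Set in
  have hhalf := hNP (t₁ / 2) (half_pos ht₁) (half_lt_self ht₁)
  have hΘc : IsCompact Θ := hhalf ▸ isCompact_newtonPolygon _
  have hΘconv : Convex ℝ Θ := hhalf ▸ convex_convexHull ℝ _
  have hnonneg : ∀ x ∈ Θ, 0 ≤ x.1 ∧ 0 ≤ x.2 := fun x hx =>
    nonneg_of_mem_newtonPolygon (hhalf.symm ▸ hx)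
  have := finite_latticePoints hΘc
  have := Fintype.ofFinite (LatticePoints Θ)
  have hP : ∀ d ∈ P.support, latticeEmb (lastExponents d) ∈ Θ := by
    intro d hd
    obtain ⟨t, ht, hmem⟩ := exists_mem_support_substT hd ht₁
    rw [← hNP t ht.1 ht.2]
    exact subset_convexHull ℝ _ ⟨_, hmem, by simp [exponent, lastExponents, latticeEmb]⟩
  have hsnd : Prod.snd '' newtonPolytope3 P = Θ := by
    rw [snd_newtonPolytope3]
    refine (convexHull_min (image_subset_iff.2 hP) hΘconv).antisymm ?_
    rw [← hhalf]
    refine convexHull_mono ?_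
    rintro _ ⟨m, hm, rfl⟩
    obtain ⟨d, hd, he⟩ := exists_of_mem_support_substT hm
    exact ⟨d, hd, he.symm⟩
  have hQ := isLowerHull_newtonPolytope3 hsnd
  have hhull := convexHull_range_position hhalf
  have hpos : ∀ i : LatticePoints Θ, 0 ≤ i.1.1 ∧ 0 ≤ i.1.2 := fun i =>
    ⟨Int.cast_nonneg_iff.1 (hnonneg _ i.2).1, Int.cast_nonneg_iff.1 (hnonneg _ i.2).2⟩
  have hproj : proj23 = Prod.snd := rfl
  have hlower : lowerPart P = lowerFaces (newtonPolytope3 P) := rfl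
  rw [hproj, hlower] at *
  have hcell : ∀ F ∈ lowerCells (newtonPolytope3 P), ∀ Φ : Set (ℝ × ℝ), Φ.Nonempty →
      IsExposed ℝ (Prod.snd '' F) Φ → ∀ s η,
      ∑ i, faceWeight (position Θ) Φ η i * (monomialSign s i.1 * reducedCoeff P Θ 0 i) = 0 →
      mom (position Θ) (fun i => faceWeight (position Θ) Φ η i *
        (monomialSign s i.1 * reducedCoeff P Θ 0 i)) ≠ 0 := by
    intro F hF Φ hΦ hexp s η
    have hndF := hnd F hF.1 hF.2.1
    rw [truncAtOne_eq_latticePoly hP hQ hF] at hndF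
    exact mom_ne_zero_of_realNonDeg hpos hndF (fun i hi =>
      indicator_of_mem (s := position Θ ⁻¹' (Prod.snd '' F)) hi _)
      hΦ hexp s η
  obtain ⟨t₀, ht₀, H⟩ := hQ.exists_autPair (fun i => hnonneg _ i.2) (signCompat_monomialSign Θ)
    (by rwa [hhull]) (continuous_reducedCoeff hQ).continuousOn hcell
  refine ⟨t₀, ht₀, fun t ht htt => ?_⟩
  obtain ⟨h, g, hA, himage⟩ := H t ⟨ht, htt⟩
  rw [hhull] at hA himage
  have hmem : tildeSet Θ ∈ quadFaces Θ := Or.inl rfl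
  refine ⟨h, g, hA.cont, hA.cont', fun p hp => ⟨hA.maps _ hmem hp, hA.left_inv p hp⟩,
    fun p hp => ⟨hA.maps' _ hmem hp, hA.right_inv p hp⟩, fun Φ hΦ s => ?_, ?_⟩
  · have hmemΦ : quadRefl s '' Φ ∈ quadFaces Θ := Or.inr ⟨s, Φ, hΦ, rfl⟩
    exact hA.image_eq hmemΦ (subset_of_mem_quadFaces hmemΦ)
  · rw [substT_eq_latticePoly hP ht, chart_latticePoly hpos le_rfl
      (indicator_eq_self.2 fun i _ => i.2), himage]
    congr 1
    ext C
    simp only [mem_image, exists_exists_and_eq_and, mem_ofPred_eq]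
    refine exists_congr fun F => ?_
    constructor
    · rintro ⟨hF, rfl⟩
      refine ⟨hF.1, hF.2.1, hF.2.2, ?_⟩
      rw [truncAtOne_eq_latticePoly hP hQ hF, chart_latticePoly hpos
        ((image_mono hF.1.subset).trans hsnd.subset) rfl]
    · rintro ⟨h1, h2, h3, rfl⟩
      have hF : F ∈ lowerCells (newtonPolytope3 P) := ⟨h1, h2, h3⟩
      refine ⟨hF, ?_⟩
      rw [truncAtOne_eq_latticePoly hP hQ hF, chart_latticePoly hpos
        ((image_mono hF.1.subset).trans hsnd.subset) rfl]
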